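/- Let Δ ∈ ℕ and c, d > 0. There exists a constant C > 0 depending only on Δ, c, d such that for every constant α > 0 there exists a constant C' > 0 depending only on Δ, c, d, α with the following property: for every finite connected vertex-transitive graph G of degree Δ satisfying V(r) ≤ c·r^d for all integers r ≥ 1, every vertex o, and every integer t with 1 ≤ t ≤ C·diam(G)², the lazy simple random walk on G satisfies P_lazy^t(o,o) ≤ C'/V(α·√t). -/

import Mathlib

open Filter

noncomputable section

/-- Transition matrix of the simple random walk on a finite graph. -/
noncomputable def srwMatrix {V : Type*} [Fintype V] (G : SimpleGraph V) [DecidableRel G.Adj] :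
    Matrix V V ℝ :=
  fun x y => if G.Adj x y then ((G.degree x : ℝ))⁻¹ else 0

/-- The lazy version `(I + P)/2` of a transition matrix `P`. -/
noncomputable def lazyMatrix {V : Type*} [Fintype V] [DecidableEq V] (P : Matrix V V ℝ) :
    Matrix V V ℝ :=
  (2 : ℝ)⁻¹ • (1 + P)

/-- Number of vertices within graph distance `s` of `o`. -/
noncomputable def ballCard {V : Type*} (G : SimpleGraph V) (o : V) (s : ℝ) : ℕ :=
  Nat.card {y : V | (G.dist o y : ℝ) ≤ s}

/-- A vertex-transitive graph. -/
def IsVertexTransitive {V : Type*} (G : SimpleGraph V) : Prop :=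
  ∀ x y : V, ∃ φ : G ≃g G, φ x = y

namespace TransitiveGrowth
open scoped Pointwise

/-- A symmetric generating set containing `1` and invariant under multiplication by `K`. -/
structure IsGenSet {A : Type} [Group A] (K : Subgroup A) (E : Set A) : Prop where
  one_mem : (1 : A) ∈ E
  inv_mem : ∀ g ∈ E, g⁻¹ ∈ E
  mul_mem : ∀ k ∈ K, ∀ g ∈ E, k * g ∈ E
  closure_eq : Subgroup.closure E = ⊤

/-- The number of left cosets of `K` that meet `S`. -/
def cosetCard {A : Type} [Group A] (K : Subgroup A) (S : Set A) : ℕ∞ :=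
  ((QuotientGroup.mk : A → A ⧸ K) '' S).encard

/-- The balls `E ^ r` meet at most `c * r ^ d` cosets of `K`. -/
def HasGrowth {A : Type} [Group A] (K : Subgroup A) (E : Set A) (c d : ℕ) : Prop :=
  ∀ r : ℕ, 1 ≤ r → cosetCard K (E ^ r) ≤ ((c * r ^ d : ℕ) : ℕ∞)

/-- The pair `(A, K)` has polynomial growth of degree at most `d`. -/
def PolyGrowth {A : Type} [Group A] (K : Subgroup A) (d : ℕ) : Prop :=
  ∃ (E : Set A) (c : ℕ), IsGenSet K E ∧ HasGrowth K E c d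

section basic

variable {A : Type} [Group A] {K : Subgroup A} {E : Set A}

lemma mul_mem_pow_add {x y : A} {m n : ℕ} (hx : x ∈ E ^ m) (hy : y ∈ E ^ n) :
    x * y ∈ E ^ (m + n) := by
  rw [pow_add]; exact Set.mul_mem_mul hx hy

namespace IsGenSet

variable (hE : IsGenSet K E)
include hE

lemma pow_mono {m n : ℕ} (h : m ≤ n) : E ^ m ⊆ E ^ n :=
  Set.pow_subset_pow_right hE.one_mem h

lemma one_mem_pow (n : ℕ) : (1 : A) ∈ E ^ n :=
  hE.pow_mono (Nat.zero_le n) (by simp)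

lemma subset_pow {n : ℕ} (hn : 1 ≤ n) : E ⊆ E ^ n := by
  simpa using hE.pow_mono hn

lemma le_genSet {k : A} (hk : k ∈ K) : k ∈ E := by
  simpa using hE.mul_mem k hk 1 hE.one_mem

lemma inv_mem_pow {n : ℕ} : ∀ {g : A}, g ∈ E ^ n → g⁻¹ ∈ E ^ n := by
  induction n with
  | zero => intro g hg; simpa using hg
  | succ n ih =>
    intro g hg
    rw [pow_succ] at hg
    obtain ⟨x, hx, y, hy, rfl⟩ := hg
    rw [mul_inv_rev, pow_succ']
    exact Set.mul_mem_mul (hE.inv_mem y hy) (ih hx)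

lemma mul_mem_pow {n : ℕ} (hn : 1 ≤ n) {k g : A} (hk : k ∈ K) (hg : g ∈ E ^ n) :
    k * g ∈ E ^ n := by
  obtain ⟨n, rfl⟩ := Nat.exists_eq_add_of_le hn
  rw [pow_add, pow_one] at hg ⊢
  obtain ⟨x, hx, y, hy, rfl⟩ := hg
  rw [← mul_assoc]
  exact Set.mul_mem_mul (hE.mul_mem k hk x hx) hy

lemma exists_mem_pow (g : A) : ∃ n : ℕ, 1 ≤ n ∧ g ∈ E ^ n := by
  have hg : g ∈ Subgroup.closure E := by rw [hE.closure_eq]; trivial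
  induction hg using Subgroup.closure_induction_left with
  | one => exact ⟨1, le_rfl, by simpa using hE.one_mem⟩
  | mul_left x hx y _ ih =>
    obtain ⟨n, hn, h⟩ := ih
    exact ⟨1 + n, by omega, mul_mem_pow_add (by simpa using hx) h⟩
  | inv_mul_cancel x hx y _ ih =>
    obtain ⟨n, hn, h⟩ := ih
    exact ⟨1 + n, by omega, mul_mem_pow_add (by simpa using hE.inv_mem x hx) h⟩

lemma exists_subset_pow {S : Set A} (hS : S.Finite) : ∃ n : ℕ, 1 ≤ n ∧ S ⊆ E ^ n := by
  induction S, hS using Set.Finite.induction_on with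
  | empty => exact ⟨1, le_rfl, by simp⟩
  | @insert a S _ _ ih =>
    obtain ⟨n, hn, h⟩ := ih
    obtain ⟨m, hm, h'⟩ := hE.exists_mem_pow a
    exact ⟨max m n, by omega, Set.insert_subset (hE.pow_mono (le_max_left _ _) h')
      (h.trans (hE.pow_mono (le_max_right _ _)))⟩

lemma pow {n : ℕ} (hn : 1 ≤ n) : IsGenSet K (E ^ n) where
  one_mem := hE.one_mem_pow n
  inv_mem := fun _ h => hE.inv_mem_pow h
  mul_mem := fun _ hk _ hg => hE.mul_mem_pow hn hk hg
  closure_eq := by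
    rw [eq_top_iff, ← hE.closure_eq]
    exact Subgroup.closure_mono (hE.subset_pow hn)

/-- If `F` contains `1` and `E * F ⊆ F * L`, then `F * L` is everything. -/
lemma exists_mem_mul {F L : Set A} (hF : 1 ∈ F) (hL : 1 ∈ L) (hLL : ∀ x ∈ L, ∀ y ∈ L, x * y ∈ L)
    (h : ∀ e ∈ E, ∀ f ∈ F, ∃ f' ∈ F, ∃ l ∈ L, e * f = f' * l) (g : A) :
    ∃ f ∈ F, ∃ l ∈ L, g = f * l := by
  have hg : g ∈ Subgroup.closure E := by rw [hE.closure_eq]; trivial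
  have key : ∀ e ∈ E, ∀ y, (∃ f ∈ F, ∃ l ∈ L, y = f * l) → ∃ f ∈ F, ∃ l ∈ L, e * y = f * l := by
    rintro e he y ⟨f, hf, l, hl, rfl⟩
    obtain ⟨f', hf', l', hl', h'⟩ := h e he f hf
    exact ⟨f', hf', l' * l, hLL _ hl' _ hl, by rw [← mul_assoc, h', mul_assoc]⟩
  induction hg using Subgroup.closure_induction_left with
  | one => exact ⟨1, hF, 1, hL, by simp⟩
  | mul_left x hx y _ ih => exact key x hx y ih
  | inv_mul_cancel x hx y _ ih => exact key _ (hE.inv_mem x hx) y ih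

end IsGenSet

lemma cosetCard_mono {S T : Set A} (h : S ⊆ T) : cosetCard K S ≤ cosetCard K T :=
  Set.encard_le_encard (Set.image_mono h)

lemma HasGrowth.pow {c d n : ℕ} (hg : HasGrowth K E c d) (hn : 1 ≤ n) :
    HasGrowth K (E ^ n) (c * n ^ d) d := by
  intro r hr
  rw [← pow_mul]
  refine (hg (n * r) (Nat.mul_pos hn hr)).trans (le_of_eq ?_)
  rw [mul_pow, mul_assoc]

lemma HasGrowth.finite {c d : ℕ} (hE : IsGenSet K E) (hg : HasGrowth K E c d) (r : ℕ) :
    ((QuotientGroup.mk : A → A ⧸ K) '' (E ^ r)).Finite := by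
  refine Set.Finite.subset (Set.finite_of_encard_le_coe (hg (max 1 r) (le_max_left _ _)))
    (Set.image_mono (hE.pow_mono (le_max_right _ _)))

end basic

/-- Polynomial growth passes to subgroups generated by bounded elements. -/
lemma polyGrowth_subgroupOf {A : Type} [Group A] {K : Subgroup A} {E : Set A} {m : ℕ}
    (hE : IsGenSet K E) (hm : 1 ≤ m) (H : Subgroup A)
    (hH : H ≤ Subgroup.closure (E ^ m ∩ H)) :
    IsGenSet (K.subgroupOf H) ((↑) ⁻¹' (E ^ m) : Set H) ∧
    ∀ r : ℕ, cosetCard (K.subgroupOf H) (((↑) ⁻¹' (E ^ m) : Set H) ^ r) ≤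
      cosetCard K (E ^ (m * r) ∩ H) := by
  refine ⟨⟨hE.one_mem_pow m, fun g h => ?_, fun k hk g h => ?_, ?_⟩, fun r => ?_⟩
  · simpa using hE.inv_mem_pow h
  · simpa using hE.mul_mem_pow hm (Subgroup.mem_subgroupOf.1 hk) h
  · rw [eq_top_iff]
    rintro ⟨x, hx⟩ -
    have h1 := hH hx
    have h2 : E ^ m ∩ H = H.subtype '' ((↑) ⁻¹' (E ^ m) : Set H) := by
      ext y; constructor
      · rintro ⟨h, h'⟩; exact ⟨⟨y, h'⟩, h, rfl⟩
      · rintro ⟨⟨z, hz⟩, h, rfl⟩; exact ⟨h, hz⟩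
    rw [h2, ← MonoidHom.map_closure] at h1
    obtain ⟨y, hy, hxy⟩ := h1
    have : y = ⟨x, hx⟩ := Subtype.ext hxy
    exact this ▸ hy
  · have hsub : ∀ x : H, x ∈ ((↑) ⁻¹' (E ^ m) : Set H) ^ r → (x : A) ∈ E ^ (m * r) := by
      induction r with
      | zero => intro x hx; simp at hx; simp [hx]
      | succ r ih =>
        intro x hx
        rw [pow_succ] at hx
        obtain ⟨y, hy, z, hz, rfl⟩ := hx
        rw [Nat.mul_succ]
        exact mul_mem_pow_add (ih _ hy) hz
    let F : H ⧸ K.subgroupOf H → A ⧸ K := Quotient.map' (fun x : H => (x : A)) (by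
      intro a b h
      rw [QuotientGroup.leftRel_apply] at h ⊢
      exact h)
    have hF : ∀ x : H, F (QuotientGroup.mk x) = QuotientGroup.mk (x : A) := fun x => rfl
    refine Set.encard_le_encard_of_injOn (f := F) ?_ ?_
    · rintro _ ⟨x, hx, rfl⟩
      exact ⟨x, ⟨hsub x hx, x.2⟩, rfl⟩
    · rintro _ ⟨x, hx, rfl⟩ _ ⟨y, hy, rfl⟩ h
      rw [hF, hF, QuotientGroup.eq] at h
      exact QuotientGroup.eq.2 h

lemma PolyGrowth.of_closure {A : Type} [Group A] {K : Subgroup A} {E : Set A} {c d m : ℕ}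
    (hE : IsGenSet K E) (hg : HasGrowth K E c d) (hm : 1 ≤ m) (H : Subgroup A)
    (hH : H ≤ Subgroup.closure (E ^ m ∩ H)) : PolyGrowth (K.subgroupOf H) d := by
  obtain ⟨h1, h2⟩ := polyGrowth_subgroupOf hE hm H hH
  refine ⟨_, c * m ^ d, h1, fun r hr => (h2 r).trans ?_⟩
  refine (cosetCard_mono Set.inter_subset_left).trans ?_
  refine (hg (m * r) (Nat.mul_pos hm hr)).trans (le_of_eq ?_)
  rw [mul_pow, mul_assoc]

/-- Polynomial growth passes to finite-index subgroups. -/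
lemma PolyGrowth.finiteIndex {A : Type} [Group A] {K : Subgroup A} {d : ℕ} (h : PolyGrowth K d)
    (H : Subgroup A) [H.FiniteIndex] : PolyGrowth (K.subgroupOf H) d := by
  obtain ⟨E, c, hE, hg⟩ := h
  have hfin : (Set.range (fun q : A ⧸ H => q.out)).Finite := Set.finite_range _
  obtain ⟨m, hm, hsub⟩ := hE.exists_subset_pow hfin
  refine PolyGrowth.of_closure hE hg (m := 2 * m + 1) (by omega) H ?_
  intro x hx
  set L := Subgroup.closure (E ^ (2 * m + 1) ∩ (H : Set A)) with hL
  have hLH : L ≤ H := (Subgroup.closure_le _).2 Set.inter_subset_right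
  obtain ⟨f, hf, l, hl, rfl⟩ := hE.exists_mem_mul (F := E ^ m) (L := L) (hE.one_mem_pow m)
    L.one_mem (fun x hx y hy => L.mul_mem hx hy) (fun e he f hf => by
      refine ⟨(QuotientGroup.mk (e * f) : A ⧸ H).out, hsub ⟨_, rfl⟩,
        (QuotientGroup.mk (e * f) : A ⧸ H).out⁻¹ * (e * f), ?_, by group⟩
      refine Subgroup.subset_closure ⟨?_, ?_⟩
      · have : 2 * m + 1 = m + (1 + m) := by ring
        rw [this]
        exact mul_mem_pow_add (hE.inv_mem_pow (hsub ⟨_, rfl⟩))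
          (mul_mem_pow_add (by simpa using he) hf)
      · have := QuotientGroup.out_eq' (QuotientGroup.mk (e * f) : A ⧸ H)
        exact QuotientGroup.eq.1 this) x
  have hfH : f ∈ H := by
    have := H.mul_mem hx (H.inv_mem (hLH hl))
    simpa using this
  exact L.mul_mem (Subgroup.subset_closure ⟨hE.pow_mono (by omega) hf, hfH⟩) hl

/-- Polynomial growth passes to quotients in which the image of `K` is finite. -/
lemma PolyGrowth.map {A B : Type} [Group A] [Group B] {K : Subgroup A} {d : ℕ}
    (h : PolyGrowth K d) (f : A →* B) (hf : Function.Surjective f)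
    (hK : (f '' (K : Set A)).Finite) : PolyGrowth (⊥ : Subgroup B) d := by
  obtain ⟨E, c, hE, hg⟩ := h
  refine ⟨f '' E, c * (f '' (K : Set A)).ncard, ⟨⟨1, hE.one_mem, map_one f⟩, ?_, ?_, ?_⟩, ?_⟩
  · rintro _ ⟨g, hg, rfl⟩; exact ⟨g⁻¹, hE.inv_mem g hg, map_inv f g⟩
  · rintro k hk _ ⟨g, hg, rfl⟩
    rw [Subgroup.mem_bot] at hk
    exact ⟨g, hg, by simp [hk]⟩
  · rw [← MonoidHom.map_closure, hE.closure_eq, ← MonoidHom.range_eq_map,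
      MonoidHom.range_eq_top.2 hf]
  · intro r hr
    have h1 : (f '' E) ^ r = f '' (E ^ r) := (Set.image_pow f E r).symm
    rw [h1]
    refine (Set.encard_image_le _ _).trans ?_
    have h2 : f '' (E ^ r) ⊆ (fun p : (A ⧸ K) × B => f p.1.out * p.2) ''
        ((QuotientGroup.mk '' (E ^ r) : Set (A ⧸ K)) ×ˢ (f '' (K : Set A))) := by
      rintro _ ⟨g, hg, rfl⟩
      refine ⟨(QuotientGroup.mk g, f ((QuotientGroup.mk g : A ⧸ K).out⁻¹ * g)),
        ⟨⟨g, hg, rfl⟩, ⟨_, ?_, rfl⟩⟩, ?_⟩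
      · exact QuotientGroup.eq.1 (QuotientGroup.out_eq' (QuotientGroup.mk g : A ⧸ K))
      · simp
    refine (Set.encard_le_encard h2).trans ((Set.encard_image_le _ _).trans ?_)
    rw [Set.encard_prod, ← hK.cast_ncard_eq]
    refine (mul_le_mul_left (hg r hr) _).trans (le_of_eq ?_)
    push_cast; ring

end TransitiveGrowth

namespace TransitiveGrowth
open scoped Pointwise

lemma exists_poly_lt_two_pow (c a d : ℕ) : ∃ n : ℕ, 1 ≤ n ∧ c * (a * n) ^ d < 2 ^ n := by
  have h := tendsto_pow_const_div_const_pow_of_one_lt d (r := 2) (by norm_num)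
  have h2 : ∀ᶠ n : ℕ in atTop, (n : ℝ) ^ d / 2 ^ n < 1 / (c * a ^ d + 1) :=
    h.eventually (gt_mem_nhds (by positivity))
  obtain ⟨n, hn, hn1⟩ := (h2.and (eventually_ge_atTop 1)).exists
  refine ⟨n, hn1, ?_⟩
  rw [div_lt_div_iff₀ (by positivity) (by positivity)] at hn
  have h3 : ((c * (a * n) ^ d : ℕ) : ℝ) < ((2 ^ n : ℕ) : ℝ) := by
    push_cast
    rw [mul_pow]
    have : (0 : ℝ) ≤ (n : ℝ) ^ d := by positivity
    nlinarith
  exact_mod_cast h3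

/-- The products `∏ (s ^ i r s ^ (-i)) ^ εᵢ` with `εᵢ ∈ {0, 1}`, `i < n`, in decreasing order. -/
def conjProducts {A : Type} [Group A] (s r : A) : ℕ → Set A
  | 0 => {1}
  | n + 1 => conjProducts s r n ∪ (s ^ n * r * (s ^ n)⁻¹) • conjProducts s r n

section

variable {A : Type} [Group A] {K : Subgroup A} {E : Set A}

lemma conjProducts_length (hE : IsGenSet K E) {s r : A} {a b : ℕ} (hs : s ∈ E ^ a)
    (hr : r ∈ E ^ b) (n : ℕ) : ∀ x ∈ conjProducts s r n, (s ^ n)⁻¹ * x ∈ E ^ ((a + b) * n) := by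
  induction n with
  | zero => intro x hx; simpa [conjProducts] using hx
  | succ n ih =>
    rintro x (hx | ⟨y, hy, rfl⟩)
    · have : (s ^ (n + 1))⁻¹ * x = s⁻¹ * ((s ^ n)⁻¹ * x) := by rw [pow_succ]; group
      rw [this]
      refine hE.pow_mono ?_ (mul_mem_pow_add (hE.inv_mem_pow hs) (ih x hx))
      nlinarith
    · have : (s ^ (n + 1))⁻¹ * ((s ^ n * r * (s ^ n)⁻¹) • y) = s⁻¹ * (r * ((s ^ n)⁻¹ * y)) := by
        rw [pow_succ, smul_eq_mul]; group
      simp only [this]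
      refine hE.pow_mono ?_ (mul_mem_pow_add (hE.inv_mem_pow hs) (mul_mem_pow_add hr (ih y hy)))
      nlinarith

/-- In a pair of polynomial growth the conjugates of an element by powers satisfy a relation. -/
lemma exists_conj_relation {c d : ℕ} (hE : IsGenSet K E) (hg : HasGrowth K E c d) (s r : A) :
    ∃ n : ℕ, ∃ x ∈ conjProducts s r n, ∃ y ∈ conjProducts s r n, ∃ k ∈ K,
      s ^ n * r * (s ^ n)⁻¹ * x = y * k := by
  by_contra! hcon
  obtain ⟨a, -, hs⟩ := hE.exists_mem_pow s
  obtain ⟨b, -, hr⟩ := hE.exists_mem_pow r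
  have hcard : ∀ n, cosetCard K (conjProducts s r n) = ((2 ^ n : ℕ) : ℕ∞) := by
    intro n
    induction n with
    | zero => simp [conjProducts, cosetCard]
    | succ n ih =>
      have hdisj : Disjoint (QuotientGroup.mk '' (conjProducts s r n) : Set (A ⧸ K))
          (QuotientGroup.mk '' ((s ^ n * r * (s ^ n)⁻¹) • conjProducts s r n) : Set (A ⧸ K)) := by
        rw [Set.disjoint_left]
        rintro _ ⟨y, hy, rfl⟩ ⟨_, ⟨x, hx, rfl⟩, h⟩
        refine hcon n x hx y hy _ (QuotientGroup.eq.1 h.symm) ?_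
        simp
      have himg : (QuotientGroup.mk '' ((s ^ n * r * (s ^ n)⁻¹) • conjProducts s r n) : Set (A ⧸ K))
          = (fun q : A ⧸ K => (s ^ n * r * (s ^ n)⁻¹) • q) ''
            (QuotientGroup.mk '' (conjProducts s r n)) := by
        rw [Set.image_image]
        ext q; constructor
        · rintro ⟨_, ⟨x, hx, rfl⟩, rfl⟩; exact ⟨x, hx, rfl⟩
        · rintro ⟨x, hx, rfl⟩; exact ⟨_, ⟨x, hx, rfl⟩, rfl⟩
      have hinj := MulAction.injective (β := A ⧸ K) (s ^ n * r * (s ^ n)⁻¹)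
      unfold cosetCard at ih ⊢
      rw [conjProducts, Set.image_union, Set.encard_union_eq hdisj, himg, hinj.encard_image, ih]
      rw [pow_succ]; push_cast; ring
  have hsub : ∀ n, conjProducts s r n ⊆ E ^ ((a + b + a) * n) := by
    intro n x hx
    have h1 := conjProducts_length hE hs hr n x hx
    have h2 : s ^ n ∈ E ^ (a * n) := by rw [pow_mul]; exact Set.pow_mem_pow hs
    have h3 := mul_mem_pow_add h2 h1
    rw [mul_inv_cancel_left] at h3
    exact hE.pow_mono (by nlinarith) h3
  obtain ⟨n, hn, hlt⟩ := exists_poly_lt_two_pow c (a + b + a + 1) d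
  have h1 := cosetCard_mono (K := K) (hsub n)
  rw [hcard] at h1
  have h2 := h1.trans (cosetCard_mono (hE.pow_mono (show _ ≤ (a + b + a + 1) * n by nlinarith)))
  have h3 := h2.trans (hg _ (Nat.mul_pos (by omega) hn))
  have h4 : 2 ^ n ≤ c * ((a + b + a + 1) * n) ^ d := by exact_mod_cast h3
  omega

/-- All conjugates of `Y` by positive powers of `s` lie in the group generated by finitely many. -/
lemma exists_conj_mem_closure {c d : ℕ} (hE : IsGenSet K E) (hg : HasGrowth K E c d) (s : A)
    {Y : Set A} (hKY : ∀ k ∈ K, k ∈ Y) (hsK : ∀ k ∈ K, s * k * s⁻¹ ∈ Y)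
    (hYf : ((QuotientGroup.mk : A → A ⧸ K) '' Y).Finite) :
    ∃ J : ℕ, ∀ j : ℕ, ∀ y ∈ Y, s ^ j * y * (s ^ j)⁻¹ ∈
      Subgroup.closure {x | ∃ i ≤ J, ∃ y ∈ Y, x = s ^ i * y * (s ^ i)⁻¹} := by
  choose! n hn using fun r : A => exists_conj_relation hE hg s r
  obtain ⟨R, hRY, hRf, hR⟩ : ∃ R ⊆ Y, R.Finite ∧
      (QuotientGroup.mk : A → A ⧸ K) '' R = (QuotientGroup.mk : A → A ⧸ K) '' Y :=
    (Set.exists_subset_bijOn Y (QuotientGroup.mk : A → A ⧸ K)).elim fun R hR =>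
      ⟨R, hR.1, Set.Finite.of_finite_image (by rw [hR.2.image_eq]; exact hYf) hR.2.injOn,
        hR.2.image_eq⟩
  obtain ⟨J, hJ⟩ := (hRf.image n).bddAbove
  refine ⟨J, fun j => ?_⟩
  set P := Subgroup.closure {x | ∃ i ≤ J, ∃ y ∈ Y, x = s ^ i * y * (s ^ i)⁻¹} with hP
  induction j using Nat.strong_induction_on with
  | _ j ih =>
    intro y hy
    by_cases hjJ : j ≤ J
    · exact Subgroup.subset_closure ⟨j, hjJ, y, hy, rfl⟩
    obtain ⟨r, hr, hry⟩ : (QuotientGroup.mk y : A ⧸ K) ∈ (QuotientGroup.mk : A → A ⧸ K) '' R := by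
      rw [hR]; exact ⟨y, hy, rfl⟩
    have hk := QuotientGroup.eq.1 hry
    have hKconj : ∀ i ≤ j, ∀ k ∈ K, s ^ i * k * (s ^ i)⁻¹ ∈ P := by
      intro i hi k hk
      rcases i with _ | i
      · exact Subgroup.subset_closure ⟨0, Nat.zero_le _, k, hKY k hk, rfl⟩
      · have := ih i hi _ (hsK k hk)
        have h2 : s ^ (i + 1) * k * (s ^ (i + 1))⁻¹ = s ^ i * (s * k * s⁻¹) * (s ^ i)⁻¹ := by
          rw [pow_succ]; group
        rwa [h2]
    have hrP : s ^ j * r * (s ^ j)⁻¹ ∈ P := by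
      obtain ⟨x, hx, z, hz, k, hk, hrel⟩ := hn r
      have hnr : n r ≤ J := hJ ⟨r, hr, rfl⟩
      set p := j - n r with hp
      have hpj : p + n r = j := by omega
      have hprod : ∀ m ≤ n r, ∀ x ∈ conjProducts s r m, s ^ p * x * (s ^ p)⁻¹ ∈ P := by
        intro m
        induction m with
        | zero => intro _ x hx; simp only [conjProducts, Set.mem_singleton_iff] at hx
                  simp [hx, P.one_mem]
        | succ m ihm =>
          rintro hm x (hx | ⟨y, hy, rfl⟩)
          · exact ihm (by omega) x hx
          · have h1 := ihm (by omega) y hy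
            have h2 := ih (p + m) (by omega) r (hRY hr)
            have h3 := P.mul_mem h2 h1
            convert h3 using 1
            simp only [pow_add, smul_eq_mul]; group
      have h1 := hprod _ le_rfl x hx
      have h2 := hprod _ le_rfl z hz
      have h3 := hKconj p (by omega) k hk
      have h4 := P.mul_mem (P.mul_mem h2 h3) (P.inv_mem h1)
      convert h4 using 1
      have h5 : s ^ n r * r * (s ^ n r)⁻¹ = z * k * x⁻¹ := by rw [← hrel]; group
      calc s ^ j * r * (s ^ j)⁻¹ = s ^ p * (s ^ n r * r * (s ^ n r)⁻¹) * (s ^ p)⁻¹ := by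
            rw [← hpj, pow_add]; group
        _ = _ := by rw [h5]; group
    have := P.mul_mem hrP (hKconj j le_rfl _ hk)
    convert this using 1
    group

end

/-- If `φ` is constant on cosets and pairwise distinct translates of a set by
`w 0, …, w (r - 1)` fit into a ball, the cardinality drops by a factor `r`. -/
lemma mul_encard_le {α β : Type} {S : Set α} {T : Set β} (r : ℕ) (F : ℕ → α → β)
    (hF : ∀ j < r, ∀ x ∈ S, F j x ∈ T)
    (hinj : ∀ i < r, ∀ j < r, ∀ x ∈ S, ∀ y ∈ S, F i x = F j y → i = j ∧ x = y) :
    (r : ℕ∞) * S.encard ≤ T.encard := by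
  have h1 : (((Finset.range r : Finset ℕ) : Set ℕ) ×ˢ S).encard = (r : ℕ∞) * S.encard := by
    rw [Set.encard_prod, Set.encard_coe_eq_coe_finsetCard, Finset.card_range]
  rw [← h1]
  refine Set.encard_le_encard_of_injOn (f := fun p => F p.1 p.2) ?_ ?_
  · rintro ⟨j, x⟩ ⟨hj, hx⟩
    exact hF j (by simpa using hj) x hx
  · rintro ⟨j, x⟩ ⟨hj, hx⟩ ⟨i, y⟩ ⟨hi, hy⟩ h
    obtain ⟨h1, h2⟩ := hinj j (by simpa using hj) i (by simpa using hi) x hx y hy h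
    exact Prod.ext h1 h2

lemma ENat.le_of_mul_le {r n : ℕ} {x : ℕ∞} (hr : 1 ≤ r) (h : (r : ℕ∞) * x ≤ ((r * n : ℕ) : ℕ∞)) :
    x ≤ n := by
  induction x using ENat.recTopCoe with
  | top =>
    rw [ENat.mul_top (by exact_mod_cast (by omega : r ≠ 0))] at h
    exact absurd h (not_le.2 (ENat.natCast_lt_top _))
  | coe a =>
    have : r * a ≤ r * n := by exact_mod_cast h
    exact_mod_cast Nat.le_of_mul_le_mul_left this (by omega)

/-- The kernel of a homomorphism onto `ℤ` has polynomial growth of smaller degree. -/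
lemma PolyGrowth.ker {A : Type} [Group A] {K : Subgroup A} {d : ℕ} (h : PolyGrowth K (d + 1))
    (φ : A →* Multiplicative ℤ) (hφ : Function.Surjective φ) (hK : K ≤ φ.ker) :
    PolyGrowth (K.subgroupOf φ.ker) d := by
  obtain ⟨E₀, c₀, hE₀, hg₀⟩ := h
  obtain ⟨t, ht⟩ := hφ (Multiplicative.ofAdd 1)
  obtain ⟨n, hn, htn⟩ := hE₀.exists_mem_pow t
  obtain ⟨E, c, hE, hg, htE⟩ : ∃ (E : Set A) (c : ℕ), IsGenSet K E ∧ HasGrowth K E c (d + 1) ∧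
      t ∈ E := ⟨_, _, hE₀.pow hn, hg₀.pow hn, htn⟩
  clear hE₀ hg₀ htn
  have hφt : ∀ j : ℤ, φ (t ^ j) = Multiplicative.ofAdd j := by
    intro j; rw [map_zpow, ht, ← ofAdd_zsmul]; simp
  have htz : ∀ j : ℤ, t ^ j ∈ E ^ j.natAbs := by
    intro j
    obtain h | h := Int.natAbs_eq j
    · have h2 : t ^ j = t ^ j.natAbs := by conv_lhs => rw [h, zpow_natCast]
      rw [h2]; exact Set.pow_mem_pow htE
    · have h2 : t ^ j = (t ^ j.natAbs)⁻¹ := by conv_lhs => rw [h, zpow_neg, zpow_natCast]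
      rw [h2]; exact hE.inv_mem_pow (Set.pow_mem_pow htE)
  -- `φ` is bounded on `E`
  obtain ⟨p, hp⟩ : ∃ p : ℕ, ∀ e ∈ E, (Multiplicative.toAdd (φ e)).natAbs ≤ p := by
    have hfin : (φ '' E).Finite := by
      have : φ '' E ⊆ (fun q : A ⧸ K => φ q.out) '' (QuotientGroup.mk '' (E ^ 1)) := by
        rintro _ ⟨e, he, rfl⟩
        refine ⟨_, ⟨e, by simpa using he, rfl⟩, ?_⟩
        have h1 := hK (QuotientGroup.eq.1 (QuotientGroup.out_eq' (QuotientGroup.mk e : A ⧸ K)))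
        rw [MonoidHom.mem_ker, map_mul, map_inv] at h1
        exact inv_mul_eq_one.1 h1
      exact ((hg.finite hE 1).image _).subset this
    obtain ⟨p, hp⟩ := (hfin.image fun x => (Multiplicative.toAdd x).natAbs).bddAbove
    exact ⟨p, fun e he => hp ⟨_, ⟨e, he, rfl⟩, rfl⟩⟩
  set Y : Set A := E ^ (p + 3) ∩ φ.ker with hY
  have hYf : ((QuotientGroup.mk : A → A ⧸ K) '' Y).Finite :=
    (hg.finite hE (p + 3)).subset (Set.image_mono Set.inter_subset_left)
  have hKY : ∀ k ∈ K, k ∈ Y := fun k hk =>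
    ⟨hE.subset_pow (by omega) (hE.le_genSet hk), hK hk⟩
  have hconj : ∀ s ∈ E, ∀ k ∈ K, s * k * s⁻¹ ∈ Y := by
    intro s hs k hk
    refine ⟨?_, ?_⟩
    · refine hE.pow_mono (show 1 + 1 + 1 ≤ p + 3 by omega) (mul_mem_pow_add (mul_mem_pow_add
        (by simpa using hs) (by simpa using hE.le_genSet hk)) (by simpa using hE.inv_mem s hs))
    · exact φ.normal_ker.conj_mem k (hK hk) s
  obtain ⟨J₁, hJ₁⟩ := exists_conj_mem_closure hE hg t hKY (hconj t htE) hYf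
  obtain ⟨J₂, hJ₂⟩ := exists_conj_mem_closure hE hg t⁻¹ hKY (hconj _ (hE.inv_mem t htE)) hYf
  set m := J₁ + J₂ + (p + 3) + (J₁ + J₂) with hm
  set L := Subgroup.closure (E ^ m ∩ (φ.ker : Set A)) with hL
  have hLφ : L ≤ φ.ker := (Subgroup.closure_le _).2 Set.inter_subset_right
  have hgenL : ∀ s ∈ E, ∀ J ≤ J₁ + J₂,
      Subgroup.closure {x | ∃ i ≤ J, ∃ y ∈ Y, x = s ^ i * y * (s ^ i)⁻¹} ≤ L := by
    intro s hs J hJ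
    refine (Subgroup.closure_le _).2 ?_
    rintro _ ⟨i, hi, y, hy, rfl⟩
    have hsi := hE.pow_mono (hi.trans hJ) (Set.pow_mem_pow hs)
    exact Subgroup.subset_closure ⟨mul_mem_pow_add (mul_mem_pow_add hsi hy.1)
      (hE.inv_mem_pow hsi), φ.normal_ker.conj_mem y hy.2 _⟩
  have hconjL : ∀ j : ℤ, ∀ y ∈ Y, t ^ j * y * (t ^ j)⁻¹ ∈ L := by
    intro j y hy
    obtain h | h := Int.natAbs_eq j
    · rw [h, zpow_natCast]
      exact hgenL t htE J₁ (by omega) (hJ₁ _ y hy)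
    · rw [h, zpow_neg, zpow_natCast, ← inv_pow]
      exact hgenL _ (hE.inv_mem t htE) J₂ (by omega) (hJ₂ _ y hy)
  -- all conjugates by powers of `t` generate the kernel
  set M := Subgroup.closure {x | ∃ j : ℤ, ∃ y ∈ Y, x = t ^ j * y * (t ^ j)⁻¹} with hM
  have hML : M ≤ L := (Subgroup.closure_le _).2 (by rintro _ ⟨j, y, hy, rfl⟩; exact hconjL j y hy)
  have hMconj : ∀ j : ℤ, ∀ x ∈ M, t ^ j * x * (t ^ j)⁻¹ ∈ M := by
    intro j x hx
    have : M ≤ M.comap (MulAut.conj (t ^ j)).toMonoidHom := by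
      refine (Subgroup.closure_le _).2 ?_
      rintro _ ⟨i, y, hy, rfl⟩
      refine Subgroup.subset_closure ⟨j + i, y, hy, ?_⟩
      simp only [MulEquiv.toMonoidHom_eq_coe, MonoidHom.coe_coe, MulAut.conj_apply]
      rw [zpow_add]; group
    exact this hx
  have hker : φ.ker ≤ L := by
    intro x hx
    obtain ⟨f, ⟨y, hy, j, rfl⟩, l, hl, rfl⟩ := hE.exists_mem_mul (L := {1})
      (F := {x | ∃ y ∈ M, ∃ j : ℤ, x = y * t ^ j}) ⟨1, M.one_mem, 0, by simp⟩
      rfl (by simp) (by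
        rintro e he _ ⟨y, hy, j, rfl⟩
        set q := Multiplicative.toAdd (φ e) with hq
        have hY' : e * (t ^ q)⁻¹ ∈ Y := by
          refine ⟨hE.pow_mono (show 1 + q.natAbs ≤ p + 3 by have := hp e he; omega)
            (mul_mem_pow_add (by simpa using he) (hE.inv_mem_pow (htz q))), ?_⟩
          change φ _ = 1
          rw [map_mul, map_inv, hφt]; simp [hq]
        refine ⟨e * y * t ^ j, ⟨e * (t ^ q)⁻¹ * (t ^ q * y * (t ^ q)⁻¹), ?_, q + j, ?_⟩, 1, rfl,
          by group⟩
        · exact M.mul_mem (Subgroup.subset_closure ⟨0, _, hY', by simp⟩) (hMconj q y hy)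
        · rw [zpow_add]; group) x
    obtain rfl : l = 1 := hl
    have h1 : φ y = 1 := hLφ (hML hy)
    rw [mul_one, MonoidHom.mem_ker, map_mul, h1, hφt, one_mul] at hx
    have : j = 0 := hx
    subst this
    simpa using hML hy
  obtain ⟨h1, h2⟩ := polyGrowth_subgroupOf hE (show 1 ≤ m by omega) φ.ker hker
  refine ⟨_, c * (m + 1) ^ (d + 1), h1, fun r hr => (h2 r).trans ?_⟩
  refine ENat.le_of_mul_le hr ?_
  have h3 : (r : ℕ∞) * cosetCard K (E ^ (m * r) ∩ φ.ker) ≤ cosetCard K (E ^ ((m + 1) * r)) := by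
    refine mul_encard_le r (fun j q => t ^ j • q) ?_ ?_
    · rintro j hj _ ⟨x, ⟨hx, -⟩, rfl⟩
      exact ⟨t ^ j * x, hE.pow_mono (show j + m * r ≤ (m + 1) * r by nlinarith)
        (mul_mem_pow_add (Set.pow_mem_pow htE) hx), rfl⟩
    · rintro i hi j hj _ ⟨x, ⟨-, hx⟩, rfl⟩ _ ⟨y, ⟨-, hy⟩, rfl⟩ h
      have hij : i = j := by
        have h4 := hK (QuotientGroup.eq.1 h)
        rw [MonoidHom.mem_ker, map_mul, map_inv] at h4
        have h5 := inv_mul_eq_one.1 h4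
        simp only [smul_eq_mul, map_mul] at h5
        rw [show φ x = 1 from hx, show φ y = 1 from hy, mul_one, mul_one, ← zpow_natCast,
          ← zpow_natCast, hφt, hφt] at h5
        have : (i : ℤ) = j := h5
        exact_mod_cast this
      subst hij
      exact ⟨rfl, MulAction.injective _ h⟩
  refine (h3.trans (hg _ (Nat.mul_pos (by omega) hr))).trans (le_of_eq ?_)
  rw [mul_pow]; push_cast; ring

/-- Quotients by an infinite cyclic subgroup have polynomial growth of smaller degree. -/
lemma PolyGrowth.quotient_zpowers {A B : Type} [Group A] [Group B] {d : ℕ}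
    (h : PolyGrowth (⊥ : Subgroup A) (d + 1)) (f : A →* B) (hf : Function.Surjective f) (z : A)
    (hz : f z = 1) (hinf : ¬ IsOfFinOrder z) : PolyGrowth (⊥ : Subgroup B) d := by
  obtain ⟨E, c, hE, hg⟩ := h
  obtain ⟨a, ha, hza⟩ := hE.exists_mem_pow z
  refine ⟨f '' E, c * (a + 1) ^ (d + 1), ⟨⟨1, hE.one_mem, map_one f⟩, ?_, ?_, ?_⟩, ?_⟩
  · rintro _ ⟨g, hg, rfl⟩; exact ⟨g⁻¹, hE.inv_mem g hg, map_inv f g⟩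
  · rintro k hk _ ⟨g, hg, rfl⟩
    rw [Subgroup.mem_bot] at hk
    exact ⟨g, hg, by simp [hk]⟩
  · rw [← MonoidHom.map_closure, hE.closure_eq, ← MonoidHom.range_eq_map,
      MonoidHom.range_eq_top.2 hf]
  · intro r hr
    have h1 : (f '' E) ^ r = f '' (E ^ r) := (Set.image_pow f E r).symm
    rw [h1]
    refine (Set.encard_image_le _ _).trans (ENat.le_of_mul_le hr ?_)
    obtain ⟨R, hR, hbij⟩ := Set.exists_subset_bijOn (E ^ r) f
    rw [← hbij.image_eq, hbij.injOn.encard_image]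
    have h3 : (r : ℕ∞) * R.encard ≤ cosetCard (⊥ : Subgroup A) (E ^ ((a + 1) * r)) := by
      refine mul_encard_le r (fun j x => QuotientGroup.mk (z ^ j * x)) ?_ ?_
      · intro j hj x hx
        refine ⟨_, hE.pow_mono (show a * j + r ≤ (a + 1) * r by nlinarith)
          (mul_mem_pow_add ?_ (hR hx)), rfl⟩
        rw [pow_mul]; exact Set.pow_mem_pow hza
      · intro i hi j hj x hx y hy h
        have h4 := QuotientGroup.eq.1 h
        rw [Subgroup.mem_bot, inv_mul_eq_one] at h4
        have h5 := congrArg f h4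
        simp only [map_mul, map_pow, hz, one_pow, one_mul] at h5
        obtain rfl := hbij.injOn hx hy h5
        exact ⟨injective_pow_iff_not_isOfFinOrder.2 hinf (mul_right_cancel h4), rfl⟩
    refine (h3.trans (hg _ (Nat.mul_pos (by omega) hr))).trans (le_of_eq ?_)
    rw [mul_pow]; push_cast; ring

/-- Growth of degree `0` means that there are finitely many cosets. -/
lemma PolyGrowth.finite_of_zero {A : Type} [Group A] {K : Subgroup A} (h : PolyGrowth K 0) :
    Finite (A ⧸ K) := by
  obtain ⟨E, c, hE, hg⟩ := h
  by_contra hinf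
  rw [not_finite_iff_infinite] at hinf
  obtain ⟨S, hS⟩ := Infinite.exists_subset_card_eq (A ⧸ K) (c + 1)
  obtain ⟨r, hr, hsub⟩ := hE.exists_subset_pow
    ((S.finite_toSet).image (fun q : A ⧸ K => q.out))
  have h1 : (S : Set (A ⧸ K)) ⊆ QuotientGroup.mk '' (E ^ r) := fun q hq =>
    ⟨q.out, hsub ⟨q, hq, rfl⟩, QuotientGroup.out_eq' q⟩
  have h2 := (Set.encard_le_encard h1).trans (hg r hr)
  rw [Set.encard_coe_eq_coe_finsetCard, hS] at h2
  have : c + 1 ≤ c * r ^ 0 := by exact_mod_cast h2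
  simp at this

end TransitiveGrowth

namespace TransitiveGrowth
open scoped Topology InnerProductSpace

/-- The average of `f` over the neighbours of `x`. -/
def avg {X W : Type} [AddCommGroup W] [Module ℝ W] (N : X → Finset X) (f : X → W) (x : X) : W :=
  ((N x).card : ℝ)⁻¹ • ∑ y ∈ N x, f y

/-- A transitive, symmetric, connected neighbourhood system containing the diagonal. -/
structure IsWalk (A : Type) {X : Type} [Group A] [MulAction A X] (N : X → Finset X) : Prop where
  self_mem : ∀ x, x ∈ N x
  symm : ∀ x y, y ∈ N x → x ∈ N y
  smul_mem : ∀ (g : A) x y, y ∈ N x → g • y ∈ N (g • x)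
  trans : ∀ x y : X, ∃ g : A, g • x = y
  conn : ∀ x y : X, Relation.ReflTransGen (fun x y => y ∈ N x) x y

section avg

variable {X W W' : Type} [AddCommGroup W] [Module ℝ W] [AddCommGroup W'] [Module ℝ W']
  {N : X → Finset X}

lemma avg_map (L : W →ₗ[ℝ] W') (f : X → W) : avg N (fun x => L (f x)) = fun x => L (avg N f x) := by
  ext x; simp [avg, map_sum]

lemma avg_iterate_map (L : W →ₗ[ℝ] W') (f : X → W) (n : ℕ) :
    (avg N)^[n] (fun x => L (f x)) = fun x => L ((avg N)^[n] f x) := by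
  induction n with
  | zero => rfl
  | succ n ih => rw [Function.iterate_succ_apply', Function.iterate_succ_apply', ih, avg_map]

lemma avg_add (f g : X → W) : avg N (fun x => f x + g x) = fun x => avg N f x + avg N g x := by
  ext x; simp [avg, Finset.sum_add_distrib]

lemma avg_iterate_add (f g : X → W) (n : ℕ) :
    (avg N)^[n] (fun x => f x + g x) = fun x => (avg N)^[n] f x + (avg N)^[n] g x := by
  induction n with
  | zero => rfl
  | succ n ih => simp only [Function.iterate_succ_apply', ih, avg_add]

lemma avg_mono {f g : X → ℝ} (h : ∀ x, f x ≤ g x) (x : X) : avg N f x ≤ avg N g x := by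
  simp only [avg, smul_eq_mul]
  gcongr with y
  exact h y

lemma avg_iterate_mono {f g : X → ℝ} (h : ∀ x, f x ≤ g x) (n : ℕ) (x : X) :
    (avg N)^[n] f x ≤ (avg N)^[n] g x := by
  induction n generalizing x with
  | zero => exact h x
  | succ n ih => simp only [Function.iterate_succ_apply']; exact avg_mono ih x

end avg

namespace IsWalk

variable {A X W : Type} [Group A] [MulAction A X] [AddCommGroup W] [Module ℝ W]
  {N : X → Finset X} (hN : IsWalk A N)
include hN

lemma image_smul [DecidableEq X] (g : A) (x : X) : (N x).image (g • ·) = N (g • x) := by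
  ext y
  simp only [Finset.mem_image]
  constructor
  · rintro ⟨z, hz, rfl⟩; exact hN.smul_mem g x z hz
  · intro hy
    refine ⟨g⁻¹ • y, ?_, by simp⟩
    simpa using hN.smul_mem g⁻¹ _ _ hy

lemma card_eq (x y : X) : (N x).card = (N y).card := by
  classical
  obtain ⟨g, rfl⟩ := hN.trans x y
  rw [← hN.image_smul, Finset.card_image_of_injective _ (MulAction.injective g)]

lemma card_pos (x : X) : 0 < (N x).card := Finset.card_pos.2 ⟨x, hN.self_mem x⟩

lemma avg_smul (f : X → W) (g : A) (x : X) : avg N (fun y => f (g • y)) x = avg N f (g • x) := by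
  classical
  unfold avg
  rw [← hN.image_smul, Finset.card_image_of_injective _ (MulAction.injective g),
    Finset.sum_image (MulAction.injective g).injOn]

lemma avg_iterate_smul (f : X → W) (g : A) (n : ℕ) (x : X) :
    (avg N)^[n] (fun y => f (g • y)) x = (avg N)^[n] f (g • x) := by
  induction n generalizing x with
  | zero => rfl
  | succ n ih =>
    simp only [Function.iterate_succ_apply']
    rw [← hN.avg_smul]
    congr 1; ext y; exact ih y

lemma avg_const (w : W) : avg N (fun _ => w) = fun _ => w := by
  ext x
  have := hN.card_pos x
  rw [avg, Finset.sum_const, ← Nat.cast_smul_eq_nsmul ℝ, smul_smul, inv_mul_cancel₀ (by positivity),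
    one_smul]

lemma avg_iterate_const (w : W) (n : ℕ) : (avg N)^[n] (fun _ => w) = fun _ => w := by
  induction n with
  | zero => rfl
  | succ n ih => rw [Function.iterate_succ_apply', ih, hN.avg_const]

lemma le_card_mul_avg {f : X → ℝ} (hf : ∀ x, 0 ≤ f x) {x y : X} (hy : y ∈ N x) :
    f y ≤ (N x).card * avg N f x := by
  have h0 := hN.card_pos x
  rw [avg, smul_eq_mul, ← mul_assoc, mul_inv_cancel₀ (by positivity), one_mul]
  exact Finset.single_le_sum (f := f) (fun z _ => hf z) hy

lemma avg_nonneg {f : X → ℝ} (hf : ∀ x, 0 ≤ f x) (x : X) : 0 ≤ avg N f x := by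
  have h := avg_mono (N := N) hf x
  rwa [hN.avg_const (0 : ℝ)] at h

lemma avg_iterate_nonneg {f : X → ℝ} (hf : ∀ x, 0 ≤ f x) (n : ℕ) (x : X) :
    0 ≤ (avg N)^[n] f x := by
  have h := avg_iterate_mono (N := N) hf n x
  rwa [hN.avg_iterate_const (0 : ℝ)] at h

lemma le_card_sq_mul_avg_avg {f : X → ℝ} (hf : ∀ x, 0 ≤ f x) {x y : X} (hy : y ∈ N x) :
    f y ≤ ((N x).card : ℝ) ^ 2 * avg N (avg N f) x := by
  have h1 := hN.le_card_mul_avg hf hy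
  have h2 := hN.le_card_mul_avg (hN.avg_nonneg hf) (hN.self_mem x)
  have : (0 : ℝ) ≤ (N x).card := by positivity
  nlinarith

end IsWalk

open Classical in
/-- The `n`-step transition probability. -/
def heat {X : Type} (N : X → Finset X) (n : ℕ) (x y : X) : ℝ :=
  (avg N)^[n] (fun z => if z = y then (1 : ℝ) else 0) x

open Classical in
/-- The set of points that can be reached in `n` steps. -/
def reach {X : Type} (N : X → Finset X) : ℕ → X → Finset X
  | 0, x => {x}
  | n + 1, x => (N x).biUnion (reach N n)

section heat

variable {X W : Type} [AddCommGroup W] [Module ℝ W] {N : X → Finset X}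

lemma avg_iterate_eq_sum (f : X → W) (n : ℕ) : ∀ (x : X) (S : Finset X), reach N n x ⊆ S →
    (avg N)^[n] f x = ∑ y ∈ S, heat N n x y • f y := by
  classical
  induction n with
  | zero =>
    intro x S hS
    have hx : x ∈ S := hS (by simp [reach])
    simp [heat, hx]
  | succ n ih =>
    intro x S hS
    have h1 : ∀ z ∈ N x, reach N n z ⊆ S := fun z hz =>
      (Finset.subset_biUnion_of_mem (reach N n) hz).trans hS
    simp only [heat, Function.iterate_succ_apply']
    rw [avg, Finset.sum_congr rfl fun z hz => ih z S (h1 z hz), Finset.sum_comm, Finset.smul_sum]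
    refine Finset.sum_congr rfl fun y _ => ?_
    rw [avg, ← Finset.sum_smul, smul_assoc]; rfl

lemma IsWalk.heat_nonneg {A : Type} [Group A] [MulAction A X] (hN : IsWalk A N) (n : ℕ) (x y : X) :
    0 ≤ heat N n x y := by
  classical
  exact hN.avg_iterate_nonneg (fun z => by split_ifs <;> norm_num) n x

lemma IsWalk.sum_heat {A : Type} [Group A] [MulAction A X] (hN : IsWalk A N) (n : ℕ) (x : X)
    {S : Finset X} (hS : reach N n x ⊆ S) : ∑ y ∈ S, heat N n x y = 1 := by
  have h := avg_iterate_eq_sum (N := N) (fun _ => (1 : ℝ)) n x S hS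
  rw [hN.avg_iterate_const (1 : ℝ)] at h
  simpa using h.symm

lemma IsWalk.heat_smul {A : Type} [Group A] [MulAction A X] (hN : IsWalk A N) (g : A) (n : ℕ)
    (x y : X) : heat N n (g • x) (g • y) = heat N n x y := by
  classical
  unfold heat
  rw [← hN.avg_iterate_smul]
  simp

lemma heat_succ (n : ℕ) (x y : X) : heat N (n + 1) x y = avg N (fun z => heat N n z y) x := by
  simp only [heat, Function.iterate_succ_apply']

open Classical in
/-- The heat kernel vectors in `ℓ²`. -/
def heatVec (N : X → Finset X) (n : ℕ) : X → lp (fun _ : X => ℝ) 2 :=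
  (avg N)^[n] (fun x => lp.single 2 x 1)

lemma IsWalk.heat_succ_right {A : Type} [Group A] [MulAction A X] (hN : IsWalk A N) (n : ℕ)
    (x y : X) : heat N (n + 1) x y = avg N (fun z => heat N n x z) y := by
  classical
  induction n generalizing x with
  | zero =>
    simp only [heat, Function.iterate_succ_apply', Function.iterate_zero, id, avg,
      smul_eq_mul, hN.card_eq x y]
    congr 1
    simp only [Finset.sum_ite_eq', eq_comm (a := x)]
    simp only [show y ∈ N x ↔ x ∈ N y from ⟨hN.symm _ _, hN.symm _ _⟩]
  | succ n ih =>
    rw [heat_succ]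
    simp only [ih, heat_succ]
    simp only [avg, smul_eq_mul]
    rw [← Finset.mul_sum, ← Finset.mul_sum, Finset.sum_comm]
    ring_nf

lemma inner_heatVec_single [DecidableEq X] (n : ℕ) (x y : X) :
    ⟪heatVec N n x, lp.single 2 y 1⟫_ℝ = heat N n x y := by
  classical
  have h := avg_iterate_map (N := N) ((innerSL ℝ (lp.single 2 y (1 : ℝ) :
    lp (fun _ : X => ℝ) 2)).toLinearMap) (fun x => lp.single 2 x 1) n
  have h2 := congrFun h x
  rw [real_inner_comm]
  unfold heatVec heat
  simp only [ContinuousLinearMap.coe_coe, innerSL_apply_apply] at h2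
  convert h2.symm using 2
  · convert rfl
  · ext z
    rw [lp.inner_single_left]
    simp [Pi.single_apply, eq_comm]

lemma IsWalk.inner_heatVec {A : Type} [Group A] [MulAction A X] (hN : IsWalk A N) (n m : ℕ)
    (x y : X) : ⟪heatVec N n x, heatVec N m y⟫_ℝ = heat N (n + m) x y := by
  classical
  induction m generalizing y with
  | zero =>
    rw [add_zero, ← inner_heatVec_single]
    simp only [heatVec, Function.iterate_zero, id]
  | succ m ih =>
    rw [← add_assoc, hN.heat_succ_right]
    simp only [← ih]
    have h1 : heatVec N (m + 1) y = avg N (heatVec N m) y := by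
      simp only [heatVec, Function.iterate_succ_apply']
    rw [h1]
    exact (congrFun (avg_map (N := N) (innerSL ℝ (heatVec N n x)).toLinearMap (heatVec N m)) y).symm

end heat

end TransitiveGrowth

namespace TransitiveGrowth
open scoped Topology InnerProductSpace

lemma exists_tendsto_of_bounded {ι : Type} (U : Ultrafilter ι) {x : ι → ℝ} {C : ℝ}
    (h : ∀ i, |x i| ≤ C) : ∃ l, Tendsto x U (𝓝 l) := by
  have h1 : (U.map x : Filter ℝ) ≤ 𝓟 (Set.Icc (-C) C) := by
    rw [le_principal_iff]
    exact Filter.mem_map.2 (Filter.Eventually.of_forall fun i => abs_le.1 (h i))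
  obtain ⟨l, -, hl⟩ := isCompact_Icc.ultrafilter_le_nhds _ h1
  exact ⟨l, hl⟩

lemma mem_reach_add_one {X : Type} {N : X → Finset X} {n : ℕ} {x y : X} :
    y ∈ reach N (n + 1) x ↔ ∃ w ∈ N x, y ∈ reach N n w := by
  classical
  rw [reach, Finset.mem_biUnion]

lemma mem_reach_succ {X : Type} {N : X → Finset X} {n : ℕ} {x y z : X} (hy : y ∈ reach N n x) (hz : z ∈ N y) :
    z ∈ reach N (n + 1) x := by
  induction n generalizing x with
  | zero =>
    simp only [reach, Finset.mem_singleton] at hy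
    subst hy
    simpa [reach] using hz
  | succ n ih =>
    rw [mem_reach_add_one] at hy ⊢
    obtain ⟨w, hw, hy⟩ := hy
    exact ⟨w, hw, ih hy⟩

lemma norm_sub_le_of_mem_reach {X E : Type} {N : X → Finset X} [SeminormedAddCommGroup E] {f : X → E} {L : ℝ}
    (hf : ∀ x, ∀ y ∈ N x, ‖f x - f y‖ ≤ L) {n : ℕ} {x y : X} (hy : y ∈ reach N n x) :
    ‖f x - f y‖ ≤ n * L := by
  induction n generalizing x with
  | zero =>
    simp only [reach, Finset.mem_singleton] at hy
    simp [hy]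
  | succ n ih =>
    rw [mem_reach_add_one] at hy
    obtain ⟨w, hw, hy⟩ := hy
    calc ‖f x - f y‖ ≤ ‖f x - f w‖ + ‖f w - f y‖ := norm_sub_le_norm_sub_add_norm_sub ..
      _ ≤ L + n * L := add_le_add (hf x w hw) (ih hy)
      _ = (n + 1 : ℕ) * L := by push_cast; ring

lemma heatVec_add_two {X : Type} {N : X → Finset X} (n : ℕ) : heatVec N (n + 2) = avg N (avg N (heatVec N n)) := by
  simp only [heatVec, Function.iterate_succ_apply']

section reach
variable {A X : Type} [Group A] [MulAction A X] {N : X → Finset X} (hN : IsWalk A N)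
include hN

lemma IsWalk.self_mem_reach (n : ℕ) (x : X) : x ∈ reach N n x := by
  induction n with
  | zero => simp [reach]
  | succ n ih => exact mem_reach_succ ih (hN.self_mem x)

lemma IsWalk.reach_subset_succ (n : ℕ) (x : X) : reach N n x ⊆ reach N (n + 1) x :=
  fun _ hy => mem_reach_succ hy (hN.self_mem _)

lemma IsWalk.exists_mem_reach (x y : X) : ∃ n, y ∈ reach N n x := by
  induction hN.conn x y with
  | refl => exact ⟨0, by simp [reach]⟩
  | tail _ h ih =>
    obtain ⟨n, hn⟩ := ih
    exact ⟨n + 1, mem_reach_succ hn h⟩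

lemma IsWalk.lt_card_reach [Infinite X] (n : ℕ) (x : X) : n < (reach N n x).card := by
  induction n with
  | zero => simp [reach]
  | succ n ih =>
    have hs := hN.reach_subset_succ n x
    have : reach N n x ≠ reach N (n + 1) x := by
      intro he
      have hall : ∀ y, y ∈ reach N n x := by
        intro y
        induction hN.conn x y with
        | refl => exact hN.self_mem_reach n x
        | tail _ h ih => rw [he]; exact mem_reach_succ ih h
      exact Set.infinite_univ ((reach N n x).finite_toSet.subset fun y _ => hall y)
    exact lt_of_le_of_lt ih (Finset.card_lt_card (Finset.ssubset_iff_subset_ne.2 ⟨hs, this⟩))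

lemma IsWalk.heat_self (n : ℕ) (x y : X) : heat N n x x = heat N n y y := by
  obtain ⟨g, rfl⟩ := hN.trans x y
  rw [hN.heat_smul]

lemma IsWalk.norm_heatVec_sub_sq (n : ℕ) (x y : X) :
    ‖heatVec N n x - heatVec N n y‖ ^ 2 = 2 * (heat N (n + n) x x - heat N (n + n) x y) := by
  rw [norm_sub_sq_real, ← real_inner_self_eq_norm_sq, ← real_inner_self_eq_norm_sq,
    hN.inner_heatVec, hN.inner_heatVec, hN.inner_heatVec, hN.heat_self _ y x]
  ring

lemma IsWalk.heat_le_heat_self (n : ℕ) (x y : X) : heat N (n + n) x y ≤ heat N (n + n) x x := by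
  have := hN.norm_heatVec_sub_sq n x y
  nlinarith [sq_nonneg ‖heatVec N n x - heatVec N n y‖]

lemma IsWalk.one_le_card_mul_heat (n : ℕ) (x : X) :
    1 ≤ ((reach N (n + n) x).card : ℝ) * heat N (n + n) x x := by
  rw [← hN.sum_heat (n + n) x subset_rfl]
  refine (Finset.sum_le_sum fun y _ => hN.heat_le_heat_self n x y).trans ?_
  simp

lemma IsWalk.sum_heat_le_one (n : ℕ) (x : X) (S : Finset X) : ∑ y ∈ S, heat N n x y ≤ 1 := by
  classical
  rw [← hN.sum_heat n x (S := S ∪ reach N n x) Finset.subset_union_right]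
  exact Finset.sum_le_sum_of_subset_of_nonneg Finset.subset_union_left
    fun y _ _ => hN.heat_nonneg n x y

/-- The decrement of the return probability. -/
lemma IsWalk.avg_avg_heat_sub (n : ℕ) (x : X) :
    avg N (avg N fun z => heat N (n + n) x x - heat N (n + n) x z) x =
      heat N (n + n) x x - heat N (n + n + 2) x x := by
  have h : heat N (n + n + 2) x x = avg N (avg N fun z => heat N (n + n) x z) x := by
    rw [show n + n + 2 = (n + n + 1) + 1 from rfl, hN.heat_succ_right]
    congr 1; ext z; rw [hN.heat_succ_right]
  simp only [sub_eq_add_neg, avg_add]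
  rw [hN.avg_const, hN.avg_const, h]
  congr 1
  have h2 := avg_map (N := N) (-LinearMap.id : ℝ →ₗ[ℝ] ℝ)
  simp only [LinearMap.neg_apply, LinearMap.id_apply] at h2
  rw [h2, h2]

/-- `decr N n x` is the decrement of the return probability between times `2 * n` and `2 * n + 2`. -/
def decr (N : X → Finset X) (n : ℕ) (x : X) : ℝ := heat N (n + n) x x - heat N (n + n + 2) x x

lemma IsWalk.norm_heatVec_sub_le (n : ℕ) (o x y : X) (hy : y ∈ N x) :
    ‖heatVec N n x - heatVec N n y‖ ^ 2 ≤ 2 * (N o).card ^ 2 * decr N n o := by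
  rw [hN.norm_heatVec_sub_sq, decr, hN.heat_self _ o x, hN.heat_self _ o x, hN.card_eq o x,
    ← hN.avg_avg_heat_sub]
  have := hN.le_card_sq_mul_avg_avg (f := fun z => heat N (n + n) x x - heat N (n + n) x z)
    (fun z => sub_nonneg.2 (hN.heat_le_heat_self n x z)) hy
  linarith

lemma IsWalk.decr_nonneg (n : ℕ) (x : X) : 0 ≤ decr N n x := by
  rw [decr, ← hN.avg_avg_heat_sub]
  exact hN.avg_nonneg (hN.avg_nonneg
    fun z => sub_nonneg.2 (hN.heat_le_heat_self n x z)) x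

lemma IsWalk.decr_sub_decr (n : ℕ) (x : X) :
    decr N n x - decr N (n + 1) x = ‖heatVec N n x - heatVec N (n + 2) x‖ ^ 2 := by
  rw [norm_sub_sq_real, ← real_inner_self_eq_norm_sq, ← real_inner_self_eq_norm_sq,
    hN.inner_heatVec, hN.inner_heatVec, hN.inner_heatVec, decr, decr]
  ring_nf

lemma IsWalk.heat_le_one (n : ℕ) (x : X) : heat N n x x ≤ 1 := by
  simpa using hN.sum_heat_le_one n x {x}

/-- Polynomial lower bound on the decrement of the return probability. -/
lemma IsWalk.one_lt_mul_decr [Infinite X] (n : ℕ) (x : X) :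
    1 < ((2 * (reach N (n + n) x).card : ℕ) : ℝ) ^ 3 * (N x).card ^ 2 * decr N n x := by
  set V := (reach N (n + n) x).card with hV
  set R := 2 * V with hR
  set D : ℝ := ((N x).card : ℝ) with hD
  by_contra! hcon
  have hk := hN.one_le_card_mul_heat n x
  rw [← hV] at hk
  have hb := hN.decr_nonneg n x
  have hV0 : 0 < V := Finset.card_pos.2 ⟨x, hN.self_mem_reach _ x⟩
  have hVR : (R : ℝ) = 2 * V := by simp [hR]
  have hR0 : (0 : ℝ) < R := by rw [hVR]; positivity
  set k := heat N (n + n) x x with hkdef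
  have key : ∀ y ∈ reach N R x, k / 2 ≤ heat N (n + n) x y := by
    intro y hy
    have h1 : ∀ z, ∀ w ∈ N z, ‖heatVec N n z - heatVec N n w‖ ≤ √(2 * D ^ 2 * decr N n x) :=
      fun z w hw => Real.le_sqrt_of_sq_le (hN.norm_heatVec_sub_le n x z w hw)
    have h2 := norm_sub_le_of_mem_reach h1 hy
    have h3 := hN.norm_heatVec_sub_sq n x y
    have h4 : ‖heatVec N n x - heatVec N n y‖ ^ 2 ≤ (R * √(2 * D ^ 2 * decr N n x)) ^ 2 := by
      gcongr
    rw [mul_pow, Real.sq_sqrt (by positivity), h3] at h4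
    have h5 : (R : ℝ) ^ 2 * (D ^ 2 * decr N n x) ≤ 1 / R := by
      rw [le_div_iff₀ hR0]; linarith
    have h6 : 1 / (R : ℝ) ≤ k / 2 := by
      rw [div_le_div_iff₀ hR0 two_pos, hVR]; linarith
    linarith
  have h1 := hN.sum_heat_le_one (n + n) x (reach N R x)
  have h2 := Finset.sum_le_sum key
  have h3 := hN.lt_card_reach R x
  rw [Finset.sum_const, nsmul_eq_mul] at h2
  have h3' : (R : ℝ) < (reach N R x).card := by exact_mod_cast h3
  have hk0 : 0 < k := by
    by_contra! h
    nlinarith [mul_nonneg (Nat.cast_nonneg (α := ℝ) V) (neg_nonneg.2 h)]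
  nlinarith

lemma IsWalk.exists_decr_sub_le [Infinite X] {x : X} {c d : ℕ}
    (hg : ∀ n, 1 ≤ n → (reach N n x).card ≤ c * n ^ d) {ε : ℝ} (hε : 0 < ε) :
    ∃ n, decr N n x - decr N (n + 1) x ≤ ε * decr N n x := by
  by_contra! hcon
  have hpos : ∀ n, 0 < decr N n x := fun n => by
    have h := hN.one_lt_mul_decr n x
    by_contra! h0
    have : 0 ≤ ((2 * (reach N (n + n) x).card : ℕ) : ℝ) ^ 3 * (N x).card ^ 2 := by positivity
    nlinarith
  have hε1 : ε < 1 := by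
    have h1 := hcon 0
    have h2 := hpos 0
    have h3 := hpos 1
    by_contra! h
    simp only [zero_add] at h1
    nlinarith
  have hdec : ∀ n, decr N n x ≤ (1 - ε) ^ n := by
    intro n
    induction n with
    | zero =>
      have h1 := hN.heat_le_one 0 x
      have h2 := hN.heat_nonneg 2 x x
      simp only [decr, add_zero, zero_add, pow_zero]
      linarith
    | succ n ih =>
      have := hcon n
      rw [pow_succ]
      nlinarith
  have hlim : Tendsto (fun n : ℕ => (8 * c ^ 3 * 8 ^ d * (N x).card ^ 2 : ℝ) *
      ((n : ℝ) ^ (3 * d) * (1 - ε) ^ n)) atTop (𝓝 0) := by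
    rw [← mul_zero (8 * c ^ 3 * 8 ^ d * (N x).card ^ 2 : ℝ)]
    exact (tendsto_pow_const_mul_const_pow_of_abs_lt_one (3 * d)
      (by rw [abs_lt]; constructor <;> linarith)).const_mul _
  obtain ⟨n, hn, hn1⟩ := ((hlim.eventually_lt_const one_pos).and (eventually_ge_atTop 1)).exists
  have h1 := hN.one_lt_mul_decr n x
  have h2 : ((2 * (reach N (n + n) x).card : ℕ) : ℝ) ≤ 2 * (c * (2 * n) ^ d) := by
    have := hg (n + n) (by omega)
    rw [← two_mul] at this ⊢
    push_cast
    exact_mod_cast Nat.mul_le_mul_left 2 this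
  have h3 : ((2 * (reach N (n + n) x).card : ℕ) : ℝ) ^ 3 * (N x).card ^ 2 * decr N n x ≤
      (2 * (c * (2 * n) ^ d)) ^ 3 * (N x).card ^ 2 * (1 - ε) ^ n := by
    gcongr
    · exact (hpos n).le
    · exact hdec n
  have h4 : (2 * (c * (2 * n) ^ d)) ^ 3 * (N x).card ^ 2 * (1 - ε) ^ n =
      (8 * c ^ 3 * 8 ^ d * (N x).card ^ 2 : ℝ) * ((n : ℝ) ^ (3 * d) * (1 - ε) ^ n) := by
    rw [show (8 : ℝ) ^ d = (2 ^ d) ^ 3 by rw [← pow_mul, mul_comm, pow_mul]; norm_num]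
    ring
  linarith

/-- Almost harmonic Lipschitz functions that oscillate near `o`. -/
lemma IsWalk.exists_almost_harmonic [Infinite X] {o : X} {c d : ℕ}
    (hg : ∀ n, 1 ≤ n → (reach N n o).card ≤ c * n ^ d) {ε : ℝ} (hε : 0 < ε) :
    ∃ f : X → ℝ, f o = 0 ∧ (∀ x, ∀ y ∈ N x, ‖f x - f y‖ ≤ 2 * (N o).card) ∧
      (∀ x, |avg N (avg N f) x - f x| ≤ ε) ∧ ∃ y ∈ reach N 2 o, 1 ≤ f y := by
  obtain ⟨n, hn⟩ := hN.exists_decr_sub_le hg (sq_pos_of_pos hε)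
  set b := decr N n o with hb
  have hb0 : 0 < b := by
    have h := hN.one_lt_mul_decr n o
    by_contra! h0
    have : 0 ≤ ((2 * (reach N (n + n) o).card : ℕ) : ℝ) ^ 3 * (N o).card ^ 2 := by positivity
    nlinarith
  obtain ⟨y, hy, hyb⟩ : ∃ y ∈ reach N 2 o, b ≤ ‖heatVec N n y - heatVec N n o‖ ^ 2 := by
    by_contra! h
    have h1 := hN.avg_avg_heat_sub n o
    change _ = b at h1
    have h2 : ∀ f : X → ℝ, avg N (avg N f) o = ∑ y ∈ reach N 2 o, heat N 2 o y • f y :=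
      fun f => avg_iterate_eq_sum f 2 o _ subset_rfl
    rw [h2] at h1
    have h3 : ∑ y ∈ reach N 2 o, heat N 2 o y • (heat N (n + n) o o - heat N (n + n) o y) ≤
        ∑ y ∈ reach N 2 o, heat N 2 o y * (b / 2) := by
      refine Finset.sum_le_sum fun y hy => mul_le_mul_of_nonneg_left ?_ (hN.heat_nonneg _ _ _)
      have := (h y hy).le
      rw [norm_sub_rev, hN.norm_heatVec_sub_sq] at this
      linarith
    rw [← Finset.sum_mul, hN.sum_heat 2 o subset_rfl] at h3
    linarith
  set e := heatVec N n y - heatVec N n o with he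
  have he0 : 0 < ‖e‖ := by
    by_contra! h
    have : ‖e‖ = 0 := le_antisymm h (norm_nonneg _)
    rw [this] at hyb; linarith [sq_nonneg (0 : ℝ)]
  have hsb : 0 < √b := Real.sqrt_pos.2 hb0
  set L : lp (fun _ : X => ℝ) 2 →ₗ[ℝ] ℝ := (innerSL ℝ ((√b)⁻¹ • (‖e‖⁻¹ • e))).toLinearMap with hL
  have hLn : ∀ v, |L v| ≤ (√b)⁻¹ * ‖v‖ := fun v => by
    refine (abs_real_inner_le_norm ((√b)⁻¹ • (‖e‖⁻¹ • e)) v).trans ?_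
    rw [norm_smul, norm_smul, norm_inv, norm_inv, norm_norm, inv_mul_cancel₀ he0.ne', mul_one,
      Real.norm_of_nonneg hsb.le]
  refine ⟨fun x => L (heatVec N n x - heatVec N n o), by simp, ?_, ?_, y, hy, ?_⟩
  · intro x z hz
    rw [← map_sub, sub_sub_sub_cancel_right, Real.norm_eq_abs]
    refine (hLn _).trans ?_
    rw [inv_mul_le_iff₀ hsb]
    refine (pow_le_pow_iff_left₀ (norm_nonneg _) (by positivity) two_ne_zero).1 ?_
    have := hN.norm_heatVec_sub_le n o x z hz
    rw [mul_pow, Real.sq_sqrt hb0.le]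
    rw [← hb] at this
    nlinarith [mul_nonneg hb0.le (sq_nonneg ((N o).card : ℝ))]
  · intro x
    have h1 : avg N (avg N fun x => L (heatVec N n x - heatVec N n o)) x =
        L (heatVec N (n + 2) x - heatVec N n o) := by
      rw [avg_map, avg_map, heatVec_add_two]
      simp only [sub_eq_add_neg, avg_add]
      rw [hN.avg_const, hN.avg_const]
    rw [h1, ← map_sub, sub_sub_sub_cancel_right]
    refine (hLn _).trans ?_
    rw [inv_mul_le_iff₀ hsb]
    refine (pow_le_pow_iff_left₀ (norm_nonneg _) (by positivity) two_ne_zero).1 ?_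
    have h2 := hN.decr_sub_decr n x
    rw [norm_sub_rev, ← h2, mul_pow, Real.sq_sqrt hb0.le, mul_comm]
    simp only [decr, hN.heat_self _ x o] at hn ⊢
    exact hn
  · have : L e = (√b)⁻¹ * ‖e‖ := by
      simp only [hL, ContinuousLinearMap.coe_coe, innerSL_apply_apply, real_inner_smul_left,
        real_inner_self_eq_norm_sq]
      field_simp
    change 1 ≤ L e
    rw [this, le_inv_mul_iff₀ hsb, mul_one]
    exact Real.sqrt_le_iff.2 ⟨he0.le, hyb⟩

/-- On an infinite transitive graph of polynomial growth there is a nonconstant Lipschitz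
harmonic function. -/
lemma IsWalk.exists_harmonic [Infinite X] {o : X} {c d : ℕ}
    (hg : ∀ n, 1 ≤ n → (reach N n o).card ≤ c * n ^ d) :
    ∃ f : X → ℝ, f o = 0 ∧ (∀ x, ∀ y ∈ N x, |f x - f y| ≤ 2 * (N o).card) ∧
      avg N (avg N f) = f ∧ f ≠ 0 := by
  choose f hf0 hfL hfh y hy hfy using fun n : ℕ =>
    hN.exists_almost_harmonic hg (ε := 1 / ((n : ℝ) + 1)) (by positivity)
  set U := hyperfilter ℕ
  have hU : (U : Filter ℕ) ≤ atTop := Nat.hyperfilter_le_atTop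
  have hlim : ∀ x, ∃ l, Tendsto (fun n => f n x) U (𝓝 l) := by
    intro x
    obtain ⟨m, hm⟩ := hN.exists_mem_reach o x
    refine exists_tendsto_of_bounded U (C := m * (2 * (N o).card)) fun n => ?_
    have := norm_sub_le_of_mem_reach (hfL n) hm
    rwa [hf0, zero_sub, norm_neg] at this
  choose F hF using hlim
  have havg : ∀ x, Tendsto (fun n => avg N (avg N (f n)) x) U (𝓝 (avg N (avg N F) x)) := by
    intro x
    simp only [avg, smul_eq_mul]
    exact (tendsto_finsetSum _ fun z _ => (tendsto_finsetSum _ fun w _ =>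
      hF w).const_mul _).const_mul _
  refine ⟨F, ?_, ?_, ?_, ?_⟩
  · refine tendsto_nhds_unique (hF o) ?_
    simp only [hf0]; exact tendsto_const_nhds
  · intro x z hz
    exact le_of_tendsto ((hF x).sub (hF z)).abs (Eventually.of_forall fun n => hfL n x z hz)
  · ext x
    refine sub_eq_zero.1 (abs_eq_zero.1 (le_antisymm ?_ (abs_nonneg _)))
    exact le_of_tendsto_of_tendsto ((havg x).sub (hF x)).abs
      (tendsto_one_div_add_atTop_nhds_zero_nat.mono_left hU) (Eventually.of_forall fun n => hfh n x)
  · intro h0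
    have h1 : ∀ᶠ n in (U : Filter ℕ), ∀ z ∈ reach N 2 o, f n z < 1 := by
      rw [Filter.eventually_all_finset]
      intro z _
      exact (hF z).eventually_lt_const (by rw [h0]; exact one_pos)
    obtain ⟨n, hn⟩ := h1.exists
    exact absurd (hfy n) (not_le.2 (hn _ (hy n)))

end reach
end TransitiveGrowth

namespace TransitiveGrowth
open scoped Topology

lemma sq_sqrt_sub_sqrt_le {s m : ℝ} (hs : 0 ≤ s) (hm : 0 ≤ m) (h : m = 0 → s = 0) :
    (√s - √m) ^ 2 ≤ s * Real.log s - s * Real.log m - s + m := by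
  rcases hs.eq_or_lt with rfl | hs
  · simp [Real.sq_sqrt hm]
  have hm0 : 0 < m := lt_of_le_of_ne hm fun h' => hs.ne' (h h'.symm)
  have h1 : Real.log √(m / s) ≤ √(m / s) - 1 := Real.log_le_sub_one_of_pos (by positivity)
  rw [Real.log_sqrt (by positivity), Real.log_div hm0.ne' hs.ne', Real.sqrt_div hm] at h1
  have h2 : √s * √s = s := Real.mul_self_sqrt hs.le
  have h3 : √m * √m = m := Real.mul_self_sqrt hm
  have h4 : s * (√m / √s) = √s * √m := by
    rw [← mul_div_assoc, div_eq_iff (by positivity), mul_right_comm, h2]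
  nlinarith

/-- The entropy of the walk at time `n`. -/
def entropy {X : Type} (N : X → Finset X) (n : ℕ) (x : X) : ℝ :=
  ∑ᶠ z, Real.negMulLog (heat N n x z)

section
variable {A X : Type} [Group A] [MulAction A X] {N : X → Finset X} (hN : IsWalk A N)
include hN

lemma IsWalk.heat_eq_zero {n : ℕ} {x z : X} (hz : z ∉ reach N n x) : heat N n x z = 0 := by
  classical
  have h1 := hN.sum_heat n x (Finset.subset_insert z (reach N n x))
  rw [Finset.sum_insert hz, hN.sum_heat n x subset_rfl] at h1
  linarith

lemma IsWalk.entropy_eq_sum {n : ℕ} {x : X} {S : Finset X} (hS : reach N n x ⊆ S) :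
    entropy N n x = ∑ z ∈ S, Real.negMulLog (heat N n x z) := by
  refine finsum_eq_sum_of_support_subset _ fun z hz => ?_
  by_contra h
  refine hz ?_
  change Real.negMulLog _ = 0
  rw [hN.heat_eq_zero fun h' => h (hS h'), Real.negMulLog_zero]

lemma IsWalk.entropy_eq (n : ℕ) (x y : X) : entropy N n x = entropy N n y := by
  obtain ⟨g, rfl⟩ := hN.trans x y
  unfold entropy
  rw [← finsum_comp_equiv (MulAction.toPerm g) (f := fun z => Real.negMulLog (heat N n (g • x) z))]
  simp only [MulAction.toPerm_apply, hN.heat_smul]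

lemma IsWalk.entropy_le_log (n : ℕ) (x : X) : entropy N n x ≤ Real.log (reach N n x).card := by
  rw [hN.entropy_eq_sum subset_rfl]
  set S := reach N n x
  have hS : 0 < S.card := Finset.card_pos.2 ⟨x, hN.self_mem_reach n x⟩
  have hS' : (0 : ℝ) < S.card := by exact_mod_cast hS
  have h := Real.concaveOn_negMulLog.le_map_sum (t := S) (w := fun _ => (S.card : ℝ)⁻¹)
    (p := fun z => heat N n x z) (fun _ _ => by positivity)
    (by simp [hS.ne']) (fun z _ => hN.heat_nonneg n x z)
  simp only [smul_eq_mul, ← Finset.mul_sum] at h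
  rw [hN.sum_heat n x subset_rfl, mul_one, Real.negMulLog, Real.log_inv, neg_mul_neg] at h
  exact le_of_mul_le_mul_left h (by positivity)

/-- The entropy increment controls the Hellinger distance between heat kernels. -/
lemma IsWalk.sum_hellinger_le (n : ℕ) (x : X) {S : Finset X} (hS : reach N (n + 1) x ⊆ S) :
    ∑ y ∈ N x, ∑ z ∈ S, (√(heat N n y z) - √(heat N (n + 1) x z)) ^ 2 ≤
      (N x).card * (entropy N (n + 1) x - entropy N n x) := by
  have hD := hN.card_pos x
  have hmean : ∀ z, ∑ y ∈ N x, heat N n y z = (N x).card * heat N (n + 1) x z := fun z => by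
    rw [heat_succ, avg, smul_eq_mul, ← mul_assoc, mul_inv_cancel₀ (by positivity), one_mul]
  have hpt : ∀ z, ∑ y ∈ N x, (√(heat N n y z) - √(heat N (n + 1) x z)) ^ 2 ≤
      (N x).card * Real.negMulLog (heat N (n + 1) x z) -
        ∑ y ∈ N x, Real.negMulLog (heat N n y z) := by
    intro z
    have h1 : ∀ y ∈ N x, (√(heat N n y z) - √(heat N (n + 1) x z)) ^ 2 ≤
        - Real.negMulLog (heat N n y z) - heat N n y z * Real.log (heat N (n + 1) x z)
          - heat N n y z + heat N (n + 1) x z := by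
      intro y hy
      have := sq_sqrt_sub_sqrt_le (hN.heat_nonneg n y z) (hN.heat_nonneg (n + 1) x z) (fun h0 => by
        have h2 := hmean z
        rw [h0, mul_zero, Finset.sum_eq_zero_iff_of_nonneg fun w _ => hN.heat_nonneg n w z] at h2
        exact h2 y hy)
      simp only [Real.negMulLog]
      linarith
    refine (Finset.sum_le_sum h1).trans (le_of_eq ?_)
    simp only [Finset.sum_add_distrib, Finset.sum_sub_distrib, ← Finset.sum_mul, hmean,
      Finset.sum_const, Finset.sum_neg_distrib, nsmul_eq_mul, Real.negMulLog]
    ring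
  rw [Finset.sum_comm]
  refine (Finset.sum_le_sum fun z _ => hpt z).trans (le_of_eq ?_)
  rw [Finset.sum_sub_distrib, ← Finset.mul_sum, ← hN.entropy_eq_sum hS, Finset.sum_comm]
  have h2 : ∀ y ∈ N x, ∑ z ∈ S, Real.negMulLog (heat N n y z) = entropy N n x := fun y hy => by
    rw [hN.entropy_eq n x y]
    refine (hN.entropy_eq_sum fun z hz => hS ?_).symm
    exact mem_reach_add_one.2 ⟨y, hy, hz⟩
  rw [Finset.sum_congr rfl h2, Finset.sum_const, nsmul_eq_mul]
  ring

lemma IsWalk.entropy_mono (n : ℕ) (x : X) : entropy N n x ≤ entropy N (n + 1) x := by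
  have h := hN.sum_hellinger_le n x subset_rfl
  have hD : (0 : ℝ) < (N x).card := by exact_mod_cast hN.card_pos x
  have h0 := h.trans' (Finset.sum_nonneg fun y _ => Finset.sum_nonneg fun z _ => sq_nonneg _)
  have := nonneg_of_mul_nonneg_right h0 hD
  linarith

lemma IsWalk.abs_avg_sub_le (n : ℕ) (f : X → ℝ) {x y : X} (hy : y ∈ N x) :
    |(avg N)^[n] f y - (avg N)^[n + 1] f x| ≤
      √((N x).card * (entropy N (n + 1) x - entropy N n x)) *
        √(2 * ((avg N)^[n] (fun z => f z ^ 2) y + (avg N)^[n + 1] (fun z => f z ^ 2) x)) := by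
  set S := reach N (n + 1) x
  have hSy : reach N n y ⊆ S := fun z hz => mem_reach_add_one.2 ⟨y, hy, hz⟩
  rw [avg_iterate_eq_sum f n y S hSy, avg_iterate_eq_sum f (n + 1) x S subset_rfl,
    avg_iterate_eq_sum _ n y S hSy, avg_iterate_eq_sum _ (n + 1) x S subset_rfl]
  simp only [smul_eq_mul, ← Finset.sum_sub_distrib, ← Finset.sum_add_distrib, Finset.mul_sum (s := S)]
  set a := fun z => √(heat N n y z)
  set b := fun z => √(heat N (n + 1) x z)
  have ha : ∀ z, heat N n y z = a z ^ 2 := fun z => (Real.sq_sqrt (hN.heat_nonneg n y z)).symm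
  have hb : ∀ z, heat N (n + 1) x z = b z ^ 2 :=
    fun z => (Real.sq_sqrt (hN.heat_nonneg (n + 1) x z)).symm
  have h1 : ∑ z ∈ S, (a z - b z) ^ 2 ≤ (N x).card * (entropy N (n + 1) x - entropy N n x) :=
    (Finset.single_le_sum (f := fun y => ∑ z ∈ S, (√(heat N n y z) - b z) ^ 2)
      (fun w _ => Finset.sum_nonneg fun z _ => sq_nonneg _) hy).trans
      (hN.sum_hellinger_le n x subset_rfl)
  have hcs := Finset.sum_mul_sq_le_sq_mul_sq S (fun z => a z - b z) (fun z => (a z + b z) * f z)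
  have h2 : ∑ z ∈ S, ((a z + b z) * f z) ^ 2 ≤
      ∑ z ∈ S, 2 * (heat N n y z * f z ^ 2 + heat N (n + 1) x z * f z ^ 2) := by
    refine Finset.sum_le_sum fun z _ => ?_
    rw [ha, hb]
    nlinarith [mul_nonneg (sq_nonneg (a z - b z)) (sq_nonneg (f z))]
  have h3 : ∑ z ∈ S, (heat N n y z * f z - heat N (n + 1) x z * f z) =
      ∑ z ∈ S, (a z - b z) * ((a z + b z) * f z) := by
    refine Finset.sum_congr rfl fun z _ => ?_
    rw [ha, hb]; ring
  rw [h3, ← Real.sqrt_mul' _ ((Finset.sum_nonneg fun z _ => sq_nonneg _).trans h2)]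
  refine Real.abs_le_sqrt (hcs.trans ?_)
  exact mul_le_mul h1 h2 (Finset.sum_nonneg fun z _ => sq_nonneg _)
    ((Finset.sum_nonneg fun z _ => sq_nonneg _).trans h1)

lemma IsWalk.frequently_entropy_le {x : X} {c d : ℕ}
    (hg : ∀ n, 1 ≤ n → (reach N n x).card ≤ c * n ^ d) :
    ∃ᶠ n : ℕ in atTop, entropy N (2 * n + 1) x - entropy N (2 * n) x ≤ (d + 1 : ℝ) / n := by
  intro hcon
  rw [eventually_atTop] at hcon
  obtain ⟨T, hT⟩ := hcon
  set M := max T 1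
  have hstep : ∀ n ≥ M, entropy N (2 * M) x - (d + 1) * Real.log M ≤
      entropy N (2 * n) x - (d + 1) * Real.log n := by
    intro n hn
    induction n, hn using Nat.le_induction with
    | base => rfl
    | succ n hn ih =>
      have h1 := not_le.1 (hT n ((le_max_left _ _).trans hn))
      have h2 := hN.entropy_mono (2 * n + 1) x
      have hn0 : (0 : ℝ) < n := by
        exact_mod_cast lt_of_lt_of_le Nat.one_pos ((le_max_right _ _).trans hn)
      have h3 : Real.log (n + 1 : ℕ) - Real.log n ≤ 1 / n := by
        rw [← Real.log_div (by positivity) (by positivity)]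
        refine (Real.log_le_sub_one_of_pos (by positivity)).trans (le_of_eq ?_)
        push_cast; field_simp; ring
      have h4 : (d + 1 : ℝ) / n = (d + 1) * (1 / n) := by ring
      rw [show 2 * (n + 1) = 2 * n + 1 + 1 from rfl]
      have h5 := mul_le_mul_of_nonneg_left h3 (by positivity : (0 : ℝ) ≤ d + 1)
      linarith
  have hc : 0 < c := by
    have h1 := hg 1 le_rfl
    have h2 : 0 < (reach N 1 x).card := Finset.card_pos.2 ⟨x, hN.self_mem_reach 1 x⟩
    by_contra! h
    simp [Nat.le_zero.1 h] at h1
    simp [h1] at h2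
  have hbd : ∀ n ≥ M, Real.log n ≤ Real.log (c * 2 ^ d) - (entropy N (2 * M) x -
      (d + 1) * Real.log M) := by
    intro n hn
    have hn1 : 1 ≤ n := (le_max_right _ _).trans hn
    have hn0 : (0 : ℝ) < n := by exact_mod_cast hn1
    have h1 := hstep n hn
    have h2 := hN.entropy_le_log (2 * n) x
    have h3 : Real.log (reach N (2 * n) x).card ≤ Real.log (c * 2 ^ d) + d * Real.log n := by
      rw [← Real.log_pow, ← Real.log_mul (by positivity) (by positivity)]
      refine Real.log_le_log ?_ ?_
      · exact_mod_cast Finset.card_pos.2 ⟨x, hN.self_mem_reach _ x⟩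
      · rw [mul_assoc, ← mul_pow]
        exact_mod_cast hg (2 * n) (by omega)
    linarith
  obtain ⟨n, hn, hnM⟩ := (((Real.tendsto_log_atTop.comp tendsto_natCast_atTop_atTop).eventually_gt_atTop
    (Real.log (c * 2 ^ d) - (entropy N (2 * M) x - (d + 1) * Real.log M))).and
      (eventually_ge_atTop M)).exists
  exact absurd (hbd n hnM) (not_le.2 hn)

/-- Times at which the heat kernels at neighbouring points are close. -/
def IsGoodTime (N : X → Finset X) (C : ℝ) (n : ℕ) : Prop :=
  ∀ (f : X → ℝ) (x : X), ∀ y ∈ N x, |(avg N)^[2 * n] f y - (avg N)^[2 * n + 1] f x| ≤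
    √(C / n) * √((avg N)^[2 * n] (fun z => f z ^ 2) y + (avg N)^[2 * n + 1] (fun z => f z ^ 2) x)

lemma IsWalk.frequently_isGoodTime {x : X} {c d : ℕ}
    (hg : ∀ n, 1 ≤ n → (reach N n x).card ≤ c * n ^ d) :
    ∃ C : ℝ, 0 < C ∧ ∃ᶠ n : ℕ in atTop, IsGoodTime N C n := by
  have hD : (0 : ℝ) < (N x).card := by exact_mod_cast hN.card_pos x
  refine ⟨2 * (N x).card * (d + 1), by positivity, (hN.frequently_entropy_le hg).mono ?_⟩
  intro n hn f z y hy
  refine (hN.abs_avg_sub_le (2 * n) f hy).trans ?_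
  rw [Real.sqrt_mul two_pos.le, ← mul_assoc, ← Real.sqrt_mul' _ two_pos.le]
  gcongr
  rw [hN.card_eq z x, hN.entropy_eq _ z x, hN.entropy_eq _ z x]
  calc _ ≤ (N x).card * ((d + 1 : ℝ) / n) * 2 := by gcongr
    _ = _ := by ring
end
end TransitiveGrowth

namespace TransitiveGrowth
open scoped Topology

lemma avg_const_mul {X : Type} {N : X → Finset X} (a : ℝ) (f : X → ℝ) :
    avg N (fun x => a * f x) = fun x => a * avg N f x := by
  ext x
  simp only [avg, smul_eq_mul, ← Finset.mul_sum]
  ring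

lemma avg_iterate_harmonic {X : Type} {N : X → Finset X} {u : X → ℝ} (hu : avg N (avg N u) = u)
    (n : ℕ) : (avg N)^[2 * n] u = u := by
  induction n with
  | zero => rfl
  | succ n ih =>
    rw [show 2 * (n + 1) = 2 * n + 1 + 1 from rfl, Function.iterate_succ_apply,
      Function.iterate_succ_apply, hu, ih]

/-- Lipschitz functions that are harmonic for the two-step walk and vanish at `o`. -/
def lipHarm {X : Type} (N : X → Finset X) (o : X) : Submodule ℝ (X → ℝ) where
  carrier := {u | u o = 0 ∧ (∃ L, ∀ x, ∀ y ∈ N x, |u x - u y| ≤ L) ∧ avg N (avg N u) = u}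
  zero_mem' := ⟨rfl, ⟨0, by simp⟩, by ext x; simp [avg]⟩
  add_mem' := by
    rintro u v ⟨hu0, ⟨L, hL⟩, hu⟩ ⟨hv0, ⟨M, hM⟩, hv⟩
    refine ⟨by simp [hu0, hv0], ⟨L + M, fun x y hy => ?_⟩, ?_⟩
    · rw [Pi.add_apply, Pi.add_apply, add_sub_add_comm]
      exact (abs_add_le _ _).trans (add_le_add (hL x y hy) (hM x y hy))
    · change avg N (avg N fun x => u x + v x) = _
      rw [avg_add, avg_add, hu, hv]; rfl
  smul_mem' := by
    rintro a u ⟨hu0, ⟨L, hL⟩, hu⟩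
    refine ⟨by simp [hu0], ⟨|a| * L, fun x y hy => ?_⟩, ?_⟩
    · rw [Pi.smul_apply, Pi.smul_apply, ← smul_sub, smul_eq_mul, abs_mul]
      gcongr
      exact hL x y hy
    · change avg N (avg N fun x => a * u x) = fun x => a * u x
      rw [avg_const_mul, avg_const_mul, hu]

lemma lipHarm_bound {X : Type} {N : X → Finset X} {o : X} {u : X → ℝ} (hu : u ∈ lipHarm N o) :
    ∃ M, 0 ≤ M ∧ ∀ x, ∀ y ∈ reach N 2 x, |u y - u x| ≤ M := by
  obtain ⟨-, ⟨L, hL⟩, -⟩ := hu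
  refine ⟨2 * |L|, by positivity, fun x y hy => ?_⟩
  rw [abs_sub_comm]
  exact norm_sub_le_of_mem_reach (f := u) (L := |L|) (fun x y hy => (hL x y hy).trans (le_abs_self L)) hy

lemma tendsto_sqrt_div {U : Ultrafilter ℕ} (hU : (U : Filter ℕ) ≤ atTop) (C : ℝ) :
    Tendsto (fun n : ℕ => √(C / n)) U (𝓝 0) := by
  have h : Tendsto (fun n : ℕ => C / (n : ℝ)) U (𝓝 0) :=
    (tendsto_const_div_atTop_nhds_zero_nat C).mono_left hU
  simpa using h.sqrt

section
variable {A X : Type} [Group A] [MulAction A X] {N : X → Finset X} {o : X} (hN : IsWalk A N)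
include hN

lemma IsWalk.avg_avg_le {f u : X → ℝ} (hu : avg N (avg N u) = u) {x : X} {a : ℝ}
    (h : ∀ y ∈ reach N 2 x, f y ≤ a + (u y - u x)) : avg N (avg N f) x ≤ a := by
  have h2 : ∀ f : X → ℝ, avg N (avg N f) x = ∑ y ∈ reach N 2 x, heat N 2 x y • f y :=
    fun f => avg_iterate_eq_sum f 2 x _ subset_rfl
  have h3 := h2 u
  rw [hu] at h3
  have h4 := hN.sum_heat 2 x subset_rfl
  rw [h2]
  calc ∑ y ∈ reach N 2 x, heat N 2 x y • f y
      ≤ ∑ y ∈ reach N 2 x, heat N 2 x y • (a + (u y - u x)) :=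
        Finset.sum_le_sum fun y hy => mul_le_mul_of_nonneg_left (h y hy) (hN.heat_nonneg _ _ _)
    _ = (∑ y ∈ reach N 2 x, heat N 2 x y) * a + ((∑ y ∈ reach N 2 x, heat N 2 x y • u y) -
          (∑ y ∈ reach N 2 x, heat N 2 x y) * u x) := by
        simp only [smul_eq_mul, mul_add, mul_sub, Finset.sum_add_distrib, Finset.sum_sub_distrib,
          Finset.sum_mul]
    _ = a := by rw [h4, ← h3]; ring

lemma IsWalk.avg_iterate_sq_le {u : X → ℝ} (hu : avg N (avg N u) = u) {M : ℝ}
    (hM : ∀ x, ∀ y ∈ reach N 2 x, |u y - u x| ≤ M) (n : ℕ) (x : X) :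
    (avg N)^[2 * n] (fun z => u z ^ 2) x ≤ u x ^ 2 + M ^ 2 * n := by
  induction n generalizing x with
  | zero => simp
  | succ n ih =>
    rw [show 2 * (n + 1) = 2 * n + 1 + 1 from rfl, Function.iterate_succ_apply',
      Function.iterate_succ_apply']
    refine (avg_mono (avg_mono ih) x).trans ?_
    refine hN.avg_avg_le (u := fun y => (2 * u x) * u y) ?_ fun y hy => ?_
    · rw [avg_const_mul, avg_const_mul, hu]
    · have := sq_le_sq' (abs_le.1 (hM x y hy)).1 (abs_le.1 (hM x y hy)).2
      push_cast
      nlinarith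

lemma IsWalk.avg_iterate_pow_four_le {u : X → ℝ} (hu : avg N (avg N u) = u) {M : ℝ}
    (hM : ∀ x, ∀ y ∈ reach N 2 x, |u y - u x| ≤ M) (n : ℕ) (x : X) :
    (avg N)^[2 * n] (fun z => u z ^ 4) x ≤
      u x ^ 4 + 8 * M ^ 2 * n * u x ^ 2 + 8 * M ^ 4 * n ^ 2 := by
  induction n generalizing x with
  | zero => simp
  | succ n ih =>
    rw [show 2 * (n + 1) = 2 * n + 1 + 1 from rfl, Function.iterate_succ_apply',
      Function.iterate_succ_apply']
    refine (avg_mono (avg_mono ih) x).trans ?_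
    refine hN.avg_avg_le (u := fun y => (4 * u x ^ 3 + 16 * M ^ 2 * n * u x) * u y) ?_
      fun y hy => ?_
    · rw [avg_const_mul, avg_const_mul, hu]
    · have h0 := hM x y hy
      have h1 := sq_le_sq' (abs_le.1 h0).1 (abs_le.1 h0).2
      set δ := u y - u x with hδ
      have hy' : u y = u x + δ := by rw [hδ]; ring
      have h2 : 0 ≤ (M ^ 2 - δ ^ 2) * (6 * u x ^ 2 + 2 * u x ^ 2) :=
        mul_nonneg (by linarith) (by positivity)
      have h3 : 0 ≤ (M ^ 2 - δ ^ 2) * (M ^ 2 + δ ^ 2) := mul_nonneg (by linarith) (by positivity)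
      have h4 : 0 ≤ (M ^ 2 - δ ^ 2) * (M ^ 2 * n) := mul_nonneg (by linarith) (by positivity)
      have h5 : 4 * u x * δ ^ 3 ≤ 2 * u x ^ 2 * δ ^ 2 + 2 * δ ^ 4 := by
        nlinarith [sq_nonneg (u x * δ - δ ^ 2)]
      have h6 : 0 ≤ M ^ 4 * n := by positivity
      have h7 : 0 ≤ M ^ 4 := by positivity
      rw [hy']
      push_cast
      nlinarith

/-- The asymptotic energy form. -/
def energy (U : Ultrafilter ℕ) (N : X → Finset X) (x : X) (u v : X → ℝ) : ℝ :=
  limUnder (U : Filter ℕ) fun n : ℕ => (n : ℝ)⁻¹ * (avg N)^[2 * n] (fun z => u z * v z) x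

lemma IsWalk.avg_iterate_abs_le (n : ℕ) {f g : X → ℝ} (h : ∀ x, |f x| ≤ g x) (x : X) :
    |(avg N)^[n] f x| ≤ (avg N)^[n] g x := by
  rw [abs_le]
  refine ⟨?_, avg_iterate_mono (fun y => (abs_le.1 (h y)).2) n x⟩
  have h1 := avg_iterate_mono (N := N) (f := fun _ => (0 : ℝ)) (g := fun y => f y + g y)
    (fun y => by linarith [(abs_le.1 (h y)).1]) n x
  rw [avg_iterate_add, hN.avg_iterate_const] at h1
  linarith

lemma IsWalk.tendsto_energy (U : Ultrafilter ℕ) {u v : X → ℝ} (hu : u ∈ lipHarm N o)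
    (hv : v ∈ lipHarm N o) (x : X) :
    Tendsto (fun n : ℕ => (n : ℝ)⁻¹ * (avg N)^[2 * n] (fun z => u z * v z) x) U
      (𝓝 (energy U N x u v)) := by
  refine tendsto_nhds_limUnder ?_
  obtain ⟨M, hM0, hM⟩ := lipHarm_bound hu
  obtain ⟨M', hM'0, hM'⟩ := lipHarm_bound hv
  refine exists_tendsto_of_bounded U (C := (u x ^ 2 + M ^ 2) + (v x ^ 2 + M' ^ 2)) fun n => ?_
  rcases Nat.eq_zero_or_pos n with rfl | hn
  · simp; positivity
  have h1 := hN.avg_iterate_abs_le (2 * n) (f := fun z => u z * v z)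
    (g := fun z => u z ^ 2 + v z ^ 2) (fun z => by
      rw [abs_le]; constructor <;> nlinarith [sq_nonneg (u z + v z), sq_nonneg (u z - v z)]) x
  rw [avg_iterate_add] at h1
  have h2 := hN.avg_iterate_sq_le hu.2.2 hM n x
  have h3 := hN.avg_iterate_sq_le hv.2.2 hM' n x
  have hn' : (1 : ℝ) ≤ n := by exact_mod_cast hn
  rw [abs_mul, abs_inv, Nat.abs_cast, inv_mul_le_iff₀ (by positivity)]
  nlinarith [mul_nonneg (sub_nonneg.2 hn') (sq_nonneg (u x)),
    mul_nonneg (sub_nonneg.2 hn') (sq_nonneg (v x))]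

lemma IsWalk.avg_iterate_sub_sq_le {C : ℝ} {n : ℕ} (hn : 1 ≤ n)
    (hgood : IsGoodTime N C n) {u : X → ℝ} (hu : avg N (avg N u) = u) {M : ℝ} (hM0 : 0 ≤ M)
    (hM : ∀ x, ∀ y ∈ reach N 2 x, |u y - u x| ≤ M) {x y : X} (hy : y ∈ N x) :
    |(avg N)^[2 * n] (fun z => u z ^ 2) y - (avg N)^[2 * n + 1] (fun z => u z ^ 2) x| ≤
      √(C / n) * (√34 * (|u x| + M) ^ 2 * n) := by
  have hn' : (1 : ℝ) ≤ n := by exact_mod_cast hn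
  set b := |u x| + M
  have h4 : ∀ z ∈ N x, (avg N)^[2 * n] (fun z => u z ^ 4) z ≤ 17 * b ^ 4 * n ^ 2 := by
    intro z hz
    refine (hN.avg_iterate_pow_four_le hu hM n z).trans ?_
    have hzM : |u z - u x| ≤ M := hM x z (mem_reach_add_one.2 ⟨z, hz, hN.self_mem_reach 1 z⟩)
    have hzb : |u z| ≤ b := by
      have := abs_add_le (u z - u x) (u x)
      rw [sub_add_cancel] at this
      change |u z| ≤ |u x| + M
      linarith
    have h1 : u z ^ 2 ≤ b ^ 2 := by rw [← sq_abs]; gcongr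
    have hMb : M ^ 2 ≤ b ^ 2 := by
      have : M ≤ b := le_add_of_nonneg_left (abs_nonneg _)
      gcongr
    have h2 : u z ^ 4 ≤ b ^ 4 := by nlinarith [sq_nonneg (u z), sq_nonneg b]
    have h3 : M ^ 4 ≤ b ^ 4 := by nlinarith [sq_nonneg M, sq_nonneg b]
    have h5 : M ^ 2 * u z ^ 2 ≤ b ^ 4 := by nlinarith [sq_nonneg M, sq_nonneg b, sq_nonneg (u z)]
    have hb4 : 0 ≤ b ^ 4 := by positivity
    have hnn : (n : ℝ) ≤ n ^ 2 := by nlinarith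
    have hn2 : (1 : ℝ) ≤ n ^ 2 := by nlinarith
    calc u z ^ 4 + 8 * M ^ 2 * n * u z ^ 2 + 8 * M ^ 4 * n ^ 2
        = u z ^ 4 * 1 + 8 * n * (M ^ 2 * u z ^ 2) + 8 * M ^ 4 * n ^ 2 := by ring
      _ ≤ b ^ 4 * n ^ 2 + 8 * n ^ 2 * b ^ 4 + 8 * b ^ 4 * n ^ 2 := by gcongr
      _ = _ := by ring
  have h5 : (avg N)^[2 * n + 1] (fun z => u z ^ 4) x ≤ 17 * b ^ 4 * n ^ 2 := by
    rw [Function.iterate_succ_apply', avg, smul_eq_mul,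
      inv_mul_le_iff₀ (by exact_mod_cast hN.card_pos x), ← nsmul_eq_mul]
    exact Finset.sum_le_card_nsmul _ _ _ h4
  refine (hgood (fun z => u z ^ 2) x y hy).trans ?_
  refine mul_le_mul_of_nonneg_left ?_ (Real.sqrt_nonneg _)
  simp only [← pow_mul, show 2 * 2 = 4 from rfl]
  rw [Real.sqrt_le_left (by positivity)]
  have h6 : (√34 * b ^ 2 * n) ^ 2 = 34 * b ^ 4 * n ^ 2 := by
    rw [mul_pow, mul_pow, Real.sq_sqrt (by norm_num)]; ring
  rw [h6]
  linarith [h4 y hy]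

lemma IsWalk.tendsto_energy_odd {U : Ultrafilter ℕ} (hU : (U : Filter ℕ) ≤ atTop) {C : ℝ}
    (hgood : ∀ᶠ n in (U : Filter ℕ), IsGoodTime N C n) {u : X → ℝ}
    (hu : u ∈ lipHarm N o) {x y : X} (hy : y ∈ N x) :
    Tendsto (fun n : ℕ => (n : ℝ)⁻¹ * (avg N)^[2 * n + 1] (fun z => u z * u z) x) U
      (𝓝 (energy U N y u u)) := by
  obtain ⟨M, hM0, hM⟩ := lipHarm_bound hu
  have h1 : Tendsto (fun n : ℕ => (n : ℝ)⁻¹ * (avg N)^[2 * n] (fun z => u z * u z) y -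
      (n : ℝ)⁻¹ * (avg N)^[2 * n + 1] (fun z => u z * u z) x) U (𝓝 0) := by
    have h2 := (tendsto_sqrt_div hU C).mul_const (√34 * (|u x| + M) ^ 2)
    rw [zero_mul] at h2
    refine squeeze_zero_norm' ?_ h2
    filter_upwards [hgood, hU (eventually_ge_atTop 1)] with n hn hn1
    have hn' : (0 : ℝ) < n := by exact_mod_cast hn1
    rw [← mul_sub, Real.norm_eq_abs, abs_mul, abs_inv, Nat.abs_cast, inv_mul_le_iff₀ hn']
    have := hN.avg_iterate_sub_sq_le hn1 hn hu.2.2 hM0 hM hy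
    simp only [sq] at this ⊢
    linarith
  have h3 := (hN.tendsto_energy U hu hu y).sub h1
  simpa using h3

lemma IsWalk.energy_eq {U : Ultrafilter ℕ} (hU : (U : Filter ℕ) ≤ atTop) {C : ℝ}
    (hgood : ∀ᶠ n in (U : Filter ℕ), IsGoodTime N C n) {u : X → ℝ}
    (hu : u ∈ lipHarm N o) (x y : X) : energy U N y u u = energy U N x u u := by
  induction hN.conn x y with
  | refl => rfl
  | tail _ h ih =>
    rw [← ih]
    exact tendsto_nhds_unique (hN.tendsto_energy_odd hU hgood hu h)
      (hN.tendsto_energy_odd hU hgood hu (hN.self_mem _))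

lemma IsWalk.sub_sq_le_energy {U : Ultrafilter ℕ} (hU : (U : Filter ℕ) ≤ atTop) {C : ℝ}
    (hC : 0 ≤ C) (hgood : ∀ᶠ n in (U : Filter ℕ), IsGoodTime N C n) {u : X → ℝ}
    (hu : u ∈ lipHarm N o) {x y : X} (hy : y ∈ N x) :
    (u y - u x) ^ 2 ≤ 8 * C * energy U N o u u := by
  have key : ∀ z ∈ N x, (u z - avg N u x) ^ 2 ≤ 2 * C * energy U N o u u := by
    intro z hz
    have h1 := ((hN.tendsto_energy U hu hu z).add
      (hN.tendsto_energy_odd hU hgood hu hz)).const_mul C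
    rw [hN.energy_eq hU hgood hu o z, ← two_mul] at h1
    refine (ge_of_tendsto h1 ?_).trans (le_of_eq (by ring))
    filter_upwards [hgood] with n hn
    have h2 := hn u x z hz
    rw [Function.iterate_succ_apply', avg_iterate_harmonic hu.2.2,
      ← Real.sqrt_mul (by positivity)] at h2
    have h3 := pow_le_pow_left₀ (abs_nonneg _) h2 2
    have h4 := hN.avg_iterate_nonneg (f := fun z => u z ^ 2) (fun z => sq_nonneg _) (2 * n) z
    have h5 := hN.avg_iterate_nonneg (f := fun z => u z ^ 2) (fun z => sq_nonneg _) (2 * n + 1) x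
    rw [sq_abs, Real.sq_sqrt (by positivity)] at h3
    refine h3.trans (le_of_eq ?_)
    simp only [sq]
    ring
  have h1 := key y hy
  have h2 := key x (hN.self_mem x)
  nlinarith [sq_nonneg ((u y - avg N u x) + (u x - avg N u x))]

lemma IsWalk.energy_add_left (U : Ultrafilter ℕ) {u v w : X → ℝ} (hu : u ∈ lipHarm N o)
    (hv : v ∈ lipHarm N o) (hw : w ∈ lipHarm N o) (x : X) :
    energy U N x (u + v) w = energy U N x u w + energy U N x v w := by
  refine tendsto_nhds_unique (hN.tendsto_energy U (add_mem hu hv) hw x) ?_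
  refine ((hN.tendsto_energy U hu hw x).add (hN.tendsto_energy U hv hw x)).congr fun n => ?_
  rw [← mul_add, ← congrFun (avg_iterate_add _ _ _) x]
  simp only [Pi.add_apply, add_mul]

lemma IsWalk.energy_smul_left (U : Ultrafilter ℕ) {u w : X → ℝ} (hu : u ∈ lipHarm N o)
    (hw : w ∈ lipHarm N o) (a : ℝ) (x : X) :
    energy U N x (a • u) w = a * energy U N x u w := by
  refine tendsto_nhds_unique (hN.tendsto_energy U (Submodule.smul_mem _ a hu) hw x) ?_
  refine ((hN.tendsto_energy U hu hw x).const_mul a).congr fun n => ?_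
  have h := congrFun (avg_iterate_map (N := N) (LinearMap.mulLeft ℝ a) (fun z => u z * w z)
    (2 * n)) x
  simp only [LinearMap.mulLeft_apply] at h
  simp only [Pi.smul_apply, smul_eq_mul, mul_assoc]
  rw [h]
  ring

omit [Group A] [MulAction A X] hN in
lemma energy_comm (U : Ultrafilter ℕ) (x : X) (u v : X → ℝ) :
    energy U N x u v = energy U N x v u := by
  simp only [energy, mul_comm (u _)]

/-- The energy form is an inner product. -/
lemma IsWalk.exists_inner {U : Ultrafilter ℕ} (hU : (U : Filter ℕ) ≤ atTop) {C : ℝ}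
    (hC : 0 ≤ C) (hgood : ∀ᶠ n in (U : Filter ℕ), IsGoodTime N C n) :
    ∃ core : InnerProductSpace.Core ℝ (lipHarm N o),
      ∀ u v : lipHarm N o, core.inner u v = energy U N o u v := by
  refine ⟨{ inner := fun u v => energy U N o u v
            conj_inner_symm := fun u v => energy_comm U o _ _
            re_inner_nonneg := fun u => ?_
            add_left := fun u v w => hN.energy_add_left U u.2 v.2 w.2 o
            smul_left := fun u v a => hN.energy_smul_left U u.2 v.2 a o
            definite := fun u hu => ?_ }, fun _ _ => rfl⟩
  · refine ge_of_tendsto' (hN.tendsto_energy U u.2 u.2 o) fun n => ?_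
    have := hN.avg_iterate_nonneg (f := fun z => u.1 z * u.1 z) (fun z => mul_self_nonneg _)
      (2 * n) o
    positivity
  · ext x
    change u.1 x = 0
    induction hN.conn o x with
    | refl => exact u.2.1
    | tail _ h ih =>
      have h1 := hN.sub_sq_le_energy hU hC hgood u.2 h
      change energy U N o u.1 u.1 = 0 at hu
      rw [hu, mul_zero, ih, sub_zero] at h1
      exact pow_eq_zero_iff two_ne_zero |>.1 (le_antisymm h1 (sq_nonneg _))

lemma IsWalk.card_le_of_orthonormal {U : Ultrafilter ℕ} (hU : (U : Filter ℕ) ≤ atTop) {C : ℝ}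
    (hC : 0 ≤ C) (hgood : ∀ᶠ n in (U : Filter ℕ), IsGoodTime N C n) {ι : Type} [Fintype ι]
    [DecidableEq ι]
    (e : ι → X → ℝ) (he : ∀ i, e i ∈ lipHarm N o)
    (horth : ∀ a : ι → ℝ, energy U N o (∑ i, a i • e i) (∑ i, a i • e i) = ∑ i, a i ^ 2) :
    (Fintype.card ι : ℝ) ≤ 32 * C := by
  have h1 : ∀ x, ∀ y ∈ N x, ∑ i, (e i y - e i x) ^ 2 ≤ 8 * C := by
    intro x y hy
    set s := ∑ i, (e i y - e i x) ^ 2 with hs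
    have h2 := hN.sub_sq_le_energy hU hC hgood (o := o)
      (u := ∑ i, (e i y - e i x) • e i)
      (Submodule.sum_mem _ fun i _ => Submodule.smul_mem _ _ (he i)) hy
    rw [horth] at h2
    have h3 : (∑ i, (e i y - e i x) • e i) y - (∑ i, (e i y - e i x) • e i) x = s := by
      rw [Finset.sum_apply, Finset.sum_apply, ← Finset.sum_sub_distrib, hs]
      refine Finset.sum_congr rfl fun i _ => ?_
      simp only [Pi.smul_apply, smul_eq_mul]; ring
    rw [h3, ← hs] at h2
    by_contra! h4
    have : 0 < s := by linarith [mul_nonneg (by norm_num : (0 : ℝ) ≤ 8) hC]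
    nlinarith
  have h2 : ∀ x, ∀ y ∈ reach N 2 x, ∑ i, (e i y - e i x) ^ 2 ≤ 32 * C := by
    intro x y hy
    obtain ⟨w, hw, hy⟩ := mem_reach_add_one.1 hy
    obtain ⟨v, hv, hy⟩ := mem_reach_add_one.1 hy
    simp only [reach, Finset.mem_singleton] at hy
    subst hy
    have h3 : ∑ i, (e i y - e i x) ^ 2 ≤
        2 * (∑ i, (e i y - e i w) ^ 2 + ∑ i, (e i w - e i x) ^ 2) := by
      rw [← Finset.sum_add_distrib, Finset.mul_sum]
      refine Finset.sum_le_sum fun i _ => ?_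
      nlinarith [sq_nonneg ((e i y - e i w) - (e i w - e i x))]
    linarith [h1 x w hw, h1 w y hv]
  have h3 : ∀ (n : ℕ) x, (avg N)^[2 * n] (fun z => ∑ i, e i z ^ 2) x ≤
      ∑ i, e i x ^ 2 + 32 * C * n := by
    intro n
    induction n with
    | zero => simp
    | succ n ih =>
      intro x
      rw [show 2 * (n + 1) = 2 * n + 1 + 1 from rfl, Function.iterate_succ_apply',
        Function.iterate_succ_apply']
      refine (avg_mono (avg_mono ih) x).trans ?_
      refine hN.avg_avg_le (u := ∑ i, (2 * e i x) • e i)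
        (Submodule.sum_mem (lipHarm N o) fun i _ => Submodule.smul_mem _ _ (he i)).2.2
        fun y hy => ?_
      have h4 := h2 x y hy
      have h5 : ∑ i, e i y ^ 2 = ∑ i, e i x ^ 2 + ∑ i, (e i y - e i x) ^ 2 +
          ((∑ i, (2 * e i x) • e i) y - (∑ i, (2 * e i x) • e i) x) := by
        rw [Finset.sum_apply, Finset.sum_apply, ← Finset.sum_sub_distrib,
          ← Finset.sum_add_distrib, ← Finset.sum_add_distrib]
        refine Finset.sum_congr rfl fun i _ => ?_
        simp only [Pi.smul_apply, smul_eq_mul]; ring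
      rw [h5]
      push_cast
      linarith
  have h4 : ∀ i, energy U N o (e i) (e i) = 1 := fun i => by
    simpa [Pi.single_apply, ite_smul] using horth (Pi.single i 1)
  have h5 : Tendsto (fun n : ℕ => ∑ i, (n : ℝ)⁻¹ * (avg N)^[2 * n] (fun z => e i z * e i z) o) U
      (𝓝 (∑ i : ι, 1)) := by
    refine tendsto_finsetSum _ fun i _ => ?_
    rw [← h4 i]
    exact hN.tendsto_energy U (he i) (he i) o
  have h6 : (∑ i : ι, (1 : ℝ)) = Fintype.card ι := by simp
  rw [h6] at h5
  refine le_of_tendsto h5 ?_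
  filter_upwards [hU (eventually_ge_atTop 1)] with n hn
  have hn' : (0 : ℝ) < n := by exact_mod_cast hn
  rw [← Finset.mul_sum, inv_mul_le_iff₀ hn']
  have h7 : ∑ i, (avg N)^[2 * n] (fun z => e i z * e i z) o =
      (avg N)^[2 * n] (fun z => ∑ i, e i z ^ 2) o := by
    simp only [avg_iterate_eq_sum _ (2 * n) o _ subset_rfl, smul_eq_mul, Finset.mul_sum, sq]
    exact Finset.sum_comm
  rw [h7]
  refine (h3 n o).trans (le_of_eq ?_)
  have h8 : ∀ i, e i o = 0 := fun i => (he i).1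
  simp only [h8]
  simp
  ring

/-- The space of Lipschitz harmonic functions is finite-dimensional. -/
lemma IsWalk.finiteDimensional_lipHarm {c d : ℕ}
    (hg : ∀ n, 1 ≤ n → (reach N n o).card ≤ c * n ^ d) : FiniteDimensional ℝ (lipHarm N o) := by
  obtain ⟨C, hC, hfreq⟩ := hN.frequently_isGoodTime hg
  have hne : NeBot (atTop ⊓ 𝓟 {n | IsGoodTime N C n}) := frequently_mem_iff_neBot.1 hfreq
  set U := Ultrafilter.of (atTop ⊓ 𝓟 {n | IsGoodTime N C n})
  have hU' : (U : Filter ℕ) ≤ _ := Ultrafilter.of_le _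
  have hU : (U : Filter ℕ) ≤ atTop := hU'.trans inf_le_left
  have hgood : ∀ᶠ n in (U : Filter ℕ), IsGoodTime N C n := le_principal_iff.1 (hU'.trans inf_le_right)
  obtain ⟨core, hcore⟩ := hN.exists_inner (o := o) hU hC.le hgood
  by_contra hfin
  obtain ⟨k, hk⟩ := exists_nat_gt (32 * C)
  have hrank : (k : Cardinal) ≤ Module.rank ℝ (lipHarm N o) := by
    by_contra! h
    exact hfin (Module.rank_lt_aleph0_iff.1 (h.trans (Cardinal.natCast_lt_aleph0)))
  obtain ⟨s, hs, hli⟩ := exists_finset_linearIndependent_of_le_rank hrank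
  let : NormedAddCommGroup (lipHarm N o) := core.toNormedAddCommGroup
  let : InnerProductSpace ℝ (lipHarm N o) := InnerProductSpace.ofCore core.toCore
  have hfr : Module.finrank ℝ (Submodule.span ℝ (s : Set (lipHarm N o))) = k := by
    rw [finrank_span_finset_eq_card hli, hs]
  let b := stdOrthonormalBasis ℝ (Submodule.span ℝ (s : Set (lipHarm N o)))
  have := hN.card_le_of_orthonormal (o := o) hU hC.le hgood
    (fun i => ((b i : lipHarm N o) : X → ℝ)) (fun i => (b i : lipHarm N o).2) fun a => by
      have h1 : (∑ i, a i • (((b i : lipHarm N o) : X → ℝ))) =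
          (((∑ i, a i • b i : Submodule.span ℝ (s : Set (lipHarm N o))) : lipHarm N o) : X → ℝ) := by
        simp
      rw [h1, ← hcore]
      change inner ℝ (∑ i, a i • b i) (∑ i, a i • b i) = _
      rw [b.orthonormal.inner_sum]
      simp [sq]
  rw [Fintype.card_fin, hfr] at this
  linarith

end
end TransitiveGrowth

namespace TransitiveGrowth
open scoped Pointwise commutatorElement

/-- The properties of `g ↦ ‖ρ g - 1‖` for a faithful isometric representation `ρ` in finite
dimension. -/
structure IsCommLength {Γ : Type} [Group Γ] (ν : Γ → ℝ) : Prop where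
  nonneg : ∀ g, 0 ≤ ν g
  map_one : ν 1 = 0
  eq_one : ∀ g, ν g = 0 → g = 1
  mul_le : ∀ g h, ν (g * h) ≤ ν g + ν h
  map_inv : ∀ g, ν g⁻¹ = ν g
  conj : ∀ g h, ν (h * g * h⁻¹) = ν g
  comm_le : ∀ g h, ν ⁅g, h⁆ ≤ 2 * ν g * ν h
  le_pow : ∀ g (k : ℕ), k * ν g ≤ ν (g ^ k) + k ^ 2 * ν g ^ 2
  totallyBounded : ∀ ε, 0 < ε → ∃ F : Set Γ, F.Finite ∧ ∀ g, ∃ f ∈ F, ν (f⁻¹ * g) ≤ ε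

/-- The ordered product of the powers `g i ^ a i` for `i < m`. -/
def powProd {Γ : Type} [Group Γ] : ℕ → (ℕ → Γ) → (ℕ → ℕ) → Γ
  | 0, _, _ => 1
  | m + 1, g, a => g 0 ^ a 0 * powProd m (fun i => g (i + 1)) (fun i => a (i + 1))

/-- Iterated commutators of elements of `S`. -/
def iterComm {Γ : Type} [Group Γ] (S : Set Γ) : ℕ → Set Γ
  | 0 => S
  | k + 1 => {x | ∃ g ∈ iterComm S k, ∃ h ∈ S, x = ⁅g, h⁆}

variable {Γ : Type} [Group Γ] {ν : Γ → ℝ} (hν : IsCommLength ν)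

section
include hν

lemma IsCommLength.pow_le (g : Γ) (k : ℕ) : ν (g ^ k) ≤ k * ν g := by
  induction k with
  | zero => simp [hν.map_one]
  | succ k ih => rw [pow_succ]; push_cast; linarith [hν.mul_le (g ^ k) g]

lemma IsCommLength.powProd_le (n : ℕ) : ∀ (m : ℕ) (g : ℕ → Γ) (a : ℕ → ℕ), (∀ i, a i ≤ n) →
    (∀ i < m, ν (g (i + 1)) ≤ ν (g i) / 2) → ν (powProd m g a) ≤ 2 * n * ν (g 0) := by
  intro m
  induction m with
  | zero => intro g a _ _; have := hν.nonneg (g 0); simp only [powProd, hν.map_one]; positivity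
  | succ m ih =>
    intro g a ha hg
    have h1 := ih (fun i => g (i + 1)) (fun i => a (i + 1)) (fun i => ha _)
      (fun i hi => hg _ (by omega))
    have h2 := hν.mul_le (g 0 ^ a 0) (powProd m (fun i => g (i + 1)) (fun i => a (i + 1)))
    have h3 := hν.pow_le (g 0) (a 0)
    have h4 : (a 0 : ℝ) ≤ n := by exact_mod_cast ha 0
    have h5 := hg 0 (by omega)
    have h6 := hν.nonneg (g 0)
    simp only [powProd]
    simp only [zero_add] at h1 h5
    have h7 : 2 * (n : ℝ) * ν (g 1) ≤ n * ν (g 0) := by nlinarith [(Nat.cast_nonneg n : (0:ℝ) ≤ n)]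
    nlinarith

lemma IsCommLength.pow_ne {n : ℕ} {x : Γ} (hx : 32 * n * ν x ≤ 1) (hx1 : x ≠ 1) {k : ℕ}
    (hk : 1 ≤ k) (hkn : k ≤ n) : ν x / 2 < ν (x ^ k) := by
  have h0 : 0 < ν x := lt_of_le_of_ne (hν.nonneg x) fun h => hx1 (hν.eq_one x h.symm)
  have h1 := hν.le_pow x k
  have hk' : (1:ℝ) ≤ k := by exact_mod_cast hk
  have hkn' : (k:ℝ) ≤ n := by exact_mod_cast hkn
  have h2 : (k:ℝ) * ν x ≤ 1 / 32 := by nlinarith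
  nlinarith [mul_le_mul_of_nonneg_left h2 (mul_nonneg (zero_le_one.trans hk') h0.le)]

lemma IsCommLength.powProd_injective {n : ℕ} (hn : 1 ≤ n) : ∀ (m : ℕ) (g : ℕ → Γ) (a b : ℕ → ℕ),
    (∀ i, a i < n) → (∀ i, b i < n) → (∀ i < m, g i ≠ 1) → (∀ i, 32 * n * ν (g i) ≤ 1) →
    (∀ i < m, 16 * n * ν (g (i + 1)) ≤ ν (g i)) → powProd m g a = powProd m g b →
    ∀ i < m, a i = b i := by
  intro m
  induction m with
  | zero => intro g a b _ _ _ _ _ _ i hi; omega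
  | succ m ih =>
    intro g a b ha hb h1 hs hd h
    have hn' : (1:ℝ) ≤ n := by exact_mod_cast hn
    have key : ∀ a b : ℕ → ℕ, (∀ i, a i < n) → (∀ i, b i < n) →
        powProd (m + 1) g a = powProd (m + 1) g b → ¬ b 0 < a 0 := by
      intro a b ha hb h hlt
      simp only [powProd] at h
      set T := powProd m (fun i => g (i + 1)) (fun i => a (i + 1))
      set T' := powProd m (fun i => g (i + 1)) (fun i => b (i + 1))
      have hT : ∀ a : ℕ → ℕ, (∀ i, a i < n) →
          ν (powProd m (fun i => g (i + 1)) (fun i => a (i + 1))) ≤ 2 * n * ν (g 1) := by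
        intro a ha
        refine hν.powProd_le n m _ _ (fun i => (ha _).le) fun i hi => ?_
        have := hd (i + 1) (by omega)
        nlinarith [hν.nonneg (g (i + 1 + 1))]
      have h2 : g 0 ^ (a 0 - b 0) = T' * T⁻¹ := by
        rw [eq_mul_inv_iff_mul_eq, pow_sub _ hlt.le]
        have : g 0 ^ a 0 * (g 0 ^ b 0)⁻¹ = (g 0 ^ b 0)⁻¹ * g 0 ^ a 0 :=
          (((Commute.refl (g 0)).pow_pow _ _).inv_right).eq
        rw [this, mul_assoc, h]; group
      have h3 := hν.mul_le T' T⁻¹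
      rw [hν.map_inv, ← h2] at h3
      have h4 := hν.pow_ne (n := n) (hs 0) (h1 0 (by omega)) (k := a 0 - b 0) (by omega)
        (by have := ha 0; omega)
      have h5 := hd 0 (by omega)
      have := hT a ha
      have := hT b hb
      simp only [zero_add] at h5
      nlinarith [hν.nonneg (g 0)]
    have h0 : a 0 = b 0 := le_antisymm (not_lt.1 (key a b ha hb h)) (not_lt.1 (key b a hb ha h.symm))
    intro i hi
    cases i with
    | zero => exact h0
    | succ i =>
      simp only [powProd, h0] at h
      exact ih (fun i => g (i + 1)) (fun i => a (i + 1)) (fun i => b (i + 1)) (fun _ => ha _)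
        (fun _ => hb _) (fun i hi => h1 _ (by omega)) (fun _ => hs _) (fun i hi => hd _ (by omega))
        (mul_left_cancel h) i (by omega)

end

lemma powProd_mem {E : Set Γ} (hE : IsGenSet ⊥ E) (n : ℕ) : ∀ (m ℓ : ℕ) (g : ℕ → Γ) (a : ℕ → ℕ),
    (∀ i < m, g i ∈ E ^ (4 ^ i * ℓ)) → (∀ i, a i ≤ n) →
    ∃ e, e + n * ℓ ≤ n * ℓ * 4 ^ m ∧ powProd m g a ∈ E ^ e := by
  intro m
  induction m with
  | zero => intro ℓ g a _ _; exact ⟨0, by simp, by simp [powProd]⟩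
  | succ m ih =>
    intro ℓ g a hg ha
    obtain ⟨e, he, hm⟩ := ih (4 * ℓ) (fun i => g (i + 1)) (fun i => a (i + 1)) (fun i hi => by
      have := hg (i + 1) (by omega); rwa [pow_succ, mul_assoc] at this) (fun i => ha _)
    refine ⟨n * ℓ + e, ?_, ?_⟩
    · rw [pow_succ]; nlinarith
    · refine mul_mem_pow_add ?_ hm
      have h1 : g 0 ^ a 0 ∈ (E ^ ℓ) ^ (a 0) := Set.pow_mem_pow (by simpa using hg 0 (by omega))
      rw [← pow_mul] at h1
      exact hE.pow_mono (by rw [mul_comm]; exact Nat.mul_le_mul_right _ (ha 0)) h1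

lemma exists_seq_of_mem_iterComm {S : Set Γ} : ∀ (m : ℕ) (x : Γ), x ∈ iterComm S m →
    ∃ g : ℕ → Γ, g m = x ∧ g 0 ∈ S ∧ (∀ k < m, ∃ h ∈ S, g (k + 1) = ⁅g k, h⁆) ∧
      ∀ k, m < k → g k = 1 := by
  intro m
  induction m with
  | zero =>
    intro x hx
    exact ⟨fun k => if k = 0 then x else 1, by simp, by simpa [iterComm] using hx, by simp,
      fun k hk => by simp; omega⟩
  | succ m ih =>
    rintro x ⟨y, hy, h, hh, rfl⟩
    obtain ⟨g, hg, h0, hs, h1⟩ := ih y hy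
    refine ⟨fun k => if k = m + 1 then ⁅y, h⁆ else g k, by simp, by simpa using h0, fun k hk => ?_,
      fun k hk => ?_⟩
    · rcases Nat.lt_succ_iff_lt_or_eq.1 hk with hk | rfl
      · obtain ⟨h', hh', e⟩ := hs k hk
        exact ⟨h', hh', by
          simp only [show ¬ k + 1 = m + 1 by omega, show ¬ k = m + 1 by omega, if_false, e]⟩
      · exact ⟨h, hh, by simp [hg]⟩
    · have : ¬ k = m + 1 := by omega
      simpa [this] using h1 k (by omega)

section
include hν

lemma IsCommLength.exists_iterComm_eq_one {E : Set Γ} {c d ℓ n : ℕ} (hE : IsGenSet ⊥ E)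
    (hg : HasGrowth ⊥ E c d) (hℓ : 1 ≤ ℓ) (hn : n = 2 * 4 ^ d) {S : Set Γ} (hS : S ⊆ E ^ ℓ)
    (hSν : ∀ g ∈ S, 32 * n * ν g ≤ 1) : ∃ m, 1 ≤ m ∧ ∀ x ∈ iterComm S m, x = 1 := by
  have hn1 : 1 ≤ n := by
    have : 0 < 4 ^ d := by positivity
    omega
  have hn' : (1:ℝ) ≤ n := by exact_mod_cast hn1
  set m := c * (n * ℓ) ^ d + 1 with hm
  refine ⟨m, by omega, fun x hx => ?_⟩
  by_contra hx1
  obtain ⟨g, rfl, h0, hs, h1⟩ := exists_seq_of_mem_iterComm m x hx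
  have hbig : ∀ k < m, 16 * n * ν (g (k + 1)) ≤ ν (g k) := by
    intro k hk
    obtain ⟨h, hh, e⟩ := hs k hk
    have h2 := hν.comm_le (g k) h
    have h3 := hSν h hh
    have h4 := hν.nonneg (g k)
    rw [e]
    nlinarith
  have hle : ∀ k, 32 * n * ν (g k) ≤ 1 := by
    intro k
    induction k with
    | zero => exact hSν _ h0
    | succ k ih =>
      by_cases hk : k < m
      · have := hbig k hk
        nlinarith [hν.nonneg (g (k + 1)), hν.nonneg (g k)]
      · rw [h1 _ (by omega), hν.map_one]; simp
  have hne : ∀ k, g (m - k) ≠ 1 := by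
    intro k
    induction k with
    | zero => exact hx1
    | succ k ih =>
      by_cases hk : k < m
      · intro h2
        obtain ⟨h, hh, e⟩ := hs (m - (k + 1)) (by omega)
        rw [h2, commutatorElement_one_left] at e
        exact ih (by rw [show m - k = m - (k + 1) + 1 by omega]; exact e)
      · rw [show m - (k + 1) = m - k by omega]; exact ih
  have hmem : ∀ k ≤ m, g k ∈ E ^ (4 ^ k * ℓ) := by
    intro k
    induction k with
    | zero => intro _; simpa using hS h0
    | succ k ih =>
      intro hk
      obtain ⟨h, hh, e⟩ := hs k (by omega)
      have h2 := ih (by omega)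
      have h3 : h ∈ E ^ (4 ^ k * ℓ) :=
        hE.pow_mono (Nat.le_mul_of_pos_left _ (by positivity)) (hS hh)
      rw [e, commutatorElement_def]
      have := mul_mem_pow_add (mul_mem_pow_add (mul_mem_pow_add h2 h3) (hE.inv_mem_pow h2))
        (hE.inv_mem_pow h3)
      rwa [show 4 ^ k * ℓ + 4 ^ k * ℓ + 4 ^ k * ℓ + 4 ^ k * ℓ = 4 ^ (k + 1) * ℓ by ring] at this
  let ext : (Fin m → Fin n) → ℕ → ℕ := fun a i => if h : i < m then a ⟨i, h⟩ else 0
  have hext : ∀ a i, ext a i < n := by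
    intro a i
    simp only [ext]
    split_ifs
    · exact (a _).2
    · omega
  let Φ : (Fin m → Fin n) → Γ ⧸ (⊥ : Subgroup Γ) := fun a => QuotientGroup.mk (powProd m g (ext a))
  have hΦ : Function.Injective Φ := by
    intro a b hab
    have h2 : powProd m g (ext a) = powProd m g (ext b) := by
      have := QuotientGroup.eq.1 hab
      rw [Subgroup.mem_bot, inv_mul_eq_one] at this
      exact this
    have h3 := hν.powProd_injective hn1 m g (ext a) (ext b) (hext a) (hext b)
      (fun i hi => by have := hne (m - i); rwa [show m - (m - i) = i by omega] at this) hle hbig h2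
    funext i
    have := h3 i i.2
    simp only [ext, i.2, dif_pos] at this
    exact Fin.ext this
  have hcard : ((n ^ m : ℕ) : ℕ∞) ≤ ((c * (n * ℓ * 4 ^ m) ^ d : ℕ) : ℕ∞) := by
    refine le_trans ?_ (hg (n * ℓ * 4 ^ m) (Nat.mul_pos (Nat.mul_pos hn1 hℓ) (by positivity)))
    have h2 : (Set.range Φ).encard = ((n ^ m : ℕ) : ℕ∞) := by
      rw [← Set.image_univ, hΦ.encard_image, Set.encard_univ]; simp
    rw [← h2]
    refine Set.encard_le_encard ?_
    rintro _ ⟨a, rfl⟩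
    obtain ⟨e, he, hm⟩ := powProd_mem hE n m ℓ g (ext a) (fun i hi => hmem i hi.le)
      (fun i => (hext a i).le)
    exact ⟨_, hE.pow_mono (by omega) hm, rfl⟩
  have hcard' : n ^ m ≤ c * (n * ℓ * 4 ^ m) ^ d := by exact_mod_cast hcard
  have h4 : n ^ m = 2 ^ m * (4 ^ m) ^ d := by rw [hn, mul_pow, ← pow_mul, ← pow_mul, mul_comm d m]
  rw [h4, mul_pow (n * ℓ), ← mul_assoc] at hcard'
  have h5 := Nat.le_of_mul_le_mul_right hcard' (by positivity)
  have := Nat.lt_two_pow_self (n := m)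
  omega

lemma IsCommLength.eq_one_of_pow_le {x : Γ} (h : ∀ k : ℕ, ν (x ^ k) ≤ 1 / 8) : x = 1 := by
  by_contra hx
  have h0 : 0 < ν x := lt_of_le_of_ne (hν.nonneg x) fun h => hx (hν.eq_one x h.symm)
  have key : ∀ k : ℕ, ν x * (3 / 2) ^ k ≤ ν (x ^ 2 ^ k) := by
    intro k
    induction k with
    | zero => simp
    | succ k ih =>
      have h1 := hν.le_pow (x ^ 2 ^ k) 2
      have h2 := h (2 ^ k)
      rw [← pow_mul, ← pow_succ] at h1
      push_cast at h1
      rw [pow_succ (3 / 2 : ℝ)]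
      nlinarith [hν.nonneg (x ^ 2 ^ k)]
  obtain ⟨k, hk⟩ := pow_unbounded_of_one_lt (1 / (ν x)) (show (1:ℝ) < 3 / 2 by norm_num)
  rw [div_lt_iff₀ h0] at hk
  linarith [key k, h (2 ^ k)]

lemma IsCommLength.commute_of_iterComm {S : Set Γ} (hSν : ∀ g ∈ S, 32 * ν g ≤ 1) :
    ∀ m, (∀ x ∈ iterComm S (m + 1), x = 1) → ∀ x ∈ iterComm S 1, x = 1 := by
  intro m
  induction m with
  | zero => exact fun h => h
  | succ m ih =>
    intro h
    refine ih ?_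
    rintro z ⟨g, hg, w, hw, rfl⟩
    have hc : ⁅⁅g, w⁆, w⁆ = 1 := h _ ⟨⁅g, w⁆, ⟨g, hg, w, hw, rfl⟩, w, hw, rfl⟩
    have hcw : Commute ⁅g, w⁆ w := commutatorElement_eq_one_iff_commute.1 hc
    -- `[g, w]^k = [g, w^k]`
    have hpow : ∀ k : ℕ, ⁅g, w⁆ ^ k = ⁅g, w ^ k⁆ := by
      intro k
      induction k with
      | zero => simp
      | succ k ihk =>
        rw [pow_succ, ihk, pow_succ' w, ← ihk]
        have h2 : ⁅g, w * w ^ k⁆ = ⁅g, w⁆ * (w * ⁅g, w ^ k⁆ * w⁻¹) := by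
          simp only [commutatorElement_def]; group
        rw [h2, ← ihk, ← (hcw.pow_left k).eq, mul_inv_cancel_right, ← pow_succ', pow_succ]
    have hgν : 32 * ν g ≤ 1 := by
      have : ∀ k, ∀ g ∈ iterComm S k, 32 * ν g ≤ 1 := by
        intro k
        induction k with
        | zero => exact hSν
        | succ k ih =>
          rintro _ ⟨g, hg, h, hh, rfl⟩
          nlinarith [hν.comm_le g h, ih g hg, hSν h hh, hν.nonneg g, hν.nonneg h]
      exact this m g hg
    refine hν.eq_one_of_pow_le fun k => ?_
    rw [hpow, commutatorElement_def, mul_assoc, mul_assoc, ← mul_assoc (w ^ k)]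
    have h3 := hν.mul_le g (w ^ k * g⁻¹ * (w ^ k)⁻¹)
    rw [hν.conj, hν.map_inv] at h3
    linarith

/-- A group of polynomial growth with a faithful isometric finite-dimensional representation
is virtually abelian. -/
theorem IsCommLength.exists_finiteIndex_comm {d : ℕ} (h : PolyGrowth (⊥ : Subgroup Γ) d) :
    ∃ H : Subgroup Γ, H.FiniteIndex ∧ ∀ x ∈ H, ∀ y ∈ H, x * y = y * x := by
  obtain ⟨E, c, hE, hg⟩ := h
  set n := 2 * 4 ^ d with hn
  have hn1 : 1 ≤ n := by
    have : 0 < 4 ^ d := by positivity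
    omega
  have hn' : (1:ℝ) ≤ n := by exact_mod_cast hn1
  obtain ⟨F, hF, hFν⟩ := hν.totallyBounded (1 / (32 * n)) (by positivity)
  obtain ⟨m₀, hm₀, hFE⟩ := hE.exists_subset_pow (hF.insert 1)
  let S : Set Γ := {g | g ∈ E ^ (m₀ + 1 + m₀) ∧ 32 * n * ν g ≤ 1}
  obtain ⟨m, hm, hm1⟩ := hν.exists_iterComm_eq_one (S := S) hE hg (ℓ := m₀ + 1 + m₀) (by omega) hn
    (fun g hg => hg.1) (fun g hg => hg.2)
  obtain ⟨m, rfl⟩ := Nat.exists_eq_add_of_le' hm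
  have hcomm := hν.commute_of_iterComm (S := S)
    (fun g hg => by nlinarith [hg.2, hν.nonneg g]) m hm1
  refine ⟨Subgroup.closure S, ?_, ?_⟩
  · have hdec := hE.exists_mem_mul (F := insert 1 F) (L := Subgroup.closure S) (by simp)
      (Subgroup.one_mem _) (fun x hx y hy => Subgroup.mul_mem _ hx hy) (by
        intro e he f hf
        obtain ⟨f', hf', hle⟩ := hFν (e * f)
        refine ⟨f', Or.inr hf', f'⁻¹ * (e * f), Subgroup.subset_closure ⟨?_, ?_⟩, by group⟩
        · rw [add_assoc]
          exact mul_mem_pow_add (hE.inv_mem_pow (hFE (Or.inr hf')))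
            (mul_mem_pow_add (by simpa using he) (hFE hf))
        · rwa [le_div_iff₀ (by positivity), mul_comm] at hle)
    refine @Subgroup.finiteIndex_of_finite_quotient _ _ _ ?_
    rw [← Set.finite_univ_iff]
    refine ((hF.insert 1).image (QuotientGroup.mk : Γ → Γ ⧸ Subgroup.closure S)).subset ?_
    intro q _
    induction q using QuotientGroup.induction_on with
    | H g =>
      obtain ⟨f, hf, l, hl, rfl⟩ := hdec g
      exact ⟨f, hf, (QuotientGroup.mk_mul_of_mem f hl).symm⟩
  · intro x hx y hy
    refine Subgroup.closure_induction₂ (p := fun x y _ _ => x * y = y * x) ?_ ?_ ?_ ?_ ?_ ?_ ?_ hx hy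
    · intro x y hx hy
      exact commutatorElement_eq_one_iff_mul_comm.1 (hcomm _ ⟨x, hx, y, hy, rfl⟩)
    · simp
    · simp
    · intro x y z _ _ _ h1 h2; exact Commute.mul_left h1 h2
    · intro x y z _ _ _ h1 h2; exact Commute.mul_right h1 h2
    · intro x y _ _ h; exact Commute.inv_left h
    · intro x y _ _ h; exact Commute.inv_right h

end
end TransitiveGrowth

namespace TransitiveGrowth
open scoped Pointwise commutatorElement

lemma isCommLength_norm_sub_one {R : Type} [NormedRing R] [NormedAlgebra ℝ R] [ProperSpace R]
    (G : Subgroup Rˣ) (hG : ∀ g ∈ G, ‖(g : R)‖ ≤ 1) :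
    IsCommLength (fun g : G => ‖((g : Rˣ) : R) - 1‖) := by
  have hl : ∀ (g : G) (x : R), ‖((g : Rˣ) : R) * x‖ ≤ ‖x‖ := fun g x =>
    (norm_mul_le _ _).trans (mul_le_of_le_one_left (norm_nonneg _) (hG g g.2))
  have hr : ∀ (g : G) (x : R), ‖x * ((g : Rˣ) : R)‖ ≤ ‖x‖ := fun g x =>
    (norm_mul_le _ _).trans (mul_le_of_le_one_right (norm_nonneg _) (hG g g.2))
  have hmul : ∀ g h : G, ‖(((g * h : G) : Rˣ) : R) - 1‖ ≤
      ‖((g : Rˣ) : R) - 1‖ + ‖((h : Rˣ) : R) - 1‖ := by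
    intro g h
    have : (((g * h : G) : Rˣ) : R) - 1 =
        (((g : Rˣ) : R) - 1) + ((g : Rˣ) : R) * (((h : Rˣ) : R) - 1) := by
      simp [mul_sub]
    rw [this]
    exact (norm_add_le _ _).trans (add_le_add le_rfl (hl _ _))
  have hinv : ∀ g : G, ‖(((g⁻¹ : G) : Rˣ) : R) - 1‖ ≤ ‖((g : Rˣ) : R) - 1‖ := by
    intro g
    have : (((g⁻¹ : G) : Rˣ) : R) - 1 = ((g⁻¹ : G) : Rˣ) * (1 - ((g : Rˣ) : R)) := by
      simp [mul_sub]
    rw [this, norm_sub_rev ((g : Rˣ) : R)]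
    exact hl _ _
  have hconj : ∀ g h : G, ‖(((h * g * h⁻¹ : G) : Rˣ) : R) - 1‖ ≤ ‖((g : Rˣ) : R) - 1‖ := by
    intro g h
    have : (((h * g * h⁻¹ : G) : Rˣ) : R) - 1 =
        ((h : Rˣ) : R) * (((g : Rˣ) : R) - 1) * ((h⁻¹ : G) : Rˣ) := by
      simp [mul_sub, sub_mul]
    rw [this]
    exact (hr _ _).trans (hl _ _)
  have hpow : ∀ (g : G) (k : ℕ), ‖(((g ^ k : G) : Rˣ) : R) - 1‖ ≤ k * ‖((g : Rˣ) : R) - 1‖ := by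
    intro g k
    induction k with
    | zero => simp
    | succ k ih => rw [pow_succ, Nat.cast_succ]; linarith [hmul (g ^ k) g]
  refine ⟨fun _ => norm_nonneg _, by simp, fun g hg => ?_, hmul, fun g => ?_, fun g h => ?_,
    fun g h => ?_, fun g k => ?_, fun ε hε => ?_⟩
  · rw [norm_eq_zero, sub_eq_zero] at hg
    exact Subtype.ext (Units.ext hg)
  · refine le_antisymm (hinv g) ?_
    simpa using hinv g⁻¹
  · refine le_antisymm (hconj g h) ?_
    have := hconj (h * g * h⁻¹) h⁻¹
    simpa [mul_assoc] using this
  · have : (((⁅g, h⁆ : G) : Rˣ) : R) - 1 =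
        ((((g : Rˣ) : R) - 1) * (((h : Rˣ) : R) - 1) - (((h : Rˣ) : R) - 1) * (((g : Rˣ) : R) - 1)) *
          ((g⁻¹ : G) : Rˣ) * ((h⁻¹ : G) : Rˣ) := by
      have h1 : (((⁅g, h⁆ : G) : Rˣ) : R) = (g : Rˣ) * (h : Rˣ) * ((g⁻¹ : G) : Rˣ) * ((h⁻¹ : G) : Rˣ) := by
        simp [commutatorElement_def]
      have h2 : (1 : R) = (h : Rˣ) * (g : Rˣ) * ((g⁻¹ : G) : Rˣ) * ((h⁻¹ : G) : Rˣ) := by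
        simp
      rw [h1]
      conv_lhs => rw [h2]
      noncomm_ring
    rw [this]
    refine (hr _ _).trans ((hr _ _).trans ((norm_sub_le _ _).trans ?_))
    have h1 := norm_mul_le (((g : Rˣ) : R) - 1) (((h : Rˣ) : R) - 1)
    have h2 := norm_mul_le (((h : Rˣ) : R) - 1) (((g : Rˣ) : R) - 1)
    nlinarith
  · have key : ∀ k : ℕ, ‖(((g ^ k : G) : Rˣ) : R) - 1 - k * (((g : Rˣ) : R) - 1)‖ ≤
        k ^ 2 * ‖((g : Rˣ) : R) - 1‖ ^ 2 := by
      intro k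
      induction k with
      | zero => simp
      | succ k ih =>
        have : (((g ^ (k + 1) : G) : Rˣ) : R) - 1 - ((k + 1 : ℕ) : R) * (((g : Rˣ) : R) - 1) =
            ((((g ^ k : G) : Rˣ) : R) - 1 - k * (((g : Rˣ) : R) - 1)) +
              ((((g ^ k : G) : Rˣ) : R) - 1) * (((g : Rˣ) : R) - 1) := by
          push_cast [pow_succ]; noncomm_ring
        rw [this]
        refine (norm_add_le _ _).trans ?_
        have h1 := norm_mul_le ((((g ^ k : G) : Rˣ) : R) - 1) (((g : Rˣ) : R) - 1)
        have h2 := mul_le_mul_of_nonneg_right (hpow g k) (norm_nonneg (((g : Rˣ) : R) - 1))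
        rw [Nat.cast_succ]
        nlinarith [sq_nonneg ‖((g : Rˣ) : R) - 1‖, (Nat.cast_nonneg k : (0:ℝ) ≤ k)]
    have h1 : ‖(k : R) * (((g : Rˣ) : R) - 1)‖ = k * ‖((g : Rˣ) : R) - 1‖ := by
      rw [← nsmul_eq_mul, ← Nat.cast_smul_eq_nsmul ℝ, norm_smul]; simp
    have h2 := norm_sub_norm_le ((k : R) * (((g : Rˣ) : R) - 1)) ((((g ^ k : G) : Rˣ) : R) - 1)
    rw [norm_sub_rev _ ((((g ^ k : G) : Rˣ) : R) - 1), h1] at h2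
    linarith [key k]
  · have htb : TotallyBounded (Set.range fun g : G => ((g : Rˣ) : R)) := by
      refine (isCompact_closedBall (0 : R) 1).totallyBounded.subset ?_
      rintro _ ⟨g, rfl⟩
      simpa using hG g g.2
    obtain ⟨t, hts, htf, ht⟩ := totallyBounded_iff_subset.1 htb _ (Metric.dist_mem_uniformity hε)
    choose s' hs' using hts
    let s : R → G := fun y => open Classical in if h : y ∈ t then s' h else 1
    have hs : ∀ y ∈ t, ((s y : Rˣ) : R) = y := fun y hy => by simp only [s, hy, dif_pos]; exact hs' hy
    refine ⟨s '' t, htf.image s, fun g => ?_⟩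
    have := ht ⟨g, rfl⟩
    simp only [Set.mem_iUnion] at this
    obtain ⟨y, hy, hgy⟩ := this
    refine ⟨s y, ⟨y, hy, rfl⟩, ?_⟩
    have h1 : ((((s y)⁻¹ * g : G) : Rˣ) : R) - 1 =
        (((s y)⁻¹ : G) : Rˣ) * (((g : Rˣ) : R) - ((s y : Rˣ) : R)) := by
      simp [mul_sub]
    rw [h1]
    refine (hl _ _).trans ?_
    have h2 : ((s y : Rˣ) : R) = y := hs y hy
    rw [h2, ← dist_eq_norm]
    exact le_of_lt hgy

end TransitiveGrowth

namespace TransitiveGrowth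
open scoped Pointwise

lemma PolyGrowth.fg {B : Type} [Group B] {d : ℕ} (h : PolyGrowth (⊥ : Subgroup B) d) :
    Group.FG B := by
  obtain ⟨E, c, hE, hg⟩ := h
  refine Group.fg_iff.2 ⟨E, hE.closure_eq, ?_⟩
  have h1 := hg.finite hE 1
  rw [pow_one] at h1
  refine h1.of_finite_image fun x _ y _ hxy => ?_
  have := QuotientGroup.eq.1 hxy
  rwa [Subgroup.mem_bot, inv_mul_eq_one] at this

lemma exists_surjective_int {B : Type} [CommGroup B] [Group.FG B] [Infinite B] :
    ∃ φ : B →* Multiplicative ℤ, Function.Surjective φ := by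
  obtain ⟨ι, j, _, _, p, hp, e, ⟨f⟩⟩ := CommGroup.equiv_free_prod_prod_multiplicative_zmod B
  have : Nonempty j := by
    by_contra hj
    rw [not_nonempty_iff] at hj
    have : ∀ i, NeZero (p i ^ e i) := fun i => ⟨pow_ne_zero _ (hp i).ne_zero⟩
    have : ∀ i, Finite (Multiplicative (ZMod (p i ^ e i))) := fun i =>
      inferInstanceAs (Finite (ZMod (p i ^ e i)))
    have : Finite B := Finite.of_equiv _ f.symm.toEquiv
    exact not_finite B
  obtain ⟨i⟩ := this
  refine ⟨(Pi.evalMonoidHom _ i).comp ((MonoidHom.fst _ _).comp f.toMonoidHom), fun x => ?_⟩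
  exact ⟨f.symm (fun _ => x, 1), by simp⟩

/-- A hom with infinite commutative image yields a surjection to `ℤ`. -/
lemma exists_surjective_int_of_infinite {H M : Type} [Group H] [CommGroup M] {K : Subgroup H}
    {d : ℕ} (h : PolyGrowth K d) (ψ : H →* M) (hK : (ψ '' (K : Set H)).Finite)
    (hinf : (Set.range ψ).Infinite) :
    ∃ φ : H →* Multiplicative ℤ, Function.Surjective φ ∧ K ≤ φ.ker ∧ ψ.ker ≤ φ.ker := by
  have hfin : (ψ.rangeRestrict '' (K : Set H)).Finite := by
    refine Set.Finite.of_finite_image (f := Subtype.val) ?_ Subtype.val_injective.injOn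
    rw [← Set.image_comp]; exact hK
  have hB : Group.FG ψ.range :=
    (h.map ψ.rangeRestrict (MonoidHom.rangeRestrict_surjective ψ) hfin).fg
  have : Infinite ψ.range := Set.infinite_coe_iff.2 (by rwa [MonoidHom.coe_range])
  obtain ⟨φ, hφ⟩ := exists_surjective_int (B := ψ.range)
  refine ⟨φ.comp ψ.rangeRestrict, hφ.comp (MonoidHom.rangeRestrict_surjective ψ), ?_, ?_⟩
  · intro k hk
    rw [MonoidHom.mem_ker]
    have h1 : ((φ.comp ψ.rangeRestrict) '' (K : Set H)).Finite := by
      have := hfin.image φ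
      rwa [← Set.image_comp] at this
    have h2 : Finite (K.map (φ.comp ψ.rangeRestrict)) := h1.to_subtype
    have h3 := isOfFinOrder_of_finite
      (⟨_, Subgroup.mem_map_of_mem (φ.comp ψ.rangeRestrict) hk⟩ : K.map (φ.comp ψ.rangeRestrict))
    have h4 := Submonoid.isOfFinOrder_coe.2 h3
    obtain ⟨n, hn, h5⟩ := isOfFinOrder_iff_pow_eq_one.1 h4
    have h6 : n • Multiplicative.toAdd ((φ.comp ψ.rangeRestrict) k) = 0 := h5
    exact (smul_eq_zero.1 h6).resolve_left hn.ne'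
  · intro g hg
    rw [MonoidHom.mem_ker] at hg ⊢
    have : ψ.rangeRestrict g = 1 := Subtype.ext hg
    simp [this]

lemma exists_finiteIndex_comm_of_isometric {A W : Type} [Group A] [NormedAddCommGroup W]
    [NormedSpace ℝ W] [FiniteDimensional ℝ W] (ρ : A →* (W →L[ℝ] W))
    (hρ : ∀ g w, ‖ρ g w‖ ≤ ‖w‖) {K : Subgroup A} {d : ℕ} (h : PolyGrowth K d)
    (hK : (ρ '' (K : Set A)).Finite) :
    ∃ H : Subgroup A, H.FiniteIndex ∧ (∀ g, ρ g = 1 → g ∈ H) ∧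
      ∀ x ∈ H, ∀ y ∈ H, ρ x * ρ y = ρ y * ρ x := by
  let ρ' := ρ.toHomUnits
  let G := ρ'.range
  have hfin : (ρ'.rangeRestrict '' (K : Set A)).Finite := by
    refine Set.Finite.of_finite_image (f := fun g : G => ((g : (W →L[ℝ] W)ˣ) : W →L[ℝ] W)) ?_
      (fun x _ y _ h => Subtype.ext (Units.ext h))
    rw [← Set.image_comp]; exact hK
  have : ProperSpace (W →L[ℝ] W) := FiniteDimensional.proper ℝ _
  have hν := isCommLength_norm_sub_one G (by
    rintro _ ⟨g, rfl⟩
    exact ContinuousLinearMap.opNorm_le_bound _ zero_le_one fun w => by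
      rw [one_mul]; exact hρ g w)
  obtain ⟨H, hH, hcomm⟩ := hν.exists_finiteIndex_comm
    (h.map ρ'.rangeRestrict (MonoidHom.rangeRestrict_surjective _) hfin)
  refine ⟨H.comap ρ'.rangeRestrict, ?_, fun g hg => ?_, fun x hx y hy => ?_⟩
  · refine ⟨?_⟩
    rw [Subgroup.index_comap_of_surjective _ (MonoidHom.rangeRestrict_surjective _)]
    exact hH.index_ne_zero
  · have : ρ'.rangeRestrict g = 1 := Subtype.ext (Units.ext hg)
    rw [Subgroup.mem_comap, this]; exact H.one_mem
  · have := congrArg (fun g : G => ((g : (W →L[ℝ] W)ˣ) : W →L[ℝ] W)) (hcomm _ hx _ hy)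
    exact this

lemma exists_finiteIndex_comm_of_core {A W : Type} [Group A] [AddCommGroup W] [Module ℝ W]
    [FiniteDimensional ℝ W] [Norm W] (core : NormedSpace.Core ℝ W) (σ : A →* (W →ₗ[ℝ] W))
    (hσ : ∀ g w, ‖σ g w‖ ≤ ‖w‖) {K : Subgroup A} {d : ℕ} (h : PolyGrowth K d)
    (hK : (σ '' (K : Set A)).Finite) :
    ∃ H : Subgroup A, H.FiniteIndex ∧ (∀ g, σ g = 1 → g ∈ H) ∧
      ∀ x ∈ H, ∀ y ∈ H, σ x * σ y = σ y * σ x := by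
  let : NormedAddCommGroup W := NormedAddCommGroup.ofCore core
  let : NormedSpace ℝ W := NormedSpace.ofCore core
  let ρ : A →* (W →L[ℝ] W) :=
    { toFun := fun g => LinearMap.toContinuousLinearMap (σ g)
      map_one' := by ext1 u; simp
      map_mul' := fun x y => by ext1 u; simp }
  have hρ : ∀ x y, ρ x = ρ y ↔ σ x = σ y := fun x y =>
    LinearMap.toContinuousLinearMap.injective.eq_iff
  obtain ⟨H, h1, h2, h3⟩ := exists_finiteIndex_comm_of_isometric ρ hσ h (by
    have : ρ '' (K : Set A) = LinearMap.toContinuousLinearMap '' (σ '' (K : Set A)) := by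
      rw [← Set.image_comp]; rfl
    rw [this]; exact hK.image _)
  refine ⟨H, h1, fun g hg => h2 g ?_, fun x hx y hy => ?_⟩
  · rw [← map_one ρ, hρ, hg, map_one]
  · rw [← map_mul, ← map_mul, ← hρ, map_mul, map_mul]
    exact h3 x hx y hy

lemma exists_finite_determining {X : Type} (W : Submodule ℝ (X → ℝ)) [FiniteDimensional ℝ W] :
    ∃ S : Finset X, ∀ u ∈ W, (∀ x ∈ S, u x = 0) → u = 0 := by
  classical
  let V : Finset X → Submodule ℝ W := fun S =>
    ⨅ x ∈ S, LinearMap.ker ((LinearMap.proj x : (X → ℝ) →ₗ[ℝ] ℝ).comp W.subtype)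
  have hV : ∀ S (u : W), u ∈ V S ↔ ∀ x ∈ S, u.1 x = 0 := by
    intro S u; simp [V]
  obtain ⟨_, ⟨S, rfl⟩, hS⟩ := WellFounded.has_min (wellFounded_lt (α := Submodule ℝ W))
    (Set.range V) ⟨_, ∅, rfl⟩
  refine ⟨S, fun u hu h0 => ?_⟩
  by_contra hne
  obtain ⟨x, hx⟩ := Function.ne_iff.1 hne
  refine hS (V (insert x S)) ⟨_, rfl⟩ (lt_of_le_of_ne ?_ ?_)
  · intro v hv
    rw [hV] at hv ⊢
    exact fun y hy => hv y (Finset.mem_insert_of_mem hy)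
  · intro he
    have h1 : (⟨u, hu⟩ : W) ∈ V S := (hV _ _).2 h0
    rw [← he, hV] at h1
    exact hx (h1 x (Finset.mem_insert_self _ _))

section
variable {A X : Type} [Group A] [MulAction A X] {N : X → Finset X} {o : X}

/-- The Lipschitz norm on Lipschitz harmonic functions. -/
def lipNorm (N : X → Finset X) (o : X) (u : lipHarm N o) : ℝ :=
  ⨆ p : {p : X × X // p.2 ∈ N p.1}, |u.1 p.1.1 - u.1 p.1.2|

lemma bddAbove_lipNorm (u : lipHarm N o) :
    BddAbove (Set.range fun p : {p : X × X // p.2 ∈ N p.1} => |u.1 p.1.1 - u.1 p.1.2|) := by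
  obtain ⟨-, ⟨L, hL⟩, -⟩ := u.2
  exact ⟨L, by rintro _ ⟨p, rfl⟩; exact hL _ _ p.2⟩

lemma le_lipNorm (u : lipHarm N o) {x y : X} (h : y ∈ N x) : |u.1 x - u.1 y| ≤ lipNorm N o u :=
  le_ciSup (bddAbove_lipNorm u) ⟨(x, y), h⟩

variable (hN : IsWalk A N)
include hN

lemma IsWalk.lipNorm_le (u : lipHarm N o) {L : ℝ} (h : ∀ x, ∀ y ∈ N x, |u.1 x - u.1 y| ≤ L) :
    lipNorm N o u ≤ L :=
  have : Nonempty {p : X × X // p.2 ∈ N p.1} := ⟨⟨(o, o), hN.self_mem o⟩⟩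
  ciSup_le fun p => h _ _ p.2

lemma IsWalk.lipNorm_nonneg (u : lipHarm N o) : 0 ≤ lipNorm N o u :=
  (abs_nonneg _).trans (le_lipNorm u (hN.self_mem o))

lemma IsWalk.lipNorm_core :
    @NormedSpace.Core ℝ (lipHarm N o) _ _ _ ⟨lipNorm N o⟩ :=
  letI : Norm (lipHarm N o) := ⟨lipNorm N o⟩
  { norm_nonneg := hN.lipNorm_nonneg
    norm_smul := by
      have key : ∀ (a : ℝ) (u : lipHarm N o), lipNorm N o (a • u) ≤ |a| * lipNorm N o u := by
        intro a u
        refine hN.lipNorm_le _ fun x y hy => ?_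
        have h1 : (a • u).1 x - (a • u).1 y = a * (u.1 x - u.1 y) := by
          change a * u.1 x - a * u.1 y = _; ring
        rw [h1, abs_mul]
        exact mul_le_mul_of_nonneg_left (le_lipNorm u hy) (abs_nonneg _)
      intro a u
      refine le_antisymm (key a u) ?_
      rcases eq_or_ne a 0 with rfl | ha
      · rw [norm_zero, zero_mul]; exact hN.lipNorm_nonneg _
      · have h1 := key a⁻¹ (a • u)
        rw [inv_smul_smul₀ ha, abs_inv, ← div_eq_inv_mul, le_div_iff₀' (abs_pos.2 ha)] at h1
        exact h1
    norm_triangle := fun u v => hN.lipNorm_le _ fun x y hy => by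
      have h1 : (u + v).1 x - (u + v).1 y = (u.1 x - u.1 y) + (v.1 x - v.1 y) := by
        change u.1 x + v.1 x - (u.1 y + v.1 y) = _; ring
      rw [h1]
      exact (abs_add_le _ _).trans (add_le_add (le_lipNorm u hy) (le_lipNorm v hy))
    norm_eq_zero_iff := fun u => by
      constructor
      · intro h
        ext x
        change u.1 x = 0
        induction hN.conn o x with
        | refl => exact u.2.1
        | tail _ h' ih =>
          have h1 := le_lipNorm u h'
          change lipNorm N o u = 0 at h
          rw [h, ih, zero_sub, abs_neg] at h1
          exact abs_eq_zero.1 (le_antisymm h1 (abs_nonneg _))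
      · rintro rfl
        exact le_antisymm (hN.lipNorm_le _ fun x y _ => by simp) (hN.lipNorm_nonneg _) }

lemma IsWalk.translate_mem (g : A) {u : X → ℝ} (hu : u ∈ lipHarm N o) :
    (fun x => u (g⁻¹ • x) - u (g⁻¹ • o)) ∈ lipHarm N o := by
  obtain ⟨h0, ⟨L, hL⟩, hu⟩ := hu
  refine ⟨by simp, ⟨L, fun x y hy => ?_⟩, ?_⟩
  · rw [sub_sub_sub_cancel_right]; exact hL _ _ (hN.smul_mem _ _ _ hy)
  · have h1 : ∀ f : X → ℝ, avg N (fun x => f (g⁻¹ • x) - u (g⁻¹ • o)) =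
        fun x => avg N f (g⁻¹ • x) - u (g⁻¹ • o) := by
      intro f
      simp only [sub_eq_add_neg]
      rw [avg_add, hN.avg_const]
      funext x
      rw [hN.avg_smul f g⁻¹ x]
    rw [h1, h1, hu]

/-- The linear action on Lipschitz harmonic functions modulo constants. -/
def IsWalk.lipRep (o : X) : A →* (lipHarm N o →ₗ[ℝ] lipHarm N o) where
  toFun g :=
    { toFun := fun u => ⟨_, hN.translate_mem g u.2⟩
      map_add' := fun u v => by
        ext x
        change u.1 _ + v.1 _ - (u.1 _ + v.1 _) = (u.1 _ - u.1 _) + (v.1 _ - v.1 _)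
        ring
      map_smul' := fun a u => by
        ext x
        change a * u.1 _ - a * u.1 _ = a * (u.1 _ - u.1 _)
        ring }
  map_one' := by
    ext u x
    change u.1 _ - u.1 _ = u.1 x
    simp [u.2.1]
  map_mul' g h := by
    ext u x
    change u.1 _ - u.1 _ = (u.1 _ - u.1 _) - (u.1 _ - u.1 _)
    simp [mul_smul]

lemma IsWalk.lipRep_apply (g : A) (u : lipHarm N o) (x : X) :
    (hN.lipRep o g u).1 x = u.1 (g⁻¹ • x) - u.1 (g⁻¹ • o) := rfl

/-- If the action on Lipschitz harmonic functions has polynomial growth, its image is virtually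
abelian. -/
lemma IsWalk.exists_finiteIndex_comm [FiniteDimensional ℝ (lipHarm N o)] {K : Subgroup A} {d : ℕ}
    (h : PolyGrowth K d) (hK : (hN.lipRep o '' (K : Set A)).Finite) :
    ∃ H : Subgroup A, H.FiniteIndex ∧ (∀ g, hN.lipRep o g = 1 → g ∈ H) ∧
      ∀ x ∈ H, ∀ y ∈ H, hN.lipRep o x * hN.lipRep o y = hN.lipRep o y * hN.lipRep o x := by
  let : Norm (lipHarm N o) := ⟨lipNorm N o⟩
  refine exists_finiteIndex_comm_of_core hN.lipNorm_core (hN.lipRep o) (fun g u => ?_) h hK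
  refine hN.lipNorm_le _ fun x y hy => ?_
  change |u.1 _ - u.1 _ - (u.1 _ - u.1 _)| ≤ lipNorm N o u
  rw [sub_sub_sub_cancel_right]
  exact le_lipNorm u (hN.smul_mem _ _ _ hy)

end
end TransitiveGrowth

namespace TransitiveGrowth
open scoped Pointwise

/-- `M` contains a finite intersection of conjugates of `K`. -/
def IsOpenRel {A : Type} [Group A] (K M : Subgroup A) : Prop :=
  ∃ S : Set A, S.Finite ∧ ∀ g : A, (∀ s ∈ S, s⁻¹ * g * s ∈ K) → g ∈ M

section walk
variable {A : Type} [Group A] {K : Subgroup A} {E : Set A}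

lemma IsGenSet.finite_neighbors {c d : ℕ} (hE : IsGenSet K E) (hg : HasGrowth K E c d)
    (q : A ⧸ K) : {q' : A ⧸ K | ∃ g h : A, q = g ∧ q' = h ∧ g⁻¹ * h ∈ E}.Finite := by
  induction q using QuotientGroup.induction_on with
  | H g =>
    have h1 := hg.finite hE 1
    rw [pow_one] at h1
    refine (h1.image (fun q => g • q)).subset ?_
    rintro _ ⟨g', h, hgg, rfl, hE'⟩
    have hk : g⁻¹ * g' ∈ K := QuotientGroup.eq.1 hgg
    refine ⟨_, ⟨g⁻¹ * h, ?_, rfl⟩, ?_⟩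
    · have := hE.mul_mem _ hk _ hE'
      rwa [show g⁻¹ * g' * (g'⁻¹ * h) = g⁻¹ * h by group] at this
    · change ((g * (g⁻¹ * h) : A) : A ⧸ K) = h
      rw [mul_inv_cancel_left]

/-- The coset graph of `(A, K, E)`. -/
def cosetNbhd {c d : ℕ} (hE : IsGenSet K E) (hg : HasGrowth K E c d) (q : A ⧸ K) :
    Finset (A ⧸ K) :=
  (hE.finite_neighbors hg q).toFinset

lemma mem_cosetNbhd {c d : ℕ} (hE : IsGenSet K E) (hg : HasGrowth K E c d) {g : A} {q : A ⧸ K} :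
    q ∈ cosetNbhd hE hg (g : A ⧸ K) ↔ ∃ e ∈ E, q = ((g * e : A) : A ⧸ K) := by
  simp only [cosetNbhd, Set.Finite.mem_toFinset, Set.mem_ofPred_eq]
  constructor
  · rintro ⟨g', h, hgg, rfl, hE'⟩
    have hk : g⁻¹ * g' ∈ K := QuotientGroup.eq.1 hgg
    refine ⟨g⁻¹ * h, ?_, by rw [mul_inv_cancel_left]⟩
    have := hE.mul_mem _ hk _ hE'
    rwa [show g⁻¹ * g' * (g'⁻¹ * h) = g⁻¹ * h by group] at this
  · rintro ⟨e, he, rfl⟩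
    exact ⟨g, g * e, rfl, rfl, by simpa using he⟩

lemma isWalk_cosetNbhd {c d : ℕ} (hE : IsGenSet K E) (hg : HasGrowth K E c d) :
    IsWalk A (cosetNbhd hE hg) where
  self_mem q := by
    induction q using QuotientGroup.induction_on with
    | H g => exact (mem_cosetNbhd hE hg).2 ⟨1, hE.one_mem, by simp⟩
  symm q q' h := by
    induction q using QuotientGroup.induction_on with
    | H g =>
      obtain ⟨e, he, rfl⟩ := (mem_cosetNbhd hE hg).1 h
      exact (mem_cosetNbhd hE hg).2 ⟨e⁻¹, hE.inv_mem e he, by simp⟩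
  smul_mem a q q' h := by
    induction q using QuotientGroup.induction_on with
    | H g =>
      obtain ⟨e, he, rfl⟩ := (mem_cosetNbhd hE hg).1 h
      exact (mem_cosetNbhd hE hg (g := a * g)).2 ⟨e, he, by rw [mul_assoc]; rfl⟩
  trans := MulAction.exists_smul_eq A
  conn q q' := by
    induction q using QuotientGroup.induction_on with
    | H g =>
      induction q' using QuotientGroup.induction_on with
      | H g' =>
        obtain ⟨n, -, hn⟩ := hE.exists_mem_pow (g⁻¹ * g')
        have key : ∀ n, ∀ x ∈ E ^ n, Relation.ReflTransGen (fun x y => y ∈ cosetNbhd hE hg x)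
            (g : A ⧸ K) ((g * x : A) : A ⧸ K) := by
          intro n
          induction n with
          | zero => intro x hx; rw [pow_zero, Set.mem_one] at hx; rw [hx, mul_one]
          | succ n ih =>
            intro x hx
            rw [pow_succ] at hx
            obtain ⟨y, hy, e, he, rfl⟩ := hx
            exact (ih y hy).tail ((mem_cosetNbhd hE hg).2 ⟨e, he, by simp [mul_assoc]⟩)
        simpa using key n _ hn

lemma reach_cosetNbhd {c d : ℕ} (hE : IsGenSet K E) (hg : HasGrowth K E c d) (n : ℕ) :
    ∀ (g : A) (q : A ⧸ K), q ∈ reach (cosetNbhd hE hg) n (g : A ⧸ K) →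
      ∃ e ∈ E ^ n, q = ((g * e : A) : A ⧸ K) := by
  induction n with
  | zero => intro g q hq; exact ⟨1, by simp, by simpa [reach] using hq⟩
  | succ n ih =>
    intro g q hq
    rw [mem_reach_add_one] at hq
    obtain ⟨z, hz, hq⟩ := hq
    obtain ⟨e, he, rfl⟩ := (mem_cosetNbhd hE hg).1 hz
    obtain ⟨e', he', rfl⟩ := ih _ _ hq
    exact ⟨e * e', by rw [pow_succ']; exact Set.mul_mem_mul he he', by rw [mul_assoc]⟩

lemma card_reach_cosetNbhd {c d : ℕ} (hE : IsGenSet K E) (hg : HasGrowth K E c d) (n : ℕ)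
    (hn : 1 ≤ n) : (reach (cosetNbhd hE hg) n ((1 : A) : A ⧸ K)).card ≤ c * n ^ d := by
  have h1 : ((reach (cosetNbhd hE hg) n ((1 : A) : A ⧸ K)).card : ℕ∞) ≤ ((c * n ^ d : ℕ) : ℕ∞) := by
    refine le_trans ?_ (hg n hn)
    rw [← Set.encard_coe_eq_coe_finsetCard]
    refine Set.encard_le_encard fun q hq => ?_
    obtain ⟨e, he, rfl⟩ := reach_cosetNbhd hE hg n 1 q hq
    exact ⟨e, he, by simp⟩
  exact_mod_cast h1

/-- `K`-orbits on `A ⧸ K` are finite. -/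
lemma PolyGrowth.finite_orbit {d : ℕ} (h : PolyGrowth K d) (q : A ⧸ K) :
    {q' : A ⧸ K | ∃ k ∈ K, q' = k • q}.Finite := by
  obtain ⟨E, c, hE, hg⟩ := h
  induction q using QuotientGroup.induction_on with
  | H g =>
    obtain ⟨n, hn, hgn⟩ := hE.exists_mem_pow g
    refine (hg.finite hE n).subset ?_
    rintro _ ⟨k, hk, rfl⟩
    exact ⟨k * g, hE.mul_mem_pow hn hk hgn, rfl⟩

end walk

section
variable {A : Type} [Group A] {K : Subgroup A}

lemma smul_one_coset {k : A} (hk : k ∈ K) : k • ((1 : A) : A ⧸ K) = ((1 : A) : A ⧸ K) := by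
  change ((k * 1 : A) : A ⧸ K) = _
  rw [mul_one]
  exact (QuotientGroup.eq.2 (by simpa using hk)).symm

variable {N : A ⧸ K → Finset (A ⧸ K)} (hN : IsWalk A N)
include hN

lemma IsWalk.lipRep_image_finite {d : ℕ} (h : PolyGrowth K d)
    [FiniteDimensional ℝ (lipHarm N ((1 : A) : A ⧸ K))] :
    (hN.lipRep ((1 : A) : A ⧸ K) '' (K : Set A)).Finite := by
  obtain ⟨S, hS⟩ := exists_finite_determining (lipHarm N ((1 : A) : A ⧸ K))
  have hfin : {f : S → A ⧸ K | ∀ x, f x ∈ {q' : A ⧸ K | ∃ k ∈ K, q' = k • x.1}}.Finite :=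
    Set.Finite.pi' fun x => h.finite_orbit x.1
  let R : A → S → A ⧸ K := fun g x => g⁻¹ • x.1
  have hR : (R '' (K : Set A)).Finite := by
    refine hfin.subset ?_
    rintro _ ⟨k, hk, rfl⟩ x
    exact ⟨k⁻¹, K.inv_mem hk, rfl⟩
  -- the operator is determined by the restriction of the translation to `S`
  have hdet : ∀ k ∈ K, ∀ k' ∈ K, R k = R k' →
      hN.lipRep ((1 : A) : A ⧸ K) k = hN.lipRep ((1 : A) : A ⧸ K) k' := by
    intro k hk k' hk' he
    refine LinearMap.ext fun u => ?_
    rw [← sub_eq_zero]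
    refine Subtype.ext (hS _ (Subtype.prop _) fun x hx => ?_)
    change (hN.lipRep _ k u).1 x - (hN.lipRep _ k' u).1 x = 0
    have h1 := congrFun he ⟨x, hx⟩
    simp only [R] at h1
    rw [hN.lipRep_apply, hN.lipRep_apply, h1, smul_one_coset (K.inv_mem hk),
      smul_one_coset (K.inv_mem hk'), sub_self]
  choose! s hs using fun f (hf : f ∈ R '' (K : Set A)) => hf
  refine ((hR.image s).image (hN.lipRep ((1 : A) : A ⧸ K))).subset ?_
  rintro _ ⟨k, hk, rfl⟩
  have h1 : R k ∈ R '' (K : Set A) := ⟨k, hk, rfl⟩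
  exact ⟨_, ⟨_, h1, rfl⟩, hdet _ (hs _ h1).1 _ hk (hs _ h1).2⟩

lemma IsWalk.exists_lipRep_eq_one [FiniteDimensional ℝ (lipHarm N ((1 : A) : A ⧸ K))] :
    ∃ S : Set A, S.Finite ∧ ∀ g : A, (∀ s ∈ S, s⁻¹ * g * s ∈ K) →
      g ∈ K ∧ hN.lipRep ((1 : A) : A ⧸ K) g = 1 := by
  obtain ⟨S, hS⟩ := exists_finite_determining (lipHarm N ((1 : A) : A ⧸ K))
  refine ⟨insert 1 (Quotient.out '' (S : Set (A ⧸ K))), (S.finite_toSet.image _).insert 1,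
    fun g hg => ?_⟩
  have hK : g ∈ K := by simpa using hg 1 (Or.inl rfl)
  refine ⟨hK, LinearMap.ext fun u => ?_⟩
  rw [← sub_eq_zero]
  refine Subtype.ext (hS _ (Subtype.prop _) fun x hx => ?_)
  have h1 : g⁻¹ • x = x := by
    rw [inv_smul_eq_iff]
    have h2 := hg x.out (Or.inr ⟨x, hx, rfl⟩)
    conv_lhs => rw [← QuotientGroup.out_eq' x]
    conv_rhs => rw [← QuotientGroup.out_eq' x]
    change _ = ((g * x.out : A) : A ⧸ K)
    exact QuotientGroup.eq.2 (by rwa [← mul_assoc])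
  change (hN.lipRep _ g u).1 x - u.1 x = 0
  rw [hN.lipRep_apply, h1, smul_one_coset (K.inv_mem hK), u.2.1]
  ring

/-- A harmonic function invariant under a finite-index subgroup is constant. -/
lemma IsWalk.eq_zero_of_invariant (A₀ : Subgroup A) [A₀.Normal] [A₀.FiniteIndex]
    {u : A ⧸ K → ℝ} (hu : u ∈ lipHarm N ((1 : A) : A ⧸ K)) (hinv : ∀ g ∈ A₀, ∀ x, u (g • x) = u x) :
    u = 0 := by
  have hfin : (Set.range u).Finite := by
    refine (Set.finite_range fun q : A ⧸ A₀ => u ((q.out : A) : A ⧸ K)).subset ?_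
    rintro _ ⟨x, rfl⟩
    induction x using QuotientGroup.induction_on with
    | H g =>
      refine ⟨(g : A ⧸ A₀), ?_⟩
      have h1 : (g : A ⧸ A₀).out⁻¹ * g ∈ A₀ :=
        QuotientGroup.eq.1 (QuotientGroup.out_eq' (g : A ⧸ A₀))
      have h2 : g * (g : A ⧸ A₀).out⁻¹ ∈ A₀ := (‹A₀.Normal›.mem_comm_iff).1 h1
      have := hinv _ h2 (((g : A ⧸ A₀).out : A) : A ⧸ K)
      change u ((g * (g : A ⧸ A₀).out⁻¹ * (g : A ⧸ A₀).out : A) : A ⧸ K) = _ at this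
      rw [inv_mul_cancel_right] at this
      exact this.symm
  obtain ⟨_, ⟨x, rfl⟩, hx⟩ := Set.exists_max_image _ id hfin ⟨_, Set.mem_range_self ((1 : A) : A ⧸ K)⟩
  have hle : ∀ y, u y ≤ u x := fun y => hx _ ⟨y, rfl⟩
  have hconst : ∀ y, u y = u x := by
    intro y
    induction hN.conn x y with
    | refl => rfl
    | @tail a b _ h ih =>
      have h1 := hN.le_card_sq_mul_avg_avg (f := fun z => u x + (-1) * u z)
        (fun z => by linarith [hle z]) h
      rw [avg_add, avg_add, avg_const_mul, avg_const_mul, hu.2.2, hN.avg_const, hN.avg_const] at h1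
      beta_reduce at h1
      rw [ih] at h1
      have := hle b
      linarith
  funext y
  rw [hconst y, ← hconst ((1 : A) : A ⧸ K), hu.1]; rfl

end

/-- A pair of polynomial growth with infinitely many cosets virtually maps onto `ℤ`. -/
theorem PolyGrowth.exists_surjective_int {A : Type} [Group A] {K : Subgroup A} {d : ℕ}
    (h : PolyGrowth K d) [Infinite (A ⧸ K)] :
    ∃ A₀ : Subgroup A, A₀.Normal ∧ A₀.FiniteIndex ∧ ∃ φ : A₀ →* Multiplicative ℤ,
      Function.Surjective φ ∧ K.subgroupOf A₀ ≤ φ.ker ∧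
        IsOpenRel K (φ.ker.map A₀.subtype) := by
  have hPG := h
  obtain ⟨E, c, hE, hg⟩ := h
  have hN := isWalk_cosetNbhd hE hg
  set N := cosetNbhd hE hg
  have : FiniteDimensional ℝ (lipHarm N ((1 : A) : A ⧸ K)) :=
    hN.finiteDimensional_lipHarm (card_reach_cosetNbhd hE hg)
  obtain ⟨S, hS, hSρ⟩ := hN.exists_lipRep_eq_one
  set ρ := hN.lipRep ((1 : A) : A ⧸ K)
  have hopen : ∀ (A₀ : Subgroup A) (φ : A₀ →* Multiplicative ℤ), (∀ g, ρ g = 1 → g ∈ A₀) →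
      K.subgroupOf A₀ ≤ φ.ker → IsOpenRel K (φ.ker.map A₀.subtype) := by
    intro A₀ φ h1 h2
    refine ⟨S, hS, fun g hg => ?_⟩
    obtain ⟨hgK, hgρ⟩ := hSρ g hg
    exact ⟨⟨g, h1 g hgρ⟩, h2 hgK, rfl⟩
  have hKρ : (ρ '' (K : Set A)).Finite := hN.lipRep_image_finite hPG
  by_cases hρ : (Set.range ρ).Finite
  · -- the kernel has finite index and acts by translations
    have hfi : ρ.toHomUnits.ker.FiniteIndex := by
      have : Finite ρ.toHomUnits.range := by
        rw [← SetLike.coe_sort_coe, Set.finite_coe_iff, MonoidHom.coe_range]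
        refine Set.Finite.of_finite_image (f := Units.val) ?_ Units.val_injective.injOn
        rw [← Set.range_comp]; exact hρ
      exact Subgroup.finiteIndex_ker _
    set A₀ := ρ.toHomUnits.ker with hA₀
    have hmem : ∀ g, g ∈ A₀ ↔ ρ g = 1 := fun g => by
      rw [hA₀, MonoidHom.mem_ker, Units.ext_iff]; rfl
    obtain ⟨u, hu0, hul, huh, hune⟩ := hN.exists_harmonic (card_reach_cosetNbhd hE hg)
    have huW : u ∈ lipHarm N ((1 : A) : A ⧸ K) := ⟨hu0, ⟨_, hul⟩, huh⟩
    have htr : ∀ g ∈ A₀, ∀ x, u (g • x) = u x + u (g • ((1 : A) : A ⧸ K)) := by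
      intro g hg x
      have h1 : ρ g⁻¹ = 1 := (hmem _).1 (A₀.inv_mem hg)
      have h2 : (ρ g⁻¹ ⟨u, huW⟩).1 x = u x := by rw [h1]; rfl
      rw [hN.lipRep_apply, inv_inv] at h2
      simp only at h2
      linarith
    let ψ : A₀ →* Multiplicative ℝ :=
      { toFun := fun g => Multiplicative.ofAdd (u (g.1 • ((1 : A) : A ⧸ K)))
        map_one' := by simp [hu0]
        map_mul' := fun g h => by
          rw [← ofAdd_add, add_comm]
          congr 1
          change u ((g.1 * h.1) • ((1 : A) : A ⧸ K)) = _
          rw [mul_smul, htr g.1 g.2] }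
    have hψK : ∀ k ∈ K.subgroupOf A₀, ψ k = 1 := by
      intro k hk
      change Multiplicative.ofAdd (u (k.1 • ((1 : A) : A ⧸ K))) = 1
      rw [smul_one_coset (K := K) (k := k.1) (Subgroup.mem_subgroupOf.1 hk), hu0]; rfl
    have hψ : ∃ g, ψ g ≠ 1 := by
      by_contra! hall
      refine hune (hN.eq_zero_of_invariant A₀ huW fun g hg x => ?_)
      have h1 : u (g • ((1 : A) : A ⧸ K)) = 0 := hall ⟨g, hg⟩
      rw [htr g hg, h1, add_zero]
    have hinf : (Set.range ψ).Infinite := by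
      obtain ⟨g, hg⟩ := hψ
      refine Set.infinite_of_injective_forall_mem (f := fun n : ℕ => ψ (g ^ n)) ?_
        fun n => ⟨_, rfl⟩
      intro m n hmn
      simp only [map_pow] at hmn
      have h1 : m • Multiplicative.toAdd (ψ g) = n • Multiplicative.toAdd (ψ g) := hmn
      rw [nsmul_eq_mul, nsmul_eq_mul] at h1
      exact_mod_cast mul_right_cancel₀ (show Multiplicative.toAdd (ψ g) ≠ 0 from hg) h1
    obtain ⟨φ, h1, h2, -⟩ := exists_surjective_int_of_infinite (hPG.finiteIndex A₀) ψ
      ((Set.finite_singleton 1).subset (by rintro _ ⟨k, hk, rfl⟩; exact hψK k hk)) hinf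
    exact ⟨A₀, inferInstance, hfi, φ, h1, h2, hopen A₀ φ (fun g hg => (hmem g).2 hg) h2⟩
  · obtain ⟨H, hHf, hHρ, hHc⟩ := hN.exists_finiteIndex_comm hPG hKρ
    set A₀ := H.normalCore
    have hA₀ : ∀ g, ρ g = 1 → g ∈ A₀ := by
      intro g hg b
      refine hHρ _ ?_
      change ρ (b * g * b⁻¹) = 1
      rw [map_mul, map_mul, hg, mul_one, ← map_mul, mul_inv_cancel, map_one]
    let ρ₀ : A₀ →* ((lipHarm N ((1 : A) : A ⧸ K)) →ₗ[ℝ] (lipHarm N ((1 : A) : A ⧸ K)))ˣ :=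
      ρ.toHomUnits.comp A₀.subtype
    let inst : CommGroup ρ₀.range :=
      { (inferInstance : Group ρ₀.range) with
        mul_comm := by
          rintro ⟨_, x, rfl⟩ ⟨_, y, rfl⟩
          exact Subtype.ext (Units.ext (hHc _ (H.normalCore_le x.2) _ (H.normalCore_le y.2))) }
    have hval : Function.Injective fun x : ρ₀.range => (x.1.1 :
        (lipHarm N ((1 : A) : A ⧸ K)) →ₗ[ℝ] (lipHarm N ((1 : A) : A ⧸ K))) :=
      fun x y h => Subtype.ext (Units.ext h)
    let ψ : A₀ →* ρ₀.range := ρ₀.rangeRestrict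
    obtain ⟨φ, h1, h2, -⟩ := exists_surjective_int_of_infinite (hPG.finiteIndex A₀) ψ (by
      refine Set.Finite.of_finite_image (hKρ.subset ?_) hval.injOn
      rintro _ ⟨_, ⟨k, hk, rfl⟩, rfl⟩
      exact ⟨k.1, hk, rfl⟩) (by
      intro hfin
      refine hρ ?_
      have h3 : (ρ '' (A₀ : Set A)).Finite := by
        refine (hfin.image fun x : ρ₀.range => (x.1.1 : _ →ₗ[ℝ] _)).subset ?_
        rintro _ ⟨g, hg, rfl⟩
        exact ⟨_, ⟨⟨g, hg⟩, rfl⟩, rfl⟩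
      refine ((Set.finite_range fun q : A ⧸ A₀ => ρ q.out).mul h3).subset ?_
      rintro _ ⟨g, rfl⟩
      refine ⟨_, ⟨(g : A ⧸ A₀), rfl⟩, _, ⟨(g : A ⧸ A₀).out⁻¹ * g,
        QuotientGroup.eq.1 (QuotientGroup.out_eq' (g : A ⧸ A₀)), rfl⟩, ?_⟩
      simp only
      rw [← map_mul, mul_inv_cancel_left])
    exact ⟨A₀, inferInstance, inferInstance, φ, h1, h2, hopen A₀ φ hA₀ h2⟩

end TransitiveGrowth

namespace TransitiveGrowth
open Polynomial

section

variable {M : Type} [AddCommGroup M]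

lemma not_torsion_zsmul {v : M} (hv : ∀ n : ℤ, n ≠ 0 → n • v ≠ 0) {m : ℤ} (hm : m ≠ 0) :
    ∀ n : ℤ, n ≠ 0 → n • (m • v) ≠ 0 := by
  intro n hn
  rw [smul_smul]
  exact hv _ (mul_ne_zero hn hm)

lemma exists_irreducible_annihilator (T : Module.End ℤ M) (p : ℤ[X]) :
    p ≠ 0 → ∀ v : M, (∀ n : ℤ, n ≠ 0 → n • v ≠ 0) → aeval T p v = 0 →
      ∃ (q f : ℤ[X]), Irreducible f ∧ f ∣ p ∧ aeval T f (aeval T q v) = 0 ∧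
        ∀ n : ℤ, n ≠ 0 → n • aeval T q v ≠ 0 := by
  induction p using WfDvdMonoid.induction_on_irreducible with
  | zero => intro h; exact absurd rfl h
  | unit u hu =>
    intro _ v hv h0
    exfalso
    obtain ⟨w, hw⟩ := hu.exists_left_inv
    have : aeval T (w * u) v = 0 := by
      rw [map_mul, Module.End.mul_apply, h0, map_zero]
    rw [hw, map_one, Module.End.one_apply] at this
    exact hv 1 one_ne_zero (by rw [this, smul_zero])
  | mul a i ha hi ih =>
    intro hne v hv h0
    by_cases hw : ∀ n : ℤ, n ≠ 0 → n • aeval T a v ≠ 0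
    · refine ⟨a, i, hi, dvd_mul_right i a, ?_, hw⟩
      rwa [map_mul, Module.End.mul_apply] at h0
    · push Not at hw
      obtain ⟨m, hm, hmv⟩ := hw
      obtain ⟨q, f, hf, hfa, h1, h2⟩ := ih ha (m • v) (not_torsion_zsmul hv hm) (by
        rw [map_zsmul, hmv])
      refine ⟨q * C m, f, hf, hfa.mul_left i, ?_⟩
      have : aeval T (q * C m) v = aeval T q (m • v) := by
        rw [map_mul, Module.End.mul_apply, aeval_C]; rfl
      rw [this]
      exact ⟨h1, h2⟩

lemma exists_int_multiple (p : ℚ[X]) :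
    ∃ (n : ℤ) (q : ℤ[X]), n ≠ 0 ∧ q.map (Int.castRingHom ℚ) = C (n : ℚ) * p := by
  obtain ⟨b, hb0, hb⟩ := IsLocalization.integerNormalization_spec (nonZeroDivisors ℤ) p
  refine ⟨b, IsLocalization.integerNormalization (nonZeroDivisors ℤ) p,
    nonZeroDivisors.ne_zero hb0, ?_⟩
  have h2 : (algebraMap ℤ ℚ) = Int.castRingHom ℚ := rfl
  rw [h2] at hb
  rw [hb]
  ext i
  simp

lemma irreducible_dvd_of_annihilator (T : Module.End ℤ M) {f g : ℤ[X]} (hf : Irreducible f)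
    (hdeg : f.natDegree ≠ 0) {w : M} (hw : ∀ n : ℤ, n ≠ 0 → n • w ≠ 0)
    (h1 : aeval T f w = 0) (h2 : aeval T g w = 0) :
    f.map (Int.castRingHom ℚ) ∣ g.map (Int.castRingHom ℚ) := by
  have hprim := hf.isPrimitive hdeg
  have hfQ := (IsPrimitive.Int.irreducible_iff_irreducible_map_cast hprim).1 hf
  rcases (dvd_or_isCoprime _ (g.map (Int.castRingHom ℚ)) hfQ).symm with h | h
  · exfalso
    obtain ⟨a, b, hab⟩ := h
    obtain ⟨n, a', hn, ha'⟩ := exists_int_multiple a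
    obtain ⟨m, b', hm, hb'⟩ := exists_int_multiple b
    have key : C m * (a' * f) + C n * (b' * g) = C (n * m) := by
      apply Polynomial.map_injective (Int.castRingHom ℚ) Int.cast_injective
      have hC : ∀ j : ℤ, (C j).map (Int.castRingHom ℚ) = C (j : ℚ) := fun j => map_C _
      rw [C_mul]
      simp only [Polynomial.map_add, Polynomial.map_mul, ha', hb', hC]
      linear_combination (C (n : ℚ) * C (m : ℚ)) * hab
    have := congrArg (fun p => aeval T p w) key
    simp only [map_add, map_mul, LinearMap.add_apply, Module.End.mul_apply, h1, h2, map_zero,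
      add_zero, aeval_C] at this
    refine hw (n * m) (mul_ne_zero hn hm) ?_
    rw [mul_smul]
    exact this.symm
  · exact h

lemma norm_root_le_two {R : ℤ[X]} (hR : R.Monic) (hc : ∀ i, |R.coeff i| ≤ 1) {z : ℂ}
    (hz : aeval z R = 0) : ‖z‖ ≤ 2 := by
  have hm : (R.map (Int.castRingHom ℂ)).Monic := hR.map _
  have h := IsRoot.norm_lt_cauchyBound hm.ne_zero (a := z) (by
    rw [IsRoot, eval_map, ← hz, aeval_def]; rfl)
  have h2 : cauchyBound (R.map (Int.castRingHom ℂ)) ≤ 2 := by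
    rw [cauchyBound, hm.leadingCoeff, nnnorm_one, div_one]
    have : (Finset.range (R.map (Int.castRingHom ℂ)).natDegree).sup
        (fun i => ‖(R.map (Int.castRingHom ℂ)).coeff i‖₊) ≤ 1 := by
      refine Finset.sup_le fun i _ => ?_
      rw [← NNReal.coe_le_coe]
      simp only [coeff_map, eq_intCast, coe_nnnorm, Complex.norm_intCast, NNReal.coe_one]
      exact_mod_cast hc i
    calc _ ≤ (1 : NNReal) + 1 := by gcongr
      _ = 2 := by norm_num
  exact (h.le.trans (by exact_mod_cast h2))

lemma le_one_of_pow_le_two {x : ℝ} (h : ∀ k : ℕ, 1 ≤ k → x ^ k ≤ 2) : x ≤ 1 := by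
  by_contra! hx
  obtain ⟨n, hn⟩ := pow_unbounded_of_one_lt 2 hx
  rcases Nat.eq_zero_or_pos n with rfl | hpos
  · norm_num at hn
  · exact absurd (h n hpos) (not_le.2 hn)

/-- An endomorphism all of whose powers satisfy relations with coefficients in `{-1, 0, 1}` has
a power with a nontorsion fixed vector. -/
theorem exists_fixed_of_small_relations (T : Module.End ℤ M) (hT : Function.Injective T) (y : M)
    (hy : ∀ n : ℤ, n ≠ 0 → n • y ≠ 0)
    (hrel : ∀ k : ℕ, 1 ≤ k → ∃ R : ℤ[X], R.Monic ∧ (∀ i, |R.coeff i| ≤ 1) ∧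
      aeval (T ^ k) R y = 0) :
    ∃ (v : M) (k : ℕ), 1 ≤ k ∧ (∀ n : ℤ, n ≠ 0 → n • v ≠ 0) ∧ (T ^ k) v = v := by
  obtain ⟨R₁, hR₁, -, hR₁y⟩ := hrel 1 le_rfl
  rw [pow_one] at hR₁y
  obtain ⟨q, f, hf, hfR, hfw, hw⟩ := exists_irreducible_annihilator T R₁ hR₁.ne_zero y hy hR₁y
  set w := aeval T q y
  have hlead : IsUnit f.leadingCoeff := by
    obtain ⟨g, rfl⟩ := hfR
    have := hR₁.leadingCoeff
    rw [leadingCoeff_mul] at this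
    exact IsUnit.of_mul_eq_one _ this
  have hdeg : f.natDegree ≠ 0 := by
    intro h
    rw [natDegree_eq_zero] at h
    obtain ⟨a, rfl⟩ := h
    rw [leadingCoeff_C] at hlead
    exact hf.not_isUnit (hlead.map C)
  have hroot : ∀ z : ℂ, z ∈ (f.map (Int.castRingHom ℂ)).roots → ‖z‖ ≤ 1 := by
    intro z hz
    have hz0 : aeval z f = 0 := by
      have := isRoot_of_mem_roots hz
      rw [IsRoot, eval_map] at this
      rw [aeval_def]; exact this
    refine le_one_of_pow_le_two fun k hk => ?_
    obtain ⟨R, hR, hRc, hRy⟩ := hrel k hk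
    rw [← norm_pow]
    refine norm_root_le_two hR hRc ?_
    have hexp : ∀ u, aeval T (expand ℤ k R) u = aeval (T ^ k) R u := by
      intro u; rw [expand_aeval]
    have h2 : aeval T (expand ℤ k R) w = 0 := by
      change aeval T (expand ℤ k R) (aeval T q y) = 0
      rw [← Module.End.mul_apply, ← map_mul, mul_comm, map_mul, Module.End.mul_apply, hexp, hRy,
        map_zero]
    have h3 := irreducible_dvd_of_annihilator T hf hdeg hw hfw h2
    rw [← expand_aeval]
    have hcast : ∀ p : ℤ[X], aeval z (p.map (Int.castRingHom ℚ)) = aeval z p := by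
      intro p
      have := aeval_map_algebraMap (A := ℚ) (B := ℂ) z p
      exact this
    rw [← hcast]
    obtain ⟨g, hg⟩ := h3
    rw [hg, map_mul, hcast, hz0, zero_mul]
  have hM : (f.map (Int.castRingHom ℂ)).mahlerMeasure = 1 := by
    rw [mahlerMeasure_eq_leadingCoeff_mul_prod_roots]
    have h1 : ‖(f.map (Int.castRingHom ℂ)).leadingCoeff‖ = 1 := by
      rw [leadingCoeff_map_of_injective (Int.castRingHom ℂ).injective_int]
      rcases Int.isUnit_iff.1 hlead with h | h <;> simp [h]
    rw [h1, one_mul]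
    apply Multiset.prod_eq_one
    intro x hx
    obtain ⟨z, hz, rfl⟩ := Multiset.mem_map.1 hx
    exact max_eq_left (hroot z hz)
  have hX : ¬ X ∣ f := by
    rintro ⟨g, rfl⟩
    rcases hf.isUnit_or_isUnit rfl with h | h
    · exact not_isUnit_X h
    · obtain ⟨u, hu⟩ := h.exists_left_inv
      have : aeval T (X : ℤ[X]) w = 0 := by
        have h3 : (X : ℤ[X]) = u * (X * g) := by linear_combination -X * hu
        rw [h3, map_mul, Module.End.mul_apply, hfw, map_zero]
      rw [aeval_X] at this
      have hw0 : w = 0 := hT (by rw [this, map_zero])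
      exact hw 1 one_ne_zero (by rw [hw0, smul_zero])
  obtain ⟨n, hn, hcyc⟩ := cyclotomic_dvd_of_mahlerMeasure_eq_one hM hX (by
    intro h; exact hdeg (natDegree_eq_of_degree_eq_some h))
  have hass : f ∣ cyclotomic n ℤ := by
    obtain ⟨g, hg⟩ := hcyc
    rcases hf.isUnit_or_isUnit hg with h | h
    · exact absurd h (cyclotomic.irreducible hn).not_isUnit
    · rw [hg]
      exact (associated_mul_unit_right _ _ h).symm.dvd
  have hfX : f ∣ X ^ n - 1 := hass.trans (cyclotomic.dvd_X_pow_sub_one n ℤ)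
  refine ⟨w, n, hn, hw, ?_⟩
  obtain ⟨g, hg⟩ := hfX
  have : aeval T (X ^ n - 1 : ℤ[X]) w = 0 := by
    rw [hg, mul_comm, map_mul, Module.End.mul_apply, hfw, map_zero]
  rw [map_sub, map_pow, aeval_X, map_one, LinearMap.sub_apply, Module.End.one_apply] at this
  exact sub_eq_zero.1 this

end
end TransitiveGrowth

namespace TransitiveGrowth
open scoped Pointwise

/-- Groups obtained from finite groups by finite-index extensions and infinite cyclic central
extensions. -/
inductive VNil : (Γ : Type) → [Group Γ] → Prop
  | finite (Γ : Type) [Group Γ] : Finite Γ → VNil Γ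
  | step (Γ : Type) [Group Γ] (H : Subgroup Γ) (Q : Type) [Group Q] (f : H →* Q) (z : H) :
      H.FiniteIndex → Function.Surjective f → z ∈ Subgroup.center H → ¬ IsOfFinOrder z →
      f.ker = Subgroup.zpowers z → VNil Q → VNil Γ

lemma VNil.exists_card_le {Γ : Type} [Group Γ] (h : VNil Γ) :
    ∃ m : ℕ, ∀ F : Subgroup Γ, Finite F → Nat.card F ≤ m := by
  induction h with
  | finite Γ hfin => exact ⟨Nat.card Γ, fun F _ => Subgroup.card_le_card_group F⟩
  | step Γ H Q f z hH hf hz hinf hker _ ih =>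
    obtain ⟨m, hm⟩ := ih
    refine ⟨m * H.index, fun F hF => ?_⟩
    have h1 : Nat.card (H.subgroupOf F) * (H.subgroupOf F).index = Nat.card F :=
      (H.subgroupOf F).card_mul_index
    have h2 : (H.subgroupOf F).index ≤ H.index := by
      rw [← Subgroup.relIndex_top_right H]
      exact Subgroup.relIndex_le_of_le_right le_top (by
        rw [Subgroup.relIndex_top_right]; exact hH.index_ne_zero)
    have hFH : Finite (F.subgroupOf H) :=
      Finite.of_injective (fun x => (⟨x.1.1, x.2⟩ : F)) (fun x y hxy =>
        Subtype.ext (Subtype.ext (congrArg (fun u : F => u.1) hxy)))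
    have h3 : Nat.card (H.subgroupOf F) = Nat.card (F.subgroupOf H) := by
      refine Nat.card_congr ⟨fun x => ⟨⟨x.1.1, x.2⟩, x.1.2⟩, fun x => ⟨⟨x.1.1, x.2⟩, x.1.2⟩,
        fun _ => rfl, fun _ => rfl⟩
    have hinj : Set.InjOn f (F.subgroupOf H : Set H) := by
      intro x hx y hy hxy
      have hk : x⁻¹ * y ∈ f.ker := by rw [MonoidHom.mem_ker, map_mul, map_inv, hxy, inv_mul_cancel]
      rw [hker] at hk
      obtain ⟨n, hn⟩ := Subgroup.mem_zpowers_iff.1 hk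
      have hfo : IsOfFinOrder (z ^ n) := by
        have : z ^ n ∈ F.subgroupOf H := hn ▸ mul_mem (inv_mem hx) hy
        have h5 := isOfFinOrder_of_finite (⟨z ^ n, this⟩ : F.subgroupOf H)
        exact (F.subgroupOf H).subtype.isOfFinOrder h5
      have hn0 : n = 0 := by
        by_contra hne
        obtain ⟨k, hk, hkz⟩ := isOfFinOrder_iff_zpow_eq_one.1 hfo
        refine hinf (isOfFinOrder_iff_zpow_eq_one.2 ⟨n * k, mul_ne_zero hne hk, ?_⟩)
        rw [zpow_mul, hkz]
      rw [hn0, zpow_zero] at hn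
      exact inv_mul_eq_one.1 hn.symm
    have h4 : Nat.card (F.subgroupOf H) ≤ m := by
      have hfin : Finite ((F.subgroupOf H).map f) := by
        have : ((F.subgroupOf H).map f : Set Q).Finite := by
          rw [Subgroup.coe_map]
          exact Set.Finite.image _ hFH
        exact this
      have := hm ((F.subgroupOf H).map f) hfin
      have heq : Nat.card (F.subgroupOf H) = Nat.card ((F.subgroupOf H).map f) :=
        (Nat.card_image_of_injOn hinj).symm
      rw [heq]; exact this
    rw [← h1, h3]
    exact Nat.mul_le_mul h4 h2

lemma VNil.exists_centralizer_finiteIndex {Γ : Type} [Group Γ] (h : VNil Γ) : Infinite Γ →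
    ∃ z : Γ, ¬ IsOfFinOrder z ∧ (Subgroup.centralizer {z}).FiniteIndex := by
  induction h with
  | finite Γ h => intro _; exact (not_finite Γ).elim
  | step Γ H Q f z hH hf hz hinf hker _ _ =>
    intro _
    refine ⟨z, fun h => hinf (Submonoid.isOfFinOrder_coe.1 h), ?_⟩
    refine Subgroup.finiteIndex_of_le (H := H) fun x hx => ?_
    rw [Subgroup.mem_centralizer_singleton_iff]
    exact congrArg Subtype.val (Subgroup.mem_center_iff.1 hz ⟨x, hx⟩)

lemma VNil.exists_nilpotent {Γ : Type} [Group Γ] (h : VNil Γ) :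
    ∃ H : Subgroup Γ, H.FiniteIndex ∧ Group.IsNilpotent H := by
  induction h with
  | finite Γ hfin =>
    exact ⟨⊥, inferInstance, inferInstance⟩
  | step Γ H Q f z hH hf hz hinf hker _ ih =>
    obtain ⟨Q', hQ', hnil⟩ := ih
    have hfi : (Q'.comap f).FiniteIndex :=
      ⟨by rw [Subgroup.index_comap_of_surjective _ hf]; exact hQ'.index_ne_zero⟩
    refine ⟨(Q'.comap f).map H.subtype, ?_, ?_⟩
    · refine ⟨?_⟩
      rw [Subgroup.index_map_subtype]
      exact mul_ne_zero hfi.index_ne_zero hH.index_ne_zero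
    · have h1 : Group.IsNilpotent (Q'.comap f) := by
        let g : Q'.comap f →* Q' := f.subgroupComap Q'
        refine Subgroup.isNilpotent_of_ker_le_center g ?_
        intro x hx
        have hx' : x.1 ∈ f.ker := congrArg Subtype.val (MonoidHom.mem_ker.1 hx)
        rw [hker] at hx'
        obtain ⟨n, hn⟩ := Subgroup.mem_zpowers_iff.1 hx'
        have hc : x.1 ∈ Subgroup.center H := hn ▸ zpow_mem hz n
        rw [Subgroup.mem_center_iff]
        intro y
        exact Subtype.ext (Subgroup.mem_center_iff.1 hc y.1)
      exact Group.nilpotent_of_mulEquiv (_h := h1)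
        ((Q'.comap f).equivMapOfInjective H.subtype H.subtype_injective)

end TransitiveGrowth

namespace TransitiveGrowth
open scoped Pointwise
open Polynomial (aeval X)

section

variable {A : Type} [Group A]

lemma finiteIndex_of_ker (φ : A →* Multiplicative ℤ) {t : A} (ht : φ t = Multiplicative.ofAdd 1)
    {k : ℕ} (hk : 1 ≤ k) (H : Subgroup A) (htk : t ^ k ∈ H)
    (hH : (H.subgroupOf φ.ker).FiniteIndex) : H.FiniteIndex := by
  have hfin : Finite (φ.ker ⧸ H.subgroupOf φ.ker) := Subgroup.finite_quotient_of_finiteIndex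
  have : Finite (A ⧸ H) := by
    refine Finite.of_surjective (fun p : Fin k × (φ.ker ⧸ H.subgroupOf φ.ker) =>
      ((t ^ p.1.1 * p.2.out.1 : A) : A ⧸ H)) ?_
    intro q
    induction q using QuotientGroup.induction_on with
    | H g =>
      set i : ℤ := Multiplicative.toAdd (φ g)
      have hφt : ∀ j : ℤ, φ (t ^ j) = Multiplicative.ofAdd j := by
        intro j
        rw [map_zpow, ht, ← ofAdd_zsmul, smul_eq_mul, mul_one]
      have hk0 : (0 : ℤ) < k := by exact_mod_cast hk
      obtain ⟨r, hr⟩ := Int.eq_ofNat_of_zero_le (Int.emod_nonneg i hk0.ne')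
      have hrk : r < k := by
        have := Int.emod_lt_of_pos i hk0
        omega
      have hdiv := Int.emod_add_mul_ediv i k
      have hn : (t ^ r)⁻¹ * g * ((t ^ k) ^ (i / k))⁻¹ ∈ φ.ker := by
        rw [MonoidHom.mem_ker, map_mul, map_mul, map_inv, map_inv, ← zpow_natCast, ← zpow_natCast,
          ← zpow_mul, hφt, hφt, show φ g = Multiplicative.ofAdd i from rfl, ← ofAdd_neg,
          ← ofAdd_neg, ← ofAdd_add, ← ofAdd_add, ← hr, ofAdd_eq_one]
        linarith
      refine ⟨(⟨r, hrk⟩, ((⟨_, hn⟩ : φ.ker) : φ.ker ⧸ H.subgroupOf φ.ker)), ?_⟩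
      obtain ⟨h, hh⟩ := QuotientGroup.mk_out_eq_mul (H.subgroupOf φ.ker) (⟨_, hn⟩ : φ.ker)
      simp only
      rw [hh]
      apply Eq.symm
      rw [QuotientGroup.eq]
      change g⁻¹ * (t ^ r * (((t ^ r)⁻¹ * g * ((t ^ k) ^ (i / k))⁻¹) * h.1.1)) ∈ H
      rw [show g⁻¹ * (t ^ r * (((t ^ r)⁻¹ * g * ((t ^ k) ^ (i / k))⁻¹) * h.1.1))
        = ((t ^ k) ^ (i / k))⁻¹ * h.1.1 by group]
      exact H.mul_mem (H.inv_mem (H.zpow_mem htk _)) h.2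
  exact Subgroup.finiteIndex_of_finite_quotient

/-- The elements whose centralizer in `N` has finite index in `N`. -/
def finiteConj (N : Subgroup A) : Subgroup A where
  carrier := {x | ((Subgroup.centralizer {x}).subgroupOf N).FiniteIndex}
  one_mem' := by
    refine Subgroup.finiteIndex_of_le (H := ⊤) fun x _ => ?_
    simp [Subgroup.mem_subgroupOf, Subgroup.mem_centralizer_singleton_iff]
  mul_mem' := by
    intro x y (hx : Subgroup.FiniteIndex _) (hy : Subgroup.FiniteIndex _)
    refine Subgroup.finiteIndex_of_le (H := (Subgroup.centralizer {x}).subgroupOf N ⊓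
      (Subgroup.centralizer {y}).subgroupOf N) ?_
    rintro g ⟨h1, h2⟩
    have h1' := Subgroup.mem_centralizer_singleton_iff.1 (Subgroup.mem_subgroupOf.1 h1)
    have h2' := Subgroup.mem_centralizer_singleton_iff.1 (Subgroup.mem_subgroupOf.1 h2)
    refine Subgroup.mem_subgroupOf.2 (Subgroup.mem_centralizer_singleton_iff.2 ?_)
    exact (show Commute g.1 x from h1').mul_right (show Commute g.1 y from h2')
  inv_mem' := by
    intro x (hx : Subgroup.FiniteIndex _)
    refine Subgroup.finiteIndex_of_le (H := (Subgroup.centralizer {x}).subgroupOf N) ?_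
    intro g h1
    have h1' := Subgroup.mem_centralizer_singleton_iff.1 (Subgroup.mem_subgroupOf.1 h1)
    refine Subgroup.mem_subgroupOf.2 (Subgroup.mem_centralizer_singleton_iff.2 ?_)
    exact (show Commute g.1 x from h1').inv_right

lemma mem_finiteConj {N : Subgroup A} {x : A} :
    x ∈ finiteConj N ↔ ((Subgroup.centralizer {x}).subgroupOf N).FiniteIndex := Iff.rfl

lemma conj_mem_finiteConj {N : Subgroup A} [N.Normal] {x : A} (g : A) (hx : x ∈ finiteConj N) :
    g * x * g⁻¹ ∈ finiteConj N := by
  have hfi := mem_finiteConj.1 hx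
  have heq : (Subgroup.centralizer {g * x * g⁻¹}).subgroupOf N =
      ((Subgroup.centralizer {x}).subgroupOf N).comap
        (MulAut.conjNormal g⁻¹ : N ≃* N).toMonoidHom := by
    ext y
    rw [Subgroup.mem_comap, Subgroup.mem_subgroupOf, Subgroup.mem_subgroupOf,
      Subgroup.mem_centralizer_singleton_iff, Subgroup.mem_centralizer_singleton_iff]
    change _ ↔ ((MulAut.conjNormal g⁻¹ y : N) : A) * x = x * ((MulAut.conjNormal g⁻¹ y : N) : A)
    rw [MulAut.conjNormal_apply, inv_inv]
    constructor
    · intro h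
      have := congrArg (fun u => g⁻¹ * u * g) h
      simp only [mul_assoc, inv_mul_cancel, mul_one, inv_mul_cancel_left] at this ⊢
      exact this
    · intro h
      have := congrArg (fun u => g * u * g⁻¹) h
      simp only [mul_assoc, mul_inv_cancel, mul_one, mul_inv_cancel_left] at this ⊢
      exact this
  rw [mem_finiteConj, heq]
  exact ⟨by
    rw [Subgroup.index_comap_of_surjective (f := (MulAut.conjNormal g⁻¹ : N ≃* N).toMonoidHom) _
      (MulAut.conjNormal g⁻¹ : N ≃* N).surjective]
    exact hfi.index_ne_zero⟩

/-- If the conjugates of `y` by powers of `t` commute and the group has polynomial growth, some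
power of `t` commutes with an element of infinite order in the subgroup they generate. -/
lemma exists_fixed_conj {d : ℕ} (h : PolyGrowth (⊥ : Subgroup A) d) (t y : A)
    (hy : ¬ IsOfFinOrder y)
    (hcomm : ∀ i j : ℕ, (t ^ i * y * (t ^ i)⁻¹) * (t ^ j * y * (t ^ j)⁻¹) =
      (t ^ j * y * (t ^ j)⁻¹) * (t ^ i * y * (t ^ i)⁻¹)) :
    ∃ z ∈ Subgroup.closure (Set.range fun i : ℕ => t ^ i * y * (t ^ i)⁻¹), ∃ k : ℕ, 1 ≤ k ∧
      ¬ IsOfFinOrder z ∧ t ^ k * z = z * t ^ k := by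
  obtain ⟨E, c, hE, hg⟩ := h
  set B := Subgroup.closure (Set.range fun i : ℕ => t ^ i * y * (t ^ i)⁻¹) with hB
  let inst : CommGroup B :=
    { (inferInstance : Group B) with
      mul_comm := (Subgroup.isMulCommutative_closure (by
        rintro _ ⟨i, rfl⟩ _ ⟨j, rfl⟩
        exact hcomm i j)).is_comm.comm }
  have hyi : ∀ i : ℕ, t ^ i * y * (t ^ i)⁻¹ ∈ B := fun i => Subgroup.subset_closure ⟨i, rfl⟩
  have hyB : y ∈ B := by simpa using hyi 0
  have htB : ∀ x ∈ B, t * x * t⁻¹ ∈ B := by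
    intro x hx
    have h1 : B.map (MulAut.conj t).toMonoidHom ≤ B := by
      rw [hB, MonoidHom.map_closure, Subgroup.closure_le]
      rintro _ ⟨_, ⟨i, rfl⟩, rfl⟩
      refine Subgroup.subset_closure ⟨i + 1, ?_⟩
      change t ^ (i + 1) * y * (t ^ (i + 1))⁻¹ = t * (t ^ i * y * (t ^ i)⁻¹) * t⁻¹
      rw [pow_succ']; group
    exact h1 ⟨x, hx, rfl⟩
  let τ : B →* B :=
    { toFun := fun x => ⟨t * x.1 * t⁻¹, htB x.1 x.2⟩
      map_one' := Subtype.ext (by simp)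
      map_mul' := fun a b => Subtype.ext (by
        change t * (a.1 * b.1) * t⁻¹ = (t * a.1 * t⁻¹) * (t * b.1 * t⁻¹)
        group) }
  let T : Module.End ℤ (Additive B) := τ.toAdditive.toIntLinearMap
  let val : Additive B → A := fun v => (Additive.toMul v).1
  have hval : Function.Injective val := fun a b hab => Additive.toMul.injective (Subtype.ext hab)
  have hval_add : ∀ a b, val (a + b) = val a * val b := fun _ _ => rfl
  have hvalT : ∀ v, val (T v) = t * val v * t⁻¹ := fun v => rfl
  have hvalTn : ∀ (n : ℕ) v, val ((T ^ n) v) = t ^ n * val v * (t ^ n)⁻¹ := by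
    intro n
    induction n with
    | zero => intro v; simp
    | succ n ih =>
      intro v
      rw [pow_succ', Module.End.mul_apply, hvalT, ih, pow_succ']
      group
  have hval_zsmul : ∀ (n : ℤ) v, val (n • v) = val v ^ n := fun n v => rfl
  have htor : ∀ v, ¬ IsOfFinOrder (val v) ↔ ∀ n : ℤ, n ≠ 0 → n • v ≠ 0 := by
    intro v
    rw [isOfFinOrder_iff_zpow_eq_one]
    push Not
    refine forall_congr' fun n => forall_congr' fun _ => not_congr ?_
    rw [← hval_zsmul]
    exact hval.eq_iff' rfl
  let y₀ : Additive B := Additive.ofMul ⟨y, hyB⟩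
  have hprod : ∀ k n : ℕ, ∀ x ∈ conjProducts (t ^ k) y n, ∃ P : Polynomial ℤ,
      (∀ i, 0 ≤ P.coeff i ∧ P.coeff i ≤ 1) ∧ (∀ i, n ≤ i → P.coeff i = 0) ∧
        val (aeval (T ^ k) P y₀) = x := by
    intro k n
    induction n with
    | zero =>
      intro x hx
      refine ⟨0, by simp, by simp, ?_⟩
      rw [Set.mem_singleton_iff.1 hx, map_zero]; rfl
    | succ n ih =>
      rintro x (hx | ⟨x', hx', rfl⟩)
      · obtain ⟨P, h1, h2, h3⟩ := ih x hx
        exact ⟨P, h1, fun i hi => h2 i (by omega), h3⟩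
      · obtain ⟨P, h1, h2, h3⟩ := ih x' hx'
        refine ⟨X ^ n + P, fun i => ?_, fun i hi => ?_, ?_⟩
        · rw [Polynomial.coeff_add, Polynomial.coeff_X_pow]
          split_ifs with hin
          · rw [hin, h2 n le_rfl]; norm_num
          · simpa using h1 i
        · rw [Polynomial.coeff_add, Polynomial.coeff_X_pow, h2 i (by omega), if_neg (by omega),
            add_zero]
        · rw [map_add, map_pow, Polynomial.aeval_X, LinearMap.add_apply, hval_add, h3, ← pow_mul,
            hvalTn, ← pow_mul]
          rfl
  have hrel : ∀ k : ℕ, 1 ≤ k → ∃ R : Polynomial ℤ, R.Monic ∧ (∀ i, |R.coeff i| ≤ 1) ∧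
      aeval (T ^ k) R y₀ = 0 := by
    intro k _
    obtain ⟨n, x, hx, x', hx', e, he, heq⟩ := exists_conj_relation hE hg (t ^ k) y
    rw [Subgroup.mem_bot.1 he, mul_one] at heq
    obtain ⟨P, h1, h2, h3⟩ := hprod k n x hx
    obtain ⟨P', h1', h2', h3'⟩ := hprod k n x' hx'
    refine ⟨X ^ n + (P - P'), ?_, fun i => ?_, ?_⟩
    · refine Polynomial.monic_X_pow_add ?_
      rw [Polynomial.degree_lt_iff_coeff_zero]
      intro m hm
      rw [Polynomial.coeff_sub, h2 m hm, h2' m hm, sub_zero]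
    · rw [Polynomial.coeff_add, Polynomial.coeff_X_pow, Polynomial.coeff_sub]
      split_ifs with hin
      · rw [hin, h2 n le_rfl, h2' n le_rfl]; norm_num
      · have a1 := h1 i
        have a2 := h1' i
        rw [abs_le]; constructor <;> omega
    · rw [← add_sub_assoc, map_sub, LinearMap.sub_apply, sub_eq_zero]
      apply hval
      rw [h3', map_add, map_pow, Polynomial.aeval_X, LinearMap.add_apply, hval_add, h3, ← pow_mul,
        hvalTn, ← heq, ← pow_mul]
      rfl
  have hT : Function.Injective T := by
    intro a b hab
    apply hval
    have := congrArg val hab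
    rw [hvalT, hvalT] at this
    exact mul_left_cancel (mul_right_cancel this)
  obtain ⟨v, k, hk, hv, hvk⟩ := exists_fixed_of_small_relations T hT y₀ ((htor y₀).1 hy) hrel
  refine ⟨val v, (Additive.toMul v).2, k, hk, (htor v).2 hv, ?_⟩
  have := congrArg val hvk
  rw [hvalTn] at this
  exact mul_inv_eq_iff_eq_mul.1 this

end

/-- An extension of `ℤ` by a virtually nilpotent group which has polynomial growth contains an
element of infinite order with centralizer of finite index. -/
lemma PolyGrowth.exists_centralizer_finiteIndex {A : Type} [Group A] {d : ℕ}
    (h : PolyGrowth (⊥ : Subgroup A) d) (φ : A →* Multiplicative ℤ) (hφ : Function.Surjective φ)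
    (hN : VNil φ.ker) :
    ∃ z : A, ¬ IsOfFinOrder z ∧ (Subgroup.centralizer {z}).FiniteIndex := by
  obtain ⟨t, ht⟩ := hφ (Multiplicative.ofAdd 1)
  by_cases hfin : Finite φ.ker
  · have hfo : IsOfFinOrder (MulAut.conjNormal t : MulAut φ.ker) := isOfFinOrder_of_finite _
    obtain ⟨k, hk, hkt⟩ := isOfFinOrder_iff_pow_eq_one.1 hfo
    rw [← map_pow] at hkt
    refine ⟨t ^ k, fun hord => ?_, ?_⟩
    · obtain ⟨n, hn, hnt⟩ := isOfFinOrder_iff_pow_eq_one.1 hord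
      have := congrArg φ hnt
      rw [map_pow, map_pow, map_one φ, ht, ← ofAdd_nsmul, ← ofAdd_nsmul, ofAdd_eq_one, smul_smul,
        nsmul_eq_mul, mul_one] at this
      have h0 : n * k ≠ 0 := mul_ne_zero hn.ne' hk.ne'
      exact h0 (by exact_mod_cast this)
    · refine finiteIndex_of_ker φ ht hk _ (Subgroup.mem_centralizer_singleton_iff.2 rfl) ?_
      refine Subgroup.finiteIndex_of_le (H := ⊤) fun x _ => ?_
      rw [Subgroup.mem_subgroupOf, Subgroup.mem_centralizer_singleton_iff]
      have := congrArg (fun f : MulAut φ.ker => (f x).1) hkt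
      simp only [MulAut.conjNormal_apply, MulAut.one_apply] at this
      exact (mul_inv_eq_iff_eq_mul.1 this).symm
  · have hinf : Infinite φ.ker := not_finite_iff_infinite.1 hfin
    obtain ⟨z₀, hz₀, hfi⟩ := hN.exists_centralizer_finiteIndex hinf
    set m := (Subgroup.centralizer {z₀}).index
    have hpow : ∀ g : A, ∀ hgN : g ∈ φ.ker, Commute (g ^ m.factorial) z₀.1 := by
      intro g hgN
      have h1 := Subgroup.pow_mem_of_index_ne_zero_of_dvd hfi.index_ne_zero (⟨g, hgN⟩ : φ.ker)
        (n := m.factorial) (fun j hj hjm => Nat.dvd_factorial hj hjm)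
      rw [Subgroup.mem_centralizer_singleton_iff] at h1
      exact congrArg Subtype.val h1
    set y : A := z₀.1 ^ m.factorial
    have hz₀A : ¬ IsOfFinOrder z₀.1 := fun hh => hz₀ (Submonoid.isOfFinOrder_coe.1 hh)
    have hy : ¬ IsOfFinOrder y := by
      rw [isOfFinOrder_pow]
      push Not
      exact ⟨hz₀A, Nat.factorial_ne_zero m⟩
    have hc0 : ∀ i : ℕ, Commute (t ^ i * y * (t ^ i)⁻¹) y := by
      intro i
      have hmem : t ^ i * z₀.1 * (t ^ i)⁻¹ ∈ φ.ker :=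
        (inferInstance : φ.ker.Normal).conj_mem _ z₀.2 _
      have := (hpow _ hmem).pow_right m.factorial
      rwa [conj_pow] at this
    have hc1 : ∀ i k : ℕ, Commute (t ^ (i + k) * y * (t ^ (i + k))⁻¹) (t ^ i * y * (t ^ i)⁻¹) := by
      intro i k
      have := (hc0 k).map (MulAut.conj (t ^ i))
      simp only [MulAut.conj_apply] at this
      convert this using 1
      rw [pow_add]; group
    obtain ⟨z, hzB, k, hk, hz, hzt⟩ := exists_fixed_conj h t y hy (by
      intro i j
      rcases le_total i j with hij | hij
      · obtain ⟨k, rfl⟩ := Nat.exists_eq_add_of_le hij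
        exact (hc1 i k).symm
      · obtain ⟨k, rfl⟩ := Nat.exists_eq_add_of_le hij
        exact hc1 j k)
    refine ⟨z, hz, finiteIndex_of_ker φ ht hk _ (Subgroup.mem_centralizer_singleton_iff.2 hzt) ?_⟩
    rw [← mem_finiteConj]
    have hz₀F : z₀.1 ∈ finiteConj φ.ker := by
      rw [mem_finiteConj]
      refine Subgroup.finiteIndex_of_le (H := Subgroup.centralizer {z₀}) fun x hx => ?_
      rw [Subgroup.mem_centralizer_singleton_iff] at hx
      rw [Subgroup.mem_subgroupOf, Subgroup.mem_centralizer_singleton_iff]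
      exact congrArg Subtype.val hx
    refine (Subgroup.closure_le _).2 ?_ hzB
    rintro _ ⟨i, rfl⟩
    exact conj_mem_finiteConj _ (pow_mem hz₀F _)

/-- Groups of polynomial growth are virtually nilpotent. -/
theorem PolyGrowth.vnil {d : ℕ} : ∀ {Γ : Type} [Group Γ], PolyGrowth (⊥ : Subgroup Γ) d → VNil Γ := by
  induction d with
  | zero =>
    intro Γ _ h
    have := h.finite_of_zero
    exact VNil.finite Γ (Finite.of_equiv _ (QuotientGroup.quotientBot (G := Γ)).toEquiv)
  | succ d ih =>
    intro Γ _ h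
    by_cases hfin : Finite Γ
    · exact VNil.finite Γ hfin
    have : Infinite (Γ ⧸ (⊥ : Subgroup Γ)) := by
      rw [← not_finite_iff_infinite]
      intro _
      exact hfin (Finite.of_equiv _ (QuotientGroup.quotientBot (G := Γ)).toEquiv)
    obtain ⟨A₀, -, hA₀, φ, hφ, -, -⟩ := h.exists_surjective_int
    have h₀ := h.finiteIndex A₀
    rw [Subgroup.bot_subgroupOf] at h₀
    have hker := h₀.ker φ hφ bot_le
    rw [Subgroup.bot_subgroupOf] at hker
    obtain ⟨z, hz, hzfi⟩ := h₀.exists_centralizer_finiteIndex φ hφ (ih hker)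
    have hfi : (Subgroup.centralizer {(z : Γ)}).FiniteIndex := by
      have h1 : ((Subgroup.centralizer {z}).map A₀.subtype).FiniteIndex := by
        refine ⟨?_⟩
        rw [Subgroup.index_map_subtype]
        exact mul_ne_zero hzfi.index_ne_zero hA₀.index_ne_zero
      refine Subgroup.finiteIndex_of_le (H := (Subgroup.centralizer {z}).map A₀.subtype) ?_
      rintro _ ⟨x, hx, rfl⟩
      rw [Subgroup.mem_centralizer_singleton_iff]
      exact congrArg Subtype.val (Subgroup.mem_centralizer_singleton_iff.1 hx)
    set C := Subgroup.centralizer {(z : Γ)}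
    let z' : C := ⟨z, Subgroup.mem_centralizer_singleton_iff.2 rfl⟩
    have hz' : z' ∈ Subgroup.center C := by
      rw [Subgroup.mem_center_iff]
      intro g
      exact Subtype.ext (Subgroup.mem_centralizer_singleton_iff.1 g.2)
    have hz'inf : ¬ IsOfFinOrder z' := fun hh =>
      hz (Submonoid.isOfFinOrder_coe.1 (C.subtype.isOfFinOrder hh : IsOfFinOrder (z : Γ)))
    have hnormal : (Subgroup.zpowers z').Normal :=
      ⟨fun n hn g => by
        obtain ⟨j, rfl⟩ := Subgroup.mem_zpowers_iff.1 hn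
        rw [Subgroup.mem_center_iff.1 (zpow_mem hz' j) g, mul_inv_cancel_right]
        exact hn⟩
    have hC := h.finiteIndex C
    rw [Subgroup.bot_subgroupOf] at hC
    have hQ := hC.quotient_zpowers (QuotientGroup.mk' (Subgroup.zpowers z'))
      (QuotientGroup.mk'_surjective _) z'
      ((QuotientGroup.eq_one_iff z').2 (Subgroup.mem_zpowers z')) hz'inf
    exact VNil.step Γ C (C ⧸ Subgroup.zpowers z') (QuotientGroup.mk' _) z' hfi
      (QuotientGroup.mk'_surjective _) hz' hz'inf (QuotientGroup.ker_mk' _) (ih hQ)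

end TransitiveGrowth

namespace TransitiveGrowth
open scoped Pointwise

/-- `S` is contained in finitely many left cosets of `K`. -/
def CosetFinite {A : Type} [Group A] (K : Subgroup A) (S : Set A) : Prop :=
  ∃ F : Set A, F.Finite ∧ ∀ x ∈ S, ∃ f ∈ F, f⁻¹ * x ∈ K

section

variable {A : Type} [Group A] {K : Subgroup A}

lemma PolyGrowth.cosetFinite_mul {d : ℕ} (h : PolyGrowth K d) (a : A) :
    CosetFinite K ((K : Set A) * {a}) := by
  refine ⟨Quotient.out '' {q' : A ⧸ K | ∃ k ∈ K, q' = k • (a : A ⧸ K)},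
    (h.finite_orbit a).image _, ?_⟩
  rintro _ ⟨k, hk, _, rfl, rfl⟩
  refine ⟨_, ⟨_, ⟨k, hk, rfl⟩, rfl⟩, ?_⟩
  rw [← QuotientGroup.eq]
  exact QuotientGroup.out_eq' _

lemma CosetFinite.conj {d : ℕ} (h : PolyGrowth K d) {S : Set A} (hS : CosetFinite K S) (a : A) :
    CosetFinite K ((fun x => a * x * a⁻¹) '' S) := by
  obtain ⟨F, hF, hFS⟩ := hS
  obtain ⟨F', hF', hFS'⟩ := h.cosetFinite_mul a⁻¹
  refine ⟨({a} : Set A) * F * F', ((Set.finite_singleton a).mul hF).mul hF', ?_⟩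
  rintro _ ⟨x, hx, rfl⟩
  obtain ⟨f, hf, hfx⟩ := hFS x hx
  obtain ⟨f', hf', hfx'⟩ := hFS' _ ⟨_, hfx, _, rfl, rfl⟩
  refine ⟨_, Set.mul_mem_mul (Set.mul_mem_mul rfl hf) hf', ?_⟩
  convert hfx' using 1
  simp only
  group

lemma CosetFinite.mul {S L : Set A} (hS : CosetFinite K S) (hL : CosetFinite K L)
    (hn : ∀ x ∈ S, ∀ m ∈ L, m⁻¹ * x * m ∈ S) : CosetFinite K (S * L) := by
  obtain ⟨F, hF, hFS⟩ := hS
  obtain ⟨F', hF', hFL⟩ := hL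
  classical
  have hch : ∀ f ∈ F', ∃ m : A, (∃ l ∈ L, f⁻¹ * l ∈ K) → m ∈ L ∧ f⁻¹ * m ∈ K := by
    intro f _
    by_cases hx : ∃ l ∈ L, f⁻¹ * l ∈ K
    · obtain ⟨l, hl⟩ := hx
      exact ⟨l, fun _ => hl⟩
    · exact ⟨1, fun hy => absurd hy hx⟩
  choose! m hm using hch
  refine ⟨m '' F' * F, (hF'.image m).mul hF, ?_⟩
  rintro _ ⟨x, hx, l, hl, rfl⟩
  obtain ⟨f', hf', hfl⟩ := hFL l hl
  obtain ⟨hmL, hmK⟩ := hm f' hf' ⟨l, hl, hfl⟩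
  obtain ⟨f, hf, hfx⟩ := hFS _ (hn x hx _ hmL)
  refine ⟨_, Set.mul_mem_mul ⟨f', hf', rfl⟩ hf, ?_⟩
  rw [show (m f' * f)⁻¹ * (x * l) =
    (f⁻¹ * ((m f')⁻¹ * x * m f')) * ((f'⁻¹ * m f')⁻¹ * (f'⁻¹ * l)) by group]
  exact K.mul_mem hfx (K.mul_mem (K.inv_mem hmK) hfl)

lemma CosetFinite.image {B : Type} [Group B] {S : Set A} (hS : CosetFinite K S) (f : A →* B)
    (hf : (f '' (K : Set A)).Finite) : (f '' S).Finite := by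
  obtain ⟨F, hF, hFS⟩ := hS
  refine ((hF.image f).mul hf).subset ?_
  rintro _ ⟨x, hx, rfl⟩
  obtain ⟨g, hg, hgx⟩ := hFS x hx
  refine ⟨f g, ⟨g, hg, rfl⟩, f (g⁻¹ * x), ⟨_, hgx, rfl⟩, ?_⟩
  simp

lemma PolyGrowth.finite_image_quotient {d : ℕ} (h : PolyGrowth K d) (M : Subgroup A) [M.Normal]
    (hM : IsOpenRel K M) : (QuotientGroup.mk' M '' (K : Set A)).Finite := by
  obtain ⟨S, hS, hSM⟩ := hM
  have := hS.fintype
  have hfin : (Set.range fun k : K => fun s : S => (k.1 • ((s.1 : A) : A ⧸ K))).Finite := by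
    refine (Set.Finite.pi' (fun s : S => h.finite_orbit ((s.1 : A) : A ⧸ K))).subset ?_
    rintro _ ⟨k, rfl⟩ s
    exact ⟨k.1, k.2, rfl⟩
  have hfin2 : Finite (Set.range fun k : K => (QuotientGroup.mk' M k.1)) := by
    have := hfin.to_subtype
    refine Finite.of_surjective (α := Set.range fun k : K => fun s : S =>
      (k.1 • ((s.1 : A) : A ⧸ K))) (fun p => ⟨QuotientGroup.mk' M p.2.choose.1, _, rfl⟩) ?_
    rintro ⟨_, k, rfl⟩
    refine ⟨⟨_, k, rfl⟩, Subtype.ext ?_⟩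
    have hsp := (⟨_, k, rfl⟩ : (Set.range fun k : K => fun s : S =>
      (k.1 • ((s.1 : A) : A ⧸ K)))).2.choose_spec
    set k' := (⟨_, k, rfl⟩ : (Set.range fun k : K => fun s : S =>
      (k.1 • ((s.1 : A) : A ⧸ K)))).2.choose
    change QuotientGroup.mk' M k'.1 = QuotientGroup.mk' M k.1
    refine QuotientGroup.eq.2 (hSM _ fun s hs => ?_)
    have h1 := congrFun hsp ⟨s, hs⟩
    have h2 : ((k'.1 * s : A) : A ⧸ K) = ((k.1 * s : A) : A ⧸ K) := h1
    rw [QuotientGroup.eq] at h2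
    convert h2 using 1
    group
  refine (Set.toFinite (Set.range fun k : K => (QuotientGroup.mk' M k.1))).subset ?_
  rintro _ ⟨k, hk, rfl⟩
  exact ⟨⟨k, hk⟩, rfl⟩

/-- The relatively compact open normal subgroups of a normal subgroup lie in one which is normal
in the whole group. -/
lemma exists_normal_of_normal {d d' : ℕ} (h : PolyGrowth K d) (B : Subgroup A) [B.Normal]
    (hB : IsOpenRel K B) (hPB : PolyGrowth (K.subgroupOf B) d') (M : Subgroup B) [M.Normal]
    (hMb : CosetFinite (K.subgroupOf B) (M : Set B)) (hMo : IsOpenRel (K.subgroupOf B) M) :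
    ∃ M' : Subgroup A, M'.Normal ∧ CosetFinite K (M' : Set A) ∧ IsOpenRel K M' := by
  have hfinK := hPB.finite_image_quotient M hMo
  have hV : VNil (B ⧸ M) :=
    (hPB.map (QuotientGroup.mk' M) (QuotientGroup.mk'_surjective M) hfinK).vnil
  obtain ⟨m, hm⟩ := hV.exists_card_le
  -- the bounded subgroups of `B` normalized by `B`
  let P : Subgroup A → Prop := fun L => L ≤ B ∧ (∀ b ∈ B, ∀ l ∈ L, b * l * b⁻¹ ∈ L) ∧
    CosetFinite K (L : Set A)
  let I : Subgroup A → Subgroup (B ⧸ M) := fun L => (L.subgroupOf B).map (QuotientGroup.mk' M)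
  have hI : ∀ L, P L → Finite (I L) := by
    rintro L ⟨hLB, -, F, hF, hFL⟩
    classical
    have hch : ∀ f ∈ F, ∃ m : B, (∃ l ∈ L, f⁻¹ * l ∈ K) → m.1 ∈ L ∧ f⁻¹ * m ∈ K := by
      intro f _
      by_cases hx : ∃ l ∈ L, f⁻¹ * l ∈ K
      · obtain ⟨l, hl⟩ := hx
        exact ⟨⟨l, hLB hl.1⟩, fun _ => hl⟩
      · exact ⟨1, fun hy => absurd hy hx⟩
    choose! u hu using hch
    have hb : CosetFinite (K.subgroupOf B) (L.subgroupOf B : Set B) := by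
      refine ⟨u '' F, hF.image u, fun x hx => ?_⟩
      obtain ⟨f, hf, hfx⟩ := hFL x.1 hx
      refine ⟨_, ⟨f, hf, rfl⟩, ?_⟩
      obtain ⟨-, h2⟩ := hu f hf ⟨x.1, hx, hfx⟩
      rw [Subgroup.mem_subgroupOf]
      change (u f).1⁻¹ * x.1 ∈ K
      rw [show (u f).1⁻¹ * x.1 = (f⁻¹ * (u f).1)⁻¹ * (f⁻¹ * x.1) by group]
      exact K.mul_mem (K.inv_mem h2) hfx
    have := hb.image (QuotientGroup.mk' M) hfinK
    rw [← Subgroup.coe_map] at this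
    exact this
  have hmulP : ∀ L L', P L → P L' → P (L ⊔ L') := by
    rintro L L' ⟨h1, h2, h3⟩ ⟨h1', h2', h3'⟩
    have hmem : ∀ x, x ∈ L ⊔ L' → ∃ l ∈ L, ∃ l' ∈ L', l * l' = x := by
      intro x hx
      rw [Subgroup.sup_eq_closure] at hx
      induction hx using Subgroup.closure_induction with
      | mem x hx =>
        rcases hx with hx | hx
        · exact ⟨x, hx, 1, L'.one_mem, mul_one x⟩
        · exact ⟨1, L.one_mem, x, hx, one_mul x⟩
      | one => exact ⟨1, L.one_mem, 1, L'.one_mem, mul_one 1⟩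
      | mul x y _ _ hx hy =>
        obtain ⟨l, hl, l', hl', rfl⟩ := hx
        obtain ⟨n, hn, n', hn', rfl⟩ := hy
        refine ⟨l * (l' * n * l'⁻¹), L.mul_mem hl (h2 _ (h1' hl') _ hn), l' * n',
          L'.mul_mem hl' hn', by group⟩
      | inv x _ hx =>
        obtain ⟨l, hl, l', hl', rfl⟩ := hx
        refine ⟨l'⁻¹ * l⁻¹ * l'⁻¹⁻¹, h2 _ (B.inv_mem (h1' hl')) _ (L.inv_mem hl), l'⁻¹,
          L'.inv_mem hl', by group⟩
    refine ⟨sup_le h1 h1', fun b hb x hx => ?_, ?_⟩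
    · obtain ⟨l, hl, l', hl', rfl⟩ := hmem x hx
      rw [show b * (l * l') * b⁻¹ = (b * l * b⁻¹) * (b * l' * b⁻¹) by group]
      exact mul_mem (Subgroup.mem_sup_left (h2 b hb l hl))
        (Subgroup.mem_sup_right (h2' b hb l' hl'))
    · obtain ⟨F, hF, hFS⟩ := h3.mul h3' (fun x hx m hm => by
        have := h2 m⁻¹ (B.inv_mem (h1' hm)) x hx
        rwa [inv_inv] at this)
      refine ⟨F, hF, fun x hx => hFS x ?_⟩
      obtain ⟨l, hl, l', hl', rfl⟩ := hmem x hx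
      exact Set.mul_mem_mul hl hl'
  let M₁ : Subgroup A := M.map B.subtype
  have hM₁ : P M₁ := by
    refine ⟨?_, ?_, ?_⟩
    · rintro _ ⟨x, _, rfl⟩; exact x.2
    · rintro b hb _ ⟨x, hx, rfl⟩
      exact ⟨⟨b, hb⟩ * x * ⟨b, hb⟩⁻¹, (inferInstance : M.Normal).conj_mem x hx _, rfl⟩
    · obtain ⟨F, hF, hFM⟩ := hMb
      refine ⟨B.subtype '' F, hF.image _, ?_⟩
      rintro _ ⟨x, hx, rfl⟩
      obtain ⟨f, hf, hfx⟩ := hFM x hx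
      exact ⟨_, ⟨f, hf, rfl⟩, hfx⟩
  obtain ⟨L, hL, hLmax⟩ : ∃ L, P L ∧ ∀ L', P L' → Nat.card (I L') ≤ Nat.card (I L) := by
    classical
    have hbdd : ∀ n, (∃ L, P L ∧ Nat.card (I L) = n) → n ≤ m := by
      rintro n ⟨L, hL, rfl⟩
      exact hm _ (hI L hL)
    have hex : ∃ n, ∃ L, P L ∧ Nat.card (I L) = n := ⟨_, M₁, hM₁, rfl⟩
    obtain ⟨n₀, hn₀⟩ := hex
    obtain ⟨L, hL, hLn⟩ := Nat.findGreatest_spec (P := fun n => ∃ L, P L ∧ Nat.card (I L) = n)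
      (hbdd n₀ hn₀) hn₀
    refine ⟨L, hL, fun L' hL' => ?_⟩
    rw [hLn]
    exact Nat.le_findGreatest (hbdd _ ⟨L', hL', rfl⟩) ⟨L', hL', rfl⟩
  have hcontains : ∀ L', P L' → L' ≤ L ⊔ M₁ := by
    intro L' hL' x hx
    have hP := hmulP L L' hL hL'
    have := hI _ hP
    have hle : I L ≤ I (L ⊔ L') := Subgroup.map_mono (fun y hy =>
      Subgroup.mem_subgroupOf.2 (Subgroup.mem_sup_left hy))
    have heq : I L = I (L ⊔ L') := Subgroup.eq_of_le_of_card_ge hle (hLmax _ hP)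
    have hxI : QuotientGroup.mk' M ⟨x, hL'.1 hx⟩ ∈ I L := by
      rw [heq]
      exact ⟨⟨x, hL'.1 hx⟩, Subgroup.mem_subgroupOf.2 (Subgroup.mem_sup_right hx), rfl⟩
    obtain ⟨l, hl, hlx⟩ := hxI
    have hmem : l⁻¹ * ⟨x, hL'.1 hx⟩ ∈ M := QuotientGroup.eq.1 hlx
    have h1 : x = l.1 * (l.1⁻¹ * x) := by group
    rw [h1]
    exact mul_mem (Subgroup.mem_sup_left hl) (Subgroup.mem_sup_right ⟨_, hmem, rfl⟩)
  have hPL := hmulP L M₁ hL hM₁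
  refine ⟨L ⊔ M₁, ⟨fun x hx a => ?_⟩, hPL.2.2, ?_⟩
  · refine hcontains ((L ⊔ M₁).map (MulAut.conj a).toMonoidHom) ⟨?_, ?_, ?_⟩ ⟨x, hx, rfl⟩
    · rintro _ ⟨y, hy, rfl⟩
      exact (inferInstance : B.Normal).conj_mem y (hPL.1 hy) a
    · rintro b hb _ ⟨y, hy, rfl⟩
      refine ⟨(a⁻¹ * b * a) * y * (a⁻¹ * b * a)⁻¹, hPL.2.1 _ ?_ y hy, ?_⟩
      · have := (inferInstance : B.Normal).conj_mem b hb a⁻¹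
        rwa [inv_inv] at this
      · simp only [MulEquiv.toMonoidHom_eq_coe, MonoidHom.coe_coe, MulAut.conj_apply]
        group
    · have := hPL.2.2.conj h a
      rw [Subgroup.coe_map]
      exact this
  · obtain ⟨S, hS, hSB⟩ := hB
    obtain ⟨S', hS', hSM⟩ := hMo
    refine ⟨S ∪ B.subtype '' S', hS.union (hS'.image _), fun g hg => ?_⟩
    have hgB : g ∈ B := hSB g fun s hs => hg s (Or.inl hs)
    refine Subgroup.mem_sup_right ⟨⟨g, hgB⟩, hSM _ fun s hs => ?_, rfl⟩
    exact hg s.1 (Or.inr ⟨s, hs, rfl⟩)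

end

/-- A pair of polynomial growth is discrete modulo a relatively compact open normal subgroup. -/
theorem PolyGrowth.exists_normal {d : ℕ} : ∀ {A : Type} [Group A] {K : Subgroup A},
    PolyGrowth K d →
      ∃ M : Subgroup A, M.Normal ∧ CosetFinite K (M : Set A) ∧ IsOpenRel K M := by
  induction d with
  | zero =>
    intro A _ K h
    have := h.finite_of_zero
    exact ⟨⊤, inferInstance, ⟨Set.range (Quotient.out : A ⧸ K → A), Set.finite_range _,
      fun x _ => ⟨_, ⟨(x : A ⧸ K), rfl⟩, QuotientGroup.eq.1 (QuotientGroup.out_eq' _)⟩⟩,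
      ⟨∅, Set.finite_empty, fun _ _ => trivial⟩⟩
  | succ d ih =>
    intro A _ K h
    by_cases hfin : Finite (A ⧸ K)
    · exact ⟨⊤, inferInstance, ⟨Set.range (Quotient.out : A ⧸ K → A), Set.finite_range _,
        fun x _ => ⟨_, ⟨(x : A ⧸ K), rfl⟩, QuotientGroup.eq.1 (QuotientGroup.out_eq' _)⟩⟩,
        ⟨∅, Set.finite_empty, fun _ _ => trivial⟩⟩
    have : Infinite (A ⧸ K) := not_finite_iff_infinite.1 hfin
    obtain ⟨A₀, hnormal, hA₀, φ, hφ, hφK, hopen⟩ := h.exists_surjective_int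
    have h₀ := h.finiteIndex A₀
    have hker := h₀.ker φ hφ hφK
    obtain ⟨M₁, hM₁, hM₁b, hM₁o⟩ := ih hker
    obtain ⟨M₂, hM₂, hM₂b, hM₂o⟩ := exists_normal_of_normal h₀ φ.ker
      ⟨{1}, Set.finite_singleton 1, fun g hg => hφK (by simpa using hg 1 rfl)⟩ hker M₁ hM₁b hM₁o
    refine exists_normal_of_normal h A₀ ?_ h₀ M₂ hM₂b hM₂o
    obtain ⟨S, hS, hSg⟩ := hopen
    refine ⟨S, hS, fun g hg => ?_⟩
    obtain ⟨x, -, rfl⟩ := hSg g hg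
    exact x.2

end TransitiveGrowth

namespace TransitiveGrowth
open scoped Classical commutatorElement

section

variable {β Γ : Type} [Group Γ]

/-- The formal inverse of a bracket of generators, for an involution `ι` of the generators. -/
def bracketInv (ι : β → β) : FreeMagma β → FreeMagma β
  | .of b => .of (ι b)
  | .mul x y => .mul y x

/-- The value of a bracket of generators. -/
def bracketVal (f : β → Γ) : FreeMagma β → Γ
  | .of b => f b
  | .mul x y => ⁅bracketVal f x, bracketVal f y⁆

lemma bracketVal_mul (f : β → Γ) (x y : FreeMagma β) :
    bracketVal f (x * y) = ⁅bracketVal f x, bracketVal f y⁆ := rfl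

lemma bracket_length_mul (x y : FreeMagma β) : (x * y).length = x.length + y.length := rfl

lemma bracketInv_length (ι : β → β) (x : FreeMagma β) : (bracketInv ι x).length = x.length := by
  cases x with
  | of b => rfl
  | mul x y => exact add_comm _ _

lemma bracketVal_inv {f : β → Γ} {ι : β → β} (hι : ∀ b, f (ι b) = (f b)⁻¹) (x : FreeMagma β) :
    bracketVal f (bracketInv ι x) = (bracketVal f x)⁻¹ := by
  cases x with
  | of b => exact hι b
  | mul x y => exact (commutatorElement_inv _ _).symm

lemma finite_length_le [Finite β] (n : ℕ) : {x : FreeMagma β | x.length ≤ n}.Finite := by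
  induction n with
  | zero =>
    refine Set.finite_empty.subset fun x hx => ?_
    have := x.length_pos
    simp only [Set.mem_ofPred_eq] at hx
    omega
  | succ n ih =>
    refine ((Set.finite_range (FreeMagma.of (α := β))).union (ih.image2 (· * ·) ih)).subset ?_
    intro x hx
    cases x with
    | of b => exact Or.inl ⟨b, rfl⟩
    | mul x y =>
      right
      have h1 := x.length_pos
      have h2 := y.length_pos
      have h3 : x.length + y.length ≤ n + 1 := hx
      exact ⟨x, by simp only [Set.mem_ofPred_eq]; omega, y, by
        simp only [Set.mem_ofPred_eq]; omega, rfl⟩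

/-- The value of a word in brackets. -/
def wordVal (f : β → Γ) (u : List (FreeMagma β)) : Γ := (u.map (bracketVal f)).prod

/-- The cost of a word in brackets. -/
def wordCost (r : ℕ) (u : List (FreeMagma β)) : ℝ := (u.map fun x => ((r : ℝ)⁻¹) ^ x.length).sum

/-- The word obtained from `u` by conjugating every letter by `y`. -/
def conjWord (y : FreeMagma β) (u : List (FreeMagma β)) : List (FreeMagma β) :=
  u.flatMap fun x => [y * x, x]

/-- A word representing the commutator of the word `ys` and the letter `x`. -/
def commLetter (x : FreeMagma β) : List (FreeMagma β) → List (FreeMagma β)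
  | [] => []
  | y :: ys => conjWord y (commLetter x ys) ++ [y * x]

/-- A word representing the commutator of the words `ys` and `xs`. -/
def commWord (ys : List (FreeMagma β)) : List (FreeMagma β) → List (FreeMagma β)
  | [] => []
  | x :: xs => commLetter x ys ++ conjWord x (commWord ys xs)

section val

variable (f : β → Γ)

@[simp] lemma wordVal_nil : wordVal f [] = 1 := rfl

@[simp] lemma wordVal_cons (x : FreeMagma β) (u : List (FreeMagma β)) :
    wordVal f (x :: u) = bracketVal f x * wordVal f u := by simp [wordVal]

@[simp] lemma wordVal_append (u v : List (FreeMagma β)) :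
    wordVal f (u ++ v) = wordVal f u * wordVal f v := by simp [wordVal]

lemma conjWord_cons (y x : FreeMagma β) (u : List (FreeMagma β)) :
    conjWord y (x :: u) = (y * x) :: x :: conjWord y u := rfl

lemma wordVal_conjWord (y : FreeMagma β) (u : List (FreeMagma β)) :
    wordVal f (conjWord y u) = bracketVal f y * wordVal f u * (bracketVal f y)⁻¹ := by
  induction u with
  | nil => simp [conjWord]
  | cons x u ih =>
    rw [conjWord_cons, wordVal_cons, wordVal_cons, ih, bracketVal_mul, wordVal_cons,
      commutatorElement_def]
    group

lemma wordVal_commLetter (x : FreeMagma β) (ys : List (FreeMagma β)) :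
    wordVal f (commLetter x ys) = ⁅wordVal f ys, bracketVal f x⁆ := by
  induction ys with
  | nil => simp [commLetter]
  | cons y ys ih =>
    rw [commLetter, wordVal_append, wordVal_conjWord, ih, wordVal_cons, wordVal_cons, wordVal_nil,
      bracketVal_mul]
    simp only [commutatorElement_def]
    group

lemma wordVal_commWord (ys xs : List (FreeMagma β)) :
    wordVal f (commWord ys xs) = ⁅wordVal f ys, wordVal f xs⁆ := by
  induction xs with
  | nil => simp [commWord]
  | cons x xs ih =>
    rw [commWord, wordVal_append, wordVal_conjWord, ih, wordVal_cons, wordVal_commLetter]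
    simp only [commutatorElement_def]
    group

lemma wordVal_replicate (n : ℕ) (x : FreeMagma β) :
    wordVal f (List.replicate n x) = bracketVal f x ^ n := by
  simp [wordVal]

end val

section cost

variable {r : ℕ}

@[simp] lemma wordCost_nil : wordCost r ([] : List (FreeMagma β)) = 0 := rfl

@[simp] lemma wordCost_cons (x : FreeMagma β) (u : List (FreeMagma β)) :
    wordCost r (x :: u) = ((r : ℝ)⁻¹) ^ x.length + wordCost r u := by simp [wordCost]

@[simp] lemma wordCost_append (u v : List (FreeMagma β)) :
    wordCost r (u ++ v) = wordCost r u + wordCost r v := by simp [wordCost]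

lemma wordCost_nonneg (u : List (FreeMagma β)) : 0 ≤ wordCost r u := by
  induction u with
  | nil => simp
  | cons x u ih => rw [wordCost_cons]; positivity

lemma wordCost_replicate (n : ℕ) (x : FreeMagma β) :
    wordCost r (List.replicate n x) = n * ((r : ℝ)⁻¹) ^ x.length := by
  simp [wordCost]

lemma wordCost_conjWord (y : FreeMagma β) (u : List (FreeMagma β)) :
    wordCost r (conjWord y u) = (1 + ((r : ℝ)⁻¹) ^ y.length) * wordCost r u := by
  induction u with
  | nil => simp [conjWord]
  | cons x u ih =>
    rw [conjWord_cons, wordCost_cons, wordCost_cons, ih, bracket_length_mul, wordCost_cons, pow_add]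
    ring

lemma wordCost_foldr_conjWord (ys u : List (FreeMagma β)) :
    wordCost r (ys.foldr conjWord u) ≤ Real.exp (wordCost r ys) * wordCost r u := by
  induction ys with
  | nil => simp
  | cons y ys ih =>
    rw [List.foldr_cons, wordCost_conjWord, wordCost_cons, Real.exp_add, mul_assoc]
    have := wordCost_nonneg (r := r) (ys.foldr conjWord u)
    have h1 := Real.add_one_le_exp (((r : ℝ)⁻¹) ^ y.length)
    gcongr
    linarith

lemma wordCost_commLetter (x : FreeMagma β) (ys : List (FreeMagma β)) :
    wordCost r (commLetter x ys) + ((r : ℝ)⁻¹) ^ x.length ≤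
      Real.exp (wordCost r ys) * ((r : ℝ)⁻¹) ^ x.length := by
  induction ys with
  | nil => simp [commLetter]
  | cons y ys ih =>
    rw [commLetter, wordCost_append, wordCost_conjWord, wordCost_cons, wordCost_nil,
      bracket_length_mul, pow_add, wordCost_cons, Real.exp_add, mul_assoc]
    have h1 := Real.add_one_le_exp (((r : ℝ)⁻¹) ^ y.length)
    have h0 := wordCost_nonneg (r := r) (commLetter x ys)
    calc _ = (1 + ((r : ℝ)⁻¹) ^ y.length) *
          (wordCost r (commLetter x ys) + ((r : ℝ)⁻¹) ^ x.length) := by ring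
      _ ≤ _ := by gcongr; linarith

lemma wordCost_commWord (ys xs : List (FreeMagma β)) :
    wordCost r (commWord ys xs) ≤ Real.exp (wordCost r ys) * (Real.exp (wordCost r xs) - 1) := by
  induction xs with
  | nil => simp [commWord]
  | cons x xs ih =>
    rw [commWord, wordCost_append, wordCost_conjWord, wordCost_cons, Real.exp_add]
    have h1 := Real.add_one_le_exp (((r : ℝ)⁻¹) ^ x.length)
    have h2 := wordCost_commLetter (r := r) x ys
    have h3 := Real.exp_pos (wordCost r ys)
    have h4 := Real.exp_pos (wordCost r xs)
    have h5 : 0 ≤ ((r : ℝ)⁻¹) ^ x.length := by positivity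
    set a := ((r : ℝ)⁻¹) ^ x.length
    set E := Real.exp (wordCost r ys)
    set e := Real.exp (wordCost r xs)
    have h6 : (1 + a) * wordCost r (commWord ys xs) ≤ (1 + a) * (E * (e - 1)) := by gcongr
    have h7 : E * ((1 + a) * e) ≤ E * (Real.exp a * e) := by gcongr; linarith
    nlinarith

end cost

lemma mem_conjWord {y z : FreeMagma β} {u : List (FreeMagma β)} :
    z ∈ conjWord y u ↔ z ∈ u ∨ ∃ x ∈ u, z = y * x := by
  simp only [conjWord, List.mem_flatMap, List.mem_cons, List.not_mem_nil, or_false]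
  constructor
  · rintro ⟨x, hx, rfl | rfl⟩
    · exact Or.inr ⟨x, hx, rfl⟩
    · exact Or.inl hx
  · rintro (h | ⟨x, hx, rfl⟩)
    · exact ⟨z, h, Or.inr rfl⟩
    · exact ⟨x, hx, Or.inl rfl⟩

lemma mem_foldr_conjWord {i j : ℕ} {ys u : List (FreeMagma β)} (hy : ∀ y ∈ ys, i ≤ y.length)
    (hu : ∀ x ∈ u, j ≤ x.length) {z : FreeMagma β} (hz : z ∈ ys.foldr conjWord u) :
    z ∈ u ∨ i + j ≤ z.length := by
  induction ys generalizing z with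
  | nil => exact Or.inl hz
  | cons y ys ih =>
    rw [List.foldr_cons, mem_conjWord] at hz
    have hy' : ∀ y ∈ ys, i ≤ y.length := fun y h => hy y (List.mem_cons_of_mem _ h)
    rcases hz with hz | ⟨x, hx, rfl⟩
    · exact ih hy' hz
    · right
      have h1 := hy y List.mem_cons_self
      rw [bracket_length_mul]
      rcases ih hy' hx with h | h
      · have := hu x h; omega
      · omega

lemma wordVal_foldr_conjWord (f : β → Γ) (ys u : List (FreeMagma β)) :
    wordVal f (ys.foldr conjWord u) = wordVal f ys * wordVal f u * (wordVal f ys)⁻¹ := by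
  induction ys with
  | nil => simp
  | cons y ys ih =>
    rw [List.foldr_cons, wordVal_conjWord, ih, wordVal_cons]
    group

lemma le_length_of_mem_commLetter {i : ℕ} {x : FreeMagma β} {ys : List (FreeMagma β)}
    (hy : ∀ y ∈ ys, i ≤ y.length) {z : FreeMagma β} (hz : z ∈ commLetter x ys) :
    i + x.length ≤ z.length := by
  induction ys generalizing z with
  | nil => simp [commLetter] at hz
  | cons y ys ih =>
    have hy' : ∀ y ∈ ys, i ≤ y.length := fun y h => hy y (List.mem_cons_of_mem _ h)
    have h1 := hy y List.mem_cons_self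
    rw [commLetter, List.mem_append, List.mem_singleton, mem_conjWord] at hz
    rcases hz with (hz | ⟨t, ht, rfl⟩) | rfl
    · exact ih hy' hz
    · have := ih hy' ht
      rw [bracket_length_mul]; omega
    · rw [bracket_length_mul]; omega

lemma le_length_of_mem_commWord {i j : ℕ} {ys xs : List (FreeMagma β)}
    (hy : ∀ y ∈ ys, i ≤ y.length) (hx : ∀ x ∈ xs, j ≤ x.length) {z : FreeMagma β}
    (hz : z ∈ commWord ys xs) : i + j ≤ z.length := by
  induction xs generalizing z with
  | nil => simp [commWord] at hz
  | cons x xs ih =>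
    have hx' : ∀ x ∈ xs, j ≤ x.length := fun y h => hx y (List.mem_cons_of_mem _ h)
    have h1 := hx x List.mem_cons_self
    rw [commWord, List.mem_append, mem_conjWord] at hz
    rcases hz with hz | hz | ⟨t, ht, rfl⟩
    · have := le_length_of_mem_commLetter hy hz; omega
    · exact ih hx' hz
    · have := ih hx' ht
      rw [bracket_length_mul]; omega

/-- Words whose letters are copies of `z` or longer than `z`. -/
def LeadBy (z : FreeMagma β) (u : List (FreeMagma β)) : Prop :=
  ∀ x ∈ u, x = z ∨ z.length < x.length

lemma LeadBy.conjWord {z : FreeMagma β} {u : List (FreeMagma β)} (h : LeadBy z u)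
    (y : FreeMagma β) : LeadBy z (conjWord y u) ∧ (conjWord y u).count z = u.count z := by
  have hy := y.length_pos
  constructor
  · intro t ht
    rcases mem_conjWord.1 ht with ht | ⟨x, hx, rfl⟩
    · exact h t ht
    · right
      rw [bracket_length_mul]
      rcases h x hx with rfl | h'
      · omega
      · omega
  · induction u with
    | nil => rfl
    | cons x u ih =>
      have h' : LeadBy z u := fun t ht => h t (List.mem_cons_of_mem _ ht)
      rw [conjWord_cons, List.count_cons, List.count_cons, List.count_cons, ih h']
      have hne : (y * x == z) = false := by
        rw [beq_eq_false_iff_ne]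
        intro heq
        have h1 := bracket_length_mul y x
        rw [heq] at h1
        rcases h x List.mem_cons_self with h2 | h2
        · rw [h2] at h1; omega
        · omega
      simp [hne]

lemma leadBy_commLetter (y x : FreeMagma β) (q : ℕ) :
    LeadBy (y * x) (commLetter x (List.replicate q y)) ∧
      (commLetter x (List.replicate q y)).count (y * x) = q := by
  induction q with
  | zero => simp [commLetter, LeadBy]
  | succ q ih =>
    have h := ih.1.conjWord y
    rw [List.replicate_succ, commLetter]
    refine ⟨?_, ?_⟩
    · intro t ht
      rw [List.mem_append, List.mem_singleton] at ht
      rcases ht with ht | ht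
      · exact h.1 t ht
      · exact Or.inl ht
    · rw [List.count_append, h.2, ih.2]; simp

lemma leadBy_commWord (y x : FreeMagma β) (q p : ℕ) :
    LeadBy (y * x) (commWord (List.replicate q y) (List.replicate p x)) ∧
      (commWord (List.replicate q y) (List.replicate p x)).count (y * x) = p * q := by
  induction p with
  | zero => simp [commWord, LeadBy]
  | succ p ih =>
    have h := ih.1.conjWord x
    have h' := leadBy_commLetter y x q
    rw [List.replicate_succ, commWord]
    refine ⟨?_, ?_⟩
    · intro t ht
      rw [List.mem_append] at ht
      rcases ht with ht | ht
      · exact h'.1 t ht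
      · exact h.1 t ht
    · rw [List.count_append, h.2, ih.2, h'.2]; ring

lemma count_mul_le_wordCost {r : ℕ} (z : FreeMagma β) (u : List (FreeMagma β)) :
    (u.count z : ℝ) * ((r : ℝ)⁻¹) ^ z.length ≤ wordCost r u := by
  induction u with
  | nil => simp
  | cons x u ih =>
    rw [List.count_cons, wordCost_cons]
    have : 0 ≤ ((r : ℝ)⁻¹) ^ x.length := by positivity
    by_cases h : x = z
    · subst h; simp only [beq_self_eq_true, if_true]; push_cast; linarith
    · simp only [beq_iff_eq, h, if_false, add_zero]; linarith

/-- Moving all copies of the letter `z` to the left of a word. -/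
lemma exists_collect {f : β → Γ} {ι : β → β} (hι : ∀ b, f (ι b) = (f b)⁻¹) (r : ℕ)
    (z : FreeMagma β) (u : List (FreeMagma β)) :
    ∃ u' : List (FreeMagma β), wordVal f u = bracketVal f z ^ u.count z * wordVal f u' ∧
      (∀ x ∈ u', (x ∈ u ∧ x ≠ z) ∨ z.length < x.length) ∧
      wordCost r u' ≤ Real.exp (wordCost r u) * wordCost r u := by
  suffices h : ∃ u' : List (FreeMagma β), wordVal f u = bracketVal f z ^ u.count z * wordVal f u' ∧
      (∀ x ∈ u', (x ∈ u ∧ x ≠ z) ∨ z.length < x.length) ∧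
      wordCost r u' ≤ Real.exp (u.count z * ((r : ℝ)⁻¹) ^ z.length) * wordCost r u by
    obtain ⟨u', h1, h2, h3⟩ := h
    refine ⟨u', h1, h2, h3.trans ?_⟩
    have := count_mul_le_wordCost (r := r) z u
    have := wordCost_nonneg (r := r) u
    gcongr
  induction u with
  | nil => exact ⟨[], by simp⟩
  | cons x u ih =>
    obtain ⟨u', h1, h2, h3⟩ := ih
    by_cases hx : x = z
    · subst hx
      refine ⟨u', ?_, fun t ht => ?_, ?_⟩
      · rw [wordVal_cons, h1, List.count_cons_self, pow_succ', mul_assoc]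
      · rcases h2 t ht with h | h
        · exact Or.inl ⟨List.mem_cons_of_mem _ h.1, h.2⟩
        · exact Or.inr h
      · refine h3.trans ?_
        rw [List.count_cons_self, wordCost_cons]
        have h0 := wordCost_nonneg (r := r) u
        gcongr
        · linarith
        · have : 0 ≤ ((r : ℝ)⁻¹) ^ x.length := by positivity
          linarith
    · set m := u.count z
      have hcount : (x :: u).count z = m := List.count_cons_of_ne hx
      let ys := List.replicate m (bracketInv ι z)
      have hys : wordVal f ys = (bracketVal f z ^ m)⁻¹ := by
        rw [wordVal_replicate, bracketVal_inv hι, inv_pow]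
      have hcost : wordCost r ys = m * ((r : ℝ)⁻¹) ^ z.length := by
        rw [wordCost_replicate, bracketInv_length]
      refine ⟨ys.foldr conjWord [x] ++ u', ?_, fun t ht => ?_, ?_⟩
      · rw [hcount, wordVal_append, wordVal_foldr_conjWord, hys, wordVal_cons, wordVal_cons,
          wordVal_nil, h1]
        group
      · rcases List.mem_append.1 ht with ht | ht
        · rcases mem_foldr_conjWord (i := z.length) (j := 1)
            (fun y hy => by rw [List.eq_of_mem_replicate hy, bracketInv_length])
            (fun x _ => x.length_pos) ht with h | h
          · rw [List.mem_singleton] at h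
            rw [h]
            exact Or.inl ⟨List.mem_cons_self, hx⟩
          · right; omega
        · rcases h2 t ht with h | h
          · exact Or.inl ⟨List.mem_cons_of_mem _ h.1, h.2⟩
          · exact Or.inr h
      · rw [hcount, wordCost_append]
        have := wordCost_foldr_conjWord (r := r) ys [x]
        rw [hcost, wordCost_cons, wordCost_nil, add_zero] at this
        rw [wordCost_cons, mul_add]
        linarith

end
end TransitiveGrowth

namespace TransitiveGrowth
open scoped Classical commutatorElement

section Cover

variable {β Γ : Type} [Group Γ]

/-- Products of at most `n` generators. -/
def genBall (f : β → Γ) (n : ℕ) : Set Γ := {g | ∃ l : List β, l.length ≤ n ∧ (l.map f).prod = g}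

/-- Values of words of cost at most `C` in brackets of length at least `v`. -/
def costBall (f : β → Γ) (r v : ℕ) (C : ℝ) : Set Γ :=
  {g | ∃ u : List (FreeMagma β), (∀ x ∈ u, v ≤ x.length) ∧ wordCost r u ≤ C ∧ wordVal f u = g}

variable {f : β → Γ} {ι : β → β} {r v i j m n : ℕ} {C D : ℝ} {g h : Γ}

lemma genBall_mul (hg : g ∈ genBall f m) (hh : h ∈ genBall f n) : g * h ∈ genBall f (m + n) := by
  obtain ⟨l, hl, rfl⟩ := hg
  obtain ⟨k, hk, rfl⟩ := hh
  exact ⟨l ++ k, by rw [List.length_append]; omega, by simp⟩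

lemma genBall_inv (hι : ∀ b, f (ι b) = (f b)⁻¹) (hg : g ∈ genBall f m) : g⁻¹ ∈ genBall f m := by
  obtain ⟨l, hl, rfl⟩ := hg
  refine ⟨(l.map ι).reverse, by simpa using hl, ?_⟩
  rw [List.prod_inv_reverse, List.map_reverse, List.map_map, List.map_map]
  congr 2
  exact List.map_congr_left fun b _ => hι b

lemma genBall_mono (hmn : m ≤ n) (hg : g ∈ genBall f m) : g ∈ genBall f n :=
  let ⟨l, hl, hl'⟩ := hg
  ⟨l, hl.trans hmn, hl'⟩

lemma genBall_comm (hι : ∀ b, f (ι b) = (f b)⁻¹) (hg : g ∈ genBall f m) (hh : h ∈ genBall f n) :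
    ⁅g, h⁆ ∈ genBall f (2 * (m + n)) := by
  refine genBall_mono ?_ (genBall_mul (genBall_mul (genBall_mul hg hh) (genBall_inv hι hg))
    (genBall_inv hι hh))
  omega

lemma genBall_subset_costBall (hr : 1 ≤ r) (hg : g ∈ genBall f (m * r)) :
    g ∈ costBall f r 1 m := by
  obtain ⟨l, hl, rfl⟩ := hg
  refine ⟨l.map FreeMagma.of, fun x _ => x.length_pos, ?_, ?_⟩
  · have : wordCost r (l.map FreeMagma.of) = l.length * (r : ℝ)⁻¹ := by
      rw [wordCost, List.map_map]
      have : ((fun x : FreeMagma β => ((r : ℝ)⁻¹) ^ x.length) ∘ FreeMagma.of) =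
          fun _ => (r : ℝ)⁻¹ := by
        funext b
        exact pow_one _
      rw [this]
      simp
    rw [this, ← div_eq_mul_inv, div_le_iff₀ (by positivity)]
    exact_mod_cast hl
  · rw [wordVal, List.map_map]
    rfl

lemma costBall_mono (hC : C ≤ D) (hij : i ≤ j) (hg : g ∈ costBall f r j C) :
    g ∈ costBall f r i D :=
  let ⟨u, h1, h2, h3⟩ := hg
  ⟨u, fun x hx => hij.trans (h1 x hx), h2.trans hC, h3⟩

lemma costBall_mul (hg : g ∈ costBall f r v C) (hh : h ∈ costBall f r v D) :
    g * h ∈ costBall f r v (C + D) := by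
  obtain ⟨u, h1, h2, rfl⟩ := hg
  obtain ⟨w, k1, k2, rfl⟩ := hh
  refine ⟨u ++ w, fun x hx => ?_, ?_, wordVal_append f u w⟩
  · rcases List.mem_append.1 hx with hx | hx
    exacts [h1 x hx, k1 x hx]
  · rw [wordCost_append]; exact add_le_add h2 k2

lemma costBall_inv (hι : ∀ b, f (ι b) = (f b)⁻¹) (hg : g ∈ costBall f r v C) :
    g⁻¹ ∈ costBall f r v C := by
  obtain ⟨u, h1, h2, rfl⟩ := hg
  refine ⟨(u.map (bracketInv ι)).reverse, fun x hx => ?_, ?_, ?_⟩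
  · simp only [List.mem_reverse, List.mem_map] at hx
    obtain ⟨y, hy, rfl⟩ := hx
    rw [bracketInv_length]
    exact h1 y hy
  · refine le_of_eq_of_le ?_ h2
    rw [wordCost, wordCost, List.map_reverse, List.sum_reverse, List.map_map]
    congr 1
    exact List.map_congr_left fun x _ => by simp [bracketInv_length]
  · rw [wordVal, wordVal, List.prod_inv_reverse, List.map_reverse, List.map_map, List.map_map]
    congr 2
    exact List.map_congr_left fun x _ => by simp [bracketVal_inv hι]

lemma costBall_conj (hh : h ∈ costBall f r 1 D) (hg : g ∈ costBall f r v C) :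
    h * g * h⁻¹ ∈ costBall f r v (Real.exp D * C) := by
  obtain ⟨u, h1, h2, rfl⟩ := hg
  obtain ⟨w, k1, k2, rfl⟩ := hh
  refine ⟨w.foldr conjWord u, fun x hx => ?_, ?_, wordVal_foldr_conjWord f w u⟩
  · rcases mem_foldr_conjWord k1 h1 hx with hx | hx
    · exact h1 x hx
    · omega
  · refine (wordCost_foldr_conjWord w u).trans ?_
    have := wordCost_nonneg (r := r) u
    gcongr

lemma costBall_comm (hg : g ∈ costBall f r i C) (hh : h ∈ costBall f r j D) :
    ⁅g, h⁆ ∈ costBall f r (i + j) (Real.exp C * Real.exp D) := by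
  obtain ⟨u, h1, h2, rfl⟩ := hg
  obtain ⟨w, k1, k2, rfl⟩ := hh
  refine ⟨commWord u w, fun x hx => le_length_of_mem_commWord h1 k1 hx, ?_, wordVal_commWord f u w⟩
  refine (wordCost_commWord u w).trans ?_
  refine (mul_le_mul_of_nonneg_left (sub_le_self _ zero_le_one) (Real.exp_pos _).le).trans ?_
  gcongr

lemma pow_mul_inv_pow_le {a w : ℕ} (hr : 1 ≤ r) (ha : a ≤ r ^ w) : (a : ℝ) * ((r : ℝ)⁻¹) ^ w ≤ 1 := by
  rw [inv_pow, ← div_eq_mul_inv, div_le_one (by positivity)]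
  exact_mod_cast ha

lemma bracketVal_pow_mem_costBall (hr : 1 ≤ r) (z : FreeMagma β) {a : ℕ} (ha : a ≤ r ^ z.length) :
    bracketVal f z ^ a ∈ costBall f r z.length 1 :=
  ⟨List.replicate a z, fun x hx => (by rw [List.eq_of_mem_replicate hx]),
    (wordCost_replicate a z).trans_le (pow_mul_inv_pow_le hr ha), wordVal_replicate f a z⟩

lemma comm_pow_eq (hι : ∀ b, f (ι b) = (f b)⁻¹) (hr : 1 ≤ r) (y x : FreeMagma β) {q p : ℕ}
    (hq : q ≤ r ^ y.length) (hp : p ≤ r ^ x.length) :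
    ∃ e ∈ costBall f r ((y * x).length + 1)
        (Real.exp (Real.exp 1 * Real.exp 1) * (Real.exp 1 * Real.exp 1)),
      ⁅bracketVal f y ^ q, bracketVal f x ^ p⁆ = bracketVal f (y * x) ^ (p * q) * e := by
  obtain ⟨h1, h2⟩ := leadBy_commWord y x q p
  obtain ⟨u', h3, h4, h5⟩ := exists_collect hι r (y * x)
    (commWord (List.replicate q y) (List.replicate p x))
  rw [wordVal_commWord, wordVal_replicate, wordVal_replicate, h2] at h3
  refine ⟨_, ⟨u', fun z hz => ?_, ?_, rfl⟩, h3⟩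
  · rcases h4 z hz with h | h
    · rcases h1 z h.1 with h' | h'
      · exact absurd h' h.2
      · exact h'
    · exact h
  · have hc : wordCost r (commWord (List.replicate q y) (List.replicate p x)) ≤
        Real.exp 1 * Real.exp 1 := by
      refine (wordCost_commWord _ _).trans ?_
      rw [wordCost_replicate, wordCost_replicate]
      refine (mul_le_mul_of_nonneg_left (sub_le_self _ zero_le_one) (Real.exp_pos _).le).trans ?_
      have := pow_mul_inv_pow_le hr hq
      have := pow_mul_inv_pow_le hr hp
      gcongr
    refine h5.trans ?_
    have := wordCost_nonneg (r := r) (commWord (List.replicate q y) (List.replicate p x))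
    gcongr

/-- Powers of a bracket of length `w` up to `r ^ w` are products of `O(r)` generators, up to a
word of bounded cost in longer brackets. -/
lemma exists_pow_eq (ι : β → β) (z : FreeMagma β) : ∃ (D : ℕ) (C : ℝ), ∀ (Γ : Type) [Group Γ]
    (f : β → Γ), (∀ b, f (ι b) = (f b)⁻¹) → ∀ r a : ℕ, 1 ≤ r → a ≤ r ^ z.length →
      ∃ g ∈ genBall f (D * r), ∃ e ∈ costBall f r (z.length + 1) C, bracketVal f z ^ a = g * e := by
  induction z with
  | ih1 b =>
    refine ⟨1, 0, fun Γ _ f hι r a hr ha => ⟨f b ^ a, ⟨List.replicate a b, ?_, by simp⟩, 1,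
      ⟨[], by simp, by simp, rfl⟩, by simp [bracketVal]⟩⟩
    have : a ≤ r ^ 1 := ha
    simpa using this
  | ih2 y x ihy ihx =>
    obtain ⟨Dy, Cy, hy⟩ := ihy
    obtain ⟨Dx, Cx, hx⟩ := ihx
    obtain ⟨D, C, hDC⟩ : ∃ (D : ℕ) (C : ℝ), ∀ (Γ : Type) [Group Γ]
        (f : β → Γ), (∀ b, f (ι b) = (f b)⁻¹) → ∀ r q p : ℕ, 1 ≤ r → q ≤ r ^ y.length →
        p ≤ r ^ x.length → ∃ g ∈ genBall f (D * r), ∃ e ∈ costBall f r ((y * x).length + 1) C,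
          bracketVal f (y * x) ^ (p * q) = g * e := by
      refine ⟨2 * (Dy + Dx), Real.exp (2 * (Dy + Dx) : ℕ) * (Real.exp Dy * (Real.exp Cy * Real.exp 1)) +
        Real.exp Dx * (Real.exp (1 + Cy) * Real.exp Cx) +
        Real.exp (Real.exp 1 * Real.exp 1) * (Real.exp 1 * Real.exp 1), fun Γ _ f hι r q p hr hq hp => ?_⟩
      obtain ⟨g, hg, e, he, hge⟩ := hy Γ f hι r q hr hq
      obtain ⟨g', hg', e', he', hge'⟩ := hx Γ f hι r p hr hp
      obtain ⟨k, hk, hk'⟩ := comm_pow_eq hι hr y x hq hp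
      have hY := bracketVal_pow_mem_costBall (f := f) hr y hq
      have hX := bracketVal_pow_mem_costBall (f := f) hr x hp
      have hgY : g ∈ costBall f r y.length (1 + Cy) := by
        have : g = bracketVal f y ^ q * e⁻¹ := by rw [hge]; group
        rw [this]
        exact costBall_mul hY (costBall_mono le_rfl (by omega) (costBall_inv hι he))
      have hg1 := genBall_subset_costBall hr hg
      have hg1' := genBall_subset_costBall hr hg'
      have hc : ⁅g, g'⁆ ∈ genBall f (2 * (Dy + Dx) * r) := by
        have := genBall_comm hι hg hg'
        rwa [← add_mul, ← mul_assoc] at this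
      have hc1 := costBall_inv hι (genBall_subset_costBall hr hc)
      have hk1 := costBall_conj hg1 (costBall_comm he hX)
      have hk2 := costBall_conj hg1' (costBall_comm hgY he')
      have hk1' := costBall_conj hc1 hk1
      have hl : (y * x).length = y.length + x.length := rfl
      have key := costBall_mul (costBall_mul
        (costBall_mono le_rfl (i := (y * x).length + 1) (by omega) hk1')
        (costBall_mono le_rfl (by omega) hk2)) (costBall_inv hι hk)
      refine ⟨_, hc, _, key, ?_⟩
      have : bracketVal f (y * x) ^ (p * q) = ⁅g * e, g' * e'⁆ * k⁻¹ := by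
        rw [← hge, ← hge', hk']; group
      rw [this, hge']
      simp only [commutatorElement_def]
      group
    refine ⟨D + D, Real.exp D * C + C, fun Γ _ f hι r a hr ha => ?_⟩
    have hpos : 0 < r ^ x.length := by positivity
    obtain ⟨g, hg, e, he, hge⟩ := hDC Γ f hι r (a / r ^ x.length) (r ^ x.length) hr
      (Nat.div_le_of_le_mul (by rw [← pow_add, add_comm]; exact ha)) le_rfl
    obtain ⟨g', hg', e', he', hge'⟩ := hDC Γ f hι r 1 (a % r ^ x.length) hr
      (Nat.one_le_pow _ _ hr) (Nat.mod_lt _ hpos).le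
    have hc := costBall_mul (costBall_conj (costBall_inv hι (genBall_subset_costBall hr hg')) he) he'
    refine ⟨g * g', by rw [add_mul]; exact genBall_mul hg hg', _, hc, ?_⟩
    have : a = r ^ x.length * (a / r ^ x.length) + a % r ^ x.length * 1 := by
      rw [mul_one, Nat.div_add_mod]
    rw [this, pow_add, hge, hge']
    group

/-- Words of bounded cost in the given brackets are covered by boundedly many balls. -/
def Coverable (ι : β → β) (s v : ℕ) (L : List (FreeMagma β)) : Prop :=
  ∃ D : ℕ, ∀ C : ℝ, ∃ K : ℕ, ∀ (Γ : Type) [Group Γ] (f : β → Γ), (∀ b, f (ι b) = (f b)⁻¹) →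
    (∀ x, s < x.length → bracketVal f x = 1) → ∀ r : ℕ, 1 ≤ r →
      ∃ Z : Finset Γ, Z.card ≤ K ∧ ∀ u : List (FreeMagma β), (∀ x ∈ u, x ∈ L ∨ v < x.length) →
        wordCost r u ≤ C → ∃ z ∈ Z, ∃ g ∈ genBall f (D * r), wordVal f u = z * g

lemma Coverable.cons {ι : β → β} {s : ℕ} {L : List (FreeMagma β)} {z : FreeMagma β}
    (hL : ∀ x ∈ L, x.length = z.length) (h : Coverable ι s z.length L) :
    Coverable ι s z.length (z :: L) := by
  obtain ⟨D, hD⟩ := h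
  obtain ⟨D', C', hz⟩ := exists_pow_eq ι z
  refine ⟨D + D', fun C => ?_⟩
  obtain ⟨K, hK⟩ := hD (Real.exp D' * (C' + Real.exp C * C))
  refine ⟨(⌈C⌉₊ + 1) * K, fun Γ _ f hι hs r hr => ?_⟩
  obtain ⟨Z, hZ, hcov⟩ := hK Γ f hι hs r hr
  refine ⟨((Finset.range (⌈C⌉₊ + 1)) ×ˢ Z).image
    fun p => bracketVal f z ^ (r ^ z.length * p.1) * p.2, ?_, fun u hu hc => ?_⟩
  · refine Finset.card_image_le.trans ?_
    rw [Finset.card_product, Finset.card_range]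
    gcongr
  · obtain ⟨u', h1, h2, h3⟩ := exists_collect hι r z u
    have hcount := (count_mul_le_wordCost (r := r) z u).trans hc
    set a := u.count z
    have hpos : 0 < r ^ z.length := by positivity
    obtain ⟨g, hg, e, ⟨w, hw1, hw2, rfl⟩, hge⟩ :=
      hz Γ f hι r (a % r ^ z.length) hr (Nat.mod_lt _ hpos).le
    obtain ⟨y, hy1, hy2, hy3⟩ := genBall_subset_costBall hr hg
    have hwu : ∀ x ∈ w ++ u', x ∈ L ∨ z.length < x.length := fun x hx => by
      rcases List.mem_append.1 hx with hx | hx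
      · exact Or.inr (hw1 x hx)
      · rcases h2 x hx with h | h
        · rcases hu x h.1 with h' | h'
          · exact Or.inl ((List.mem_cons.1 h').resolve_left h.2)
          · exact Or.inr h'
        · exact Or.inr h
    obtain ⟨z', hz', g', hg', heq⟩ := hcov (y.foldr conjWord (w ++ u')) (fun x hx => by
      rcases mem_foldr_conjWord (j := z.length) hy1 (fun x hx => by
        rcases hwu x hx with h | h
        · exact (hL x h).ge
        · exact h.le) hx with h | h
      · exact hwu x h
      · right; omega) (by
      refine (wordCost_foldr_conjWord _ _).trans ?_
      rw [wordCost_append]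
      have := wordCost_nonneg (r := r) u
      have := wordCost_nonneg (r := r) u'
      have := wordCost_nonneg (r := r) w
      have h5 : wordCost r u' ≤ Real.exp C * C := h3.trans (by gcongr)
      gcongr)
    refine ⟨_, Finset.mem_image_of_mem _ (Finset.mk_mem_product (a := a / r ^ z.length) ?_ hz'),
      g' * g, by rw [add_mul]; exact genBall_mul hg' hg, ?_⟩
    · rw [Finset.mem_range, Nat.lt_succ_iff]
      refine Nat.div_le_of_le_mul ?_
      rw [inv_pow, ← div_eq_mul_inv, div_le_iff₀ (by positivity)] at hcount
      have : (a : ℝ) ≤ ((⌈C⌉₊ * r ^ z.length : ℕ) : ℝ) := by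
        push_cast
        refine hcount.trans ?_
        gcongr
        exact Nat.le_ceil C
      rw [mul_comm]
      exact_mod_cast this
    · rw [wordVal_foldr_conjWord, hy3, wordVal_append] at heq
      have e1 : bracketVal f z ^ a = bracketVal f z ^ (r ^ z.length * (a / r ^ z.length)) *
          (g * wordVal f w) := by
        rw [← hge, ← pow_add, Nat.div_add_mod]
      have e2 : g * (wordVal f w * wordVal f u') = z' * g' * g := by rw [← heq]; group
      rw [h1, e1]
      calc _ = bracketVal f z ^ (r ^ z.length * (a / r ^ z.length)) *
            (g * (wordVal f w * wordVal f u')) := by group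
        _ = _ := by rw [e2]; group

lemma coverable_nil [Finite β] (ι : β → β) (s k : ℕ) : Coverable ι s (s - k) [] := by
  induction k with
  | zero =>
    refine ⟨0, fun C => ⟨1, fun Γ _ f hι hs r hr => ⟨{1}, by simp, fun u hu hc =>
      ⟨1, by simp, 1, ⟨[], by simp, rfl⟩, ?_⟩⟩⟩⟩
    rw [mul_one, wordVal]
    refine List.prod_eq_one fun t ht => ?_
    obtain ⟨x, hx, rfl⟩ := List.mem_map.1 ht
    refine hs x ?_
    simpa using hu x hx
  | succ k ih =>
    by_cases hk : s ≤ k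
    · have : s - (k + 1) = s - k := by omega
      rwa [this]
    set v := s - (k + 1)
    have hv : s - k = v + 1 := by omega
    rw [hv] at ih
    have key : ∀ L : List (FreeMagma β), (∀ x ∈ L, x.length = v + 1) → Coverable ι s (v + 1) L := by
      intro L
      induction L with
      | nil => exact fun _ => ih
      | cons z L ihL =>
        intro hL
        have hz := hL z List.mem_cons_self
        have := ihL fun x hx => hL x (List.mem_cons_of_mem _ hx)
        rw [← hz] at this ⊢
        exact this.cons fun x hx => (hL x (List.mem_cons_of_mem _ hx)).trans hz.symm
    have hfin : {x : FreeMagma β | x.length = v + 1}.Finite :=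
      (finite_length_le (v + 1)).subset fun x hx => le_of_eq hx
    obtain ⟨D, hD⟩ := key hfin.toFinset.toList fun x hx => by simpa using hx
    refine ⟨D, fun C => ?_⟩
    obtain ⟨K, hK⟩ := hD C
    refine ⟨K, fun Γ _ f hι hs r hr => ?_⟩
    obtain ⟨Z, hZ, hcov⟩ := hK Γ f hι hs r hr
    refine ⟨Z, hZ, fun u hu hc => hcov u (fun x hx => ?_) hc⟩
    have h1 : v < x.length := by simpa using hu x hx
    rcases Nat.lt_or_ge (v + 1) x.length with h | h
    · exact Or.inr h
    · left
      simp only [Finset.mem_toList, Set.Finite.mem_toFinset, Set.mem_ofPred_eq]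
      omega

/-- In groups generated by boundedly many elements whose long brackets vanish, balls of comparable
radii cover each other. -/
theorem exists_cover [Finite β] (ι : β → β) (s : ℕ) :
    ∃ D : ℕ, ∀ C : ℕ, ∃ K : ℕ, ∀ (Γ : Type) [Group Γ] (f : β → Γ), (∀ b, f (ι b) = (f b)⁻¹) →
      (∀ x, s < x.length → bracketVal f x = 1) → ∀ r : ℕ, 1 ≤ r →
        ∃ Z : Finset Γ, Z.card ≤ K ∧ ∀ g ∈ genBall f (C * r), ∃ z ∈ Z, ∃ h ∈ genBall f (D * r),
          g = z * h := by
  obtain ⟨D, hD⟩ := coverable_nil ι s s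
  refine ⟨D, fun C => ?_⟩
  obtain ⟨K, hK⟩ := hD C
  refine ⟨K, fun Γ _ f hι hs r hr => ?_⟩
  obtain ⟨Z, hZ, hcov⟩ := hK Γ f hι hs r hr
  refine ⟨Z, hZ, fun g hg => ?_⟩
  obtain ⟨u, h1, h2, rfl⟩ := genBall_subset_costBall hr hg
  exact hcov u (fun x hx => Or.inr (by have := h1 x hx; omega)) h2

end Cover

end TransitiveGrowth

namespace TransitiveGrowth
open scoped Classical commutatorElement Pointwise

section Certificate

lemma bracketVal_map {β Γ Γ' : Type} [Group Γ] [Group Γ'] (φ : Γ →* Γ') (f : β → Γ)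
    (x : FreeMagma β) : φ (bracketVal f x) = bracketVal (φ ∘ f) x := by
  induction x with
  | ih1 b => rfl
  | ih2 x y ihx ihy => rw [bracketVal_mul, bracketVal_mul, map_commutatorElement, ihx, ihy]

lemma bracketVal_mem_lowerCentralSeries {β Γ : Type} [Group Γ] (f : β → Γ) (n : ℕ) :
    ∀ x : FreeMagma β, 2 ^ n < x.length → bracketVal f x ∈
      (⊤ : Subgroup Γ).lowerCentralSeries n := by
  induction n with
  | zero => intro x _; simp
  | succ n ih =>
    intro x hx
    cases x with
    | of b =>
      have : 2 ^ (n + 1) < 1 := hx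
      have := Nat.one_le_two_pow (n := n + 1)
      omega
    | mul x y =>
      have h : 2 ^ (n + 1) < x.length + y.length := hx
      rw [pow_succ] at h
      rcases Nat.lt_or_ge (2 ^ n) x.length with h' | h'
      · exact Subgroup.commutator_mem_commutator (ih x h') (Subgroup.mem_top _)
      · have hy := ih y (by omega)
        change ⁅bracketVal f x, bracketVal f y⁆ ∈ _
        rw [← inv_mem_iff, commutatorElement_inv]
        exact Subgroup.commutator_mem_commutator hy (Subgroup.mem_top _)

lemma bracketVal_eq_one_of_forall {β Γ : Type} [Group Γ] (f : β → Γ) (s : ℕ)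
    (h : ∀ x : FreeMagma β, s < x.length → x.length ≤ 2 * s → bracketVal f x = 1) :
    ∀ x : FreeMagma β, 1 ≤ s → s < x.length → bracketVal f x = 1 := by
  intro x hs
  induction x with
  | ih1 b =>
    intro hx
    have : s < 1 := hx
    omega
  | ih2 x y ihx ihy =>
    intro hx
    by_cases hle : (x * y).length ≤ 2 * s
    · exact h _ hx hle
    · have hl : (x * y).length = x.length + y.length := rfl
      rw [bracketVal_mul]
      rcases Nat.lt_or_ge s x.length with h' | h'
      · rw [ihx h', commutatorElement_one_left]
      · rw [ihy (by omega), commutatorElement_one_right]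

variable {A : Type} [Group A] {K : Subgroup A}

/-- A subgroup that is bounded and open is a finite union of cosets of a finite intersection of
conjugates of `K`. -/
lemma exists_mem_iff_of_isOpenRel {M : Subgroup A} (hn : M.Normal) (hb : CosetFinite K (M : Set A))
    (ho : IsOpenRel K M) : ∃ S T : Set A, S.Finite ∧ T.Finite ∧ 1 ∈ S ∧
      ∀ g, g ∈ M ↔ ∃ t ∈ T, ∀ s ∈ S, s⁻¹ * (t⁻¹ * g) * s ∈ K := by
  obtain ⟨S₀, hS₀, hM⟩ := ho
  let S := insert 1 S₀
  have hS : S.Finite := hS₀.insert 1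
  obtain ⟨F, hF, hFM⟩ := hb
  let R : A → S → A ⧸ K := fun g s => ((g * s.1 : A) : A ⧸ K)
  have := hS.to_subtype
  have hfin : (R '' (M : Set A)).Finite := by
    have : (Set.pi Set.univ fun s : S => (fun f : A => ((s.1 * f : A) : A ⧸ K)) '' F).Finite :=
      Set.Finite.pi fun s => hF.image _
    refine this.subset ?_
    rintro _ ⟨g, hg, rfl⟩ s _
    obtain ⟨f, hf, hfK⟩ := hFM (s.1⁻¹ * g * s.1) (by simpa using hn.conj_mem g hg s.1⁻¹)
    refine ⟨f, hf, QuotientGroup.eq.2 ?_⟩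
    convert hfK using 1
    group
  obtain ⟨T, hTM, hinj, himg⟩ := (Set.surjOn_image R (M : Set A)).exists_subset_injOn_image_eq
  have hT : T.Finite := Set.Finite.of_finite_image (himg ▸ hfin) hinj
  refine ⟨S, T, hS, hT, Set.mem_insert _ _, fun g => ⟨fun hg => ?_, ?_⟩⟩
  · have : R g ∈ R '' T := by rw [himg]; exact ⟨g, hg, rfl⟩
    obtain ⟨t, ht, htg⟩ := this
    refine ⟨t, ht, fun s hs => ?_⟩
    have := QuotientGroup.eq.1 (congrFun htg ⟨s, hs⟩)
    convert this using 1
    group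
  · rintro ⟨t, ht, h⟩
    have := M.mul_mem (hTM ht) (hM (t⁻¹ * g) fun s hs => h s (Set.mem_insert_of_mem _ hs))
    simpa using this

lemma exists_mem_genBall {β Γ : Type} [Group Γ] {f : β → Γ} {ι : β → β}
    (hι : ∀ b, f (ι b) = (f b)⁻¹) {g : Γ} (hg : g ∈ Subgroup.closure (Set.range f)) :
    ∃ n, g ∈ genBall f n := by
  induction hg using Subgroup.closure_induction with
  | mem x hx =>
    obtain ⟨b, rfl⟩ := hx
    exact ⟨1, [b], by simp, by simp⟩
  | one => exact ⟨0, [], by simp, rfl⟩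
  | mul x y _ _ hx hy =>
    obtain ⟨m, hm⟩ := hx
    obtain ⟨n, hn⟩ := hy
    exact ⟨_, genBall_mul hm hn⟩
  | inv x _ hx => exact hx.imp fun n hn => genBall_inv hι hn

/-- A finite description of the large scale structure of a pair of polynomial growth: a bounded
normal subgroup modulo which the group is virtually nilpotent. -/
theorem exists_certificate {E : Set A} {c d : ℕ} (hE : IsGenSet K E) (hg : HasGrowth K E c d) :
    ∃ (M : Subgroup A) (S T : Set A) (β : Type) (_ : Finite β) (ι : β → β) (f : β → A) (F : Set A)
      (s n : ℕ), M.Normal ∧ S.Finite ∧ T.Finite ∧ 1 ∈ S ∧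
      (∀ g, g ∈ M ↔ ∃ t ∈ T, ∀ s ∈ S, s⁻¹ * (t⁻¹ * g) * s ∈ K) ∧
      (∀ b, f (ι b) * f b ∈ M) ∧ 1 ≤ s ∧ (∀ x, s < x.length → bracketVal f x ∈ M) ∧
      F.Finite ∧ 1 ∈ F ∧
      ∀ e ∈ E, ∀ a ∈ F, ∃ a' ∈ F, ∃ g ∈ genBall f n, ∃ m ∈ M, e * a = a' * g * m := by
  have hP : PolyGrowth K d := ⟨E, c, hE, hg⟩
  obtain ⟨M, hn, hb, ho⟩ := hP.exists_normal
  obtain ⟨S, T, hS, hT, h1S, hmem⟩ := exists_mem_iff_of_isOpenRel hn hb ho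
  have hKfin := hP.finite_image_quotient M ho
  have hQ := hP.map (QuotientGroup.mk' M) (QuotientGroup.mk'_surjective M) hKfin
  obtain ⟨H, hH, hnil⟩ := hQ.vnil.exists_nilpotent
  have := hQ.fg
  have hHfg : Group.FG H := inferInstance
  obtain ⟨Y₀, hY₀, hY₀fin⟩ := Group.fg_iff.1 hHfg
  let Y : Set H := Y₀ ∪ Y₀⁻¹
  have hYfin : Y.Finite := hY₀fin.union hY₀fin.inv
  have hY : Subgroup.closure Y = ⊤ :=
    top_unique (hY₀ ▸ Subgroup.closure_mono Set.subset_union_left)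
  have hYinv : ∀ y ∈ Y, y⁻¹ ∈ Y := by
    rintro y (hy | hy)
    · exact Or.inr (by simpa using hy)
    · exact Or.inl hy
  let ι : Y → Y := fun y => ⟨y.1⁻¹, hYinv y.1 y.2⟩
  let f : Y → A := fun y => (y.1.1 : A ⧸ M).out
  have hf : ∀ y, ((f y : A) : A ⧸ M) = y.1.1 := fun y => QuotientGroup.out_eq' _
  have hfc : (QuotientGroup.mk' M : A → A ⧸ M) ∘ f = H.subtype ∘ Subtype.val := by
    funext y; exact hf y
  have hι : ∀ y : Y, (Subtype.val (ι y) : H) = (y.1)⁻¹ := fun y => rfl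
  have hrange : Set.range (Subtype.val : Y → H) = Y := Subtype.range_coe
  let F : Set A := insert 1 (Set.range fun q : (A ⧸ M) ⧸ H => (q.out : A ⧸ M).out)
  have hF : F.Finite := (Set.finite_range _).insert 1
  have hEfin : ((QuotientGroup.mk' M) '' E).Finite := by
    have h1 := hg.finite hE 1
    rw [pow_one] at h1
    refine CosetFinite.image ⟨Quotient.out '' _, h1.image _, fun x hx => ?_⟩ _ hKfin
    exact ⟨_, ⟨_, ⟨x, hx, rfl⟩, rfl⟩, QuotientGroup.eq.1 (QuotientGroup.out_eq' _)⟩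
  have hdec : ∀ q : A ⧸ M, ∃ n : ℕ, ∃ a ∈ F, ∃ g ∈ genBall f n, q = ((a * g : A) : A ⧸ M) := by
    intro q
    let p : (A ⧸ M) ⧸ H := (q : (A ⧸ M) ⧸ H)
    have hp : (p.out)⁻¹ * q ∈ H := QuotientGroup.eq.1 (QuotientGroup.out_eq' _)
    obtain ⟨n, l, hl, hl'⟩ := exists_mem_genBall (f := (Subtype.val : Y → H)) (ι := ι) hι
      (g := ⟨_, hp⟩) (by rw [hrange, hY]; trivial)
    refine ⟨n, _, Set.mem_insert_of_mem _ ⟨p, rfl⟩, (l.map f).prod, ⟨l, hl, rfl⟩, ?_⟩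
    have h1 : (((l.map f).prod : A) : A ⧸ M) = (p.out)⁻¹ * q := by
      have h2 := congrArg H.subtype hl'
      change QuotientGroup.mk' M (l.map f).prod = _
      rw [map_list_prod, List.map_map, hfc, ← List.map_map, ← map_list_prod, h2]
      rfl
    rw [QuotientGroup.mk_mul, h1, QuotientGroup.out_eq']
    group
  choose N hN using hdec
  have hfin2 := hEfin.mul (hF.image (QuotientGroup.mk' M))
  obtain ⟨n, hn'⟩ := (hfin2.image N).bddAbove
  refine ⟨M, S, T, Y, hYfin.to_subtype, ι, f, F, 2 ^ (Group.nilpotencyClass H), n, hn, hS, hT, h1S,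
    hmem, fun b => ?_, Nat.one_le_two_pow, fun x hx => ?_, hF, Set.mem_insert _ _,
    fun e he a ha => ?_⟩
  · rw [← QuotientGroup.eq_one_iff, QuotientGroup.mk_mul, hf, hf, hι]
    simp
  · rw [← QuotientGroup.eq_one_iff]
    change QuotientGroup.mk' M _ = 1
    rw [bracketVal_map, hfc, ← bracketVal_map]
    have := bracketVal_mem_lowerCentralSeries (Subtype.val : Y → H) _ x hx
    rw [Subgroup.lowerCentralSeries_nilpotencyClass, Subgroup.mem_bot] at this
    rw [this, map_one]
  · have hq : QuotientGroup.mk' M (e * a) ∈ QuotientGroup.mk' M '' E * QuotientGroup.mk' M '' F := by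
      rw [map_mul]
      exact Set.mul_mem_mul ⟨e, he, rfl⟩ ⟨a, ha, rfl⟩
    obtain ⟨a', ha', g, hg, heq⟩ := hN (QuotientGroup.mk' M (e * a))
    refine ⟨a', ha', g, genBall_mono (hn' ⟨_, hq, rfl⟩) hg, (a' * g)⁻¹ * (e * a), ?_, by group⟩
    exact QuotientGroup.eq.1 heq.symm

end Certificate

end TransitiveGrowth

namespace TransitiveGrowth
open scoped Classical commutatorElement Pointwise

section CoverCount

variable {A : Type} [Group A] {K : Subgroup A} {E : Set A}

lemma genBall_map {β Γ Γ' : Type} [Group Γ] [Group Γ'] (φ : Γ →* Γ') {f : β → Γ} {n : ℕ} {g : Γ}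
    (hg : g ∈ genBall f n) : φ g ∈ genBall (φ ∘ f) n := by
  obtain ⟨l, hl, rfl⟩ := hg
  exact ⟨l, hl, by rw [map_list_prod, List.map_map]⟩

lemma exists_of_mem_genBall_comp {β Γ Γ' : Type} [Group Γ] [Group Γ'] (φ : Γ →* Γ') {f : β → Γ}
    {n : ℕ} {g : Γ'} (hg : g ∈ genBall (φ ∘ f) n) : ∃ h ∈ genBall f n, φ h = g := by
  obtain ⟨l, hl, rfl⟩ := hg
  exact ⟨_, ⟨l, hl, rfl⟩, by rw [map_list_prod, List.map_map]⟩

lemma genBall_subset_pow {β : Type} {f : β → A} (hE : IsGenSet K E) {m n : ℕ}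
    (hf : ∀ b, f b ∈ E ^ m) {g : A} (hg : g ∈ genBall f n) : g ∈ E ^ (m * n) := by
  obtain ⟨l, hl, rfl⟩ := hg
  refine hE.pow_mono (Nat.mul_le_mul_left m hl) ?_
  clear hl
  induction l with
  | nil => exact hE.one_mem_pow _
  | cons b l ih =>
    rw [List.map_cons, List.prod_cons, List.length_cons, mul_add, mul_one, add_comm]
    exact mul_mem_pow_add (hf b) ih

lemma cosetCard_le_card_mul {B B' : Set A} (Z : Finset A)
    (h : ∀ b ∈ B, ∃ z ∈ Z, ∃ b' ∈ B', b = z * b') :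
    cosetCard K B ≤ Z.card * cosetCard K B' := by
  have hsub : (QuotientGroup.mk : A → A ⧸ K) '' B ⊆
      ⋃ z ∈ Z, (fun q : A ⧸ K => z • q) '' ((QuotientGroup.mk : A → A ⧸ K) '' B') := by
    rintro _ ⟨b, hb, rfl⟩
    obtain ⟨z, hz, b', hb', rfl⟩ := h b hb
    exact Set.mem_biUnion hz ⟨_, ⟨b', hb', rfl⟩, rfl⟩
  refine (Set.encard_le_encard hsub).trans ((Finset.set_encard_biUnion_le Z _).trans ?_)
  refine (Finset.sum_le_card_nsmul Z _ (cosetCard K B') fun z _ => Set.encard_image_le _ _).trans ?_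
  rw [nsmul_eq_mul]

lemma IsGenSet.normal (hE : IsGenSet K E) (N : Subgroup A)
    (h : ∀ e ∈ E, ∀ a ∈ N, e * a * e⁻¹ ∈ N) : N.Normal := by
  have key : ∀ n : ℕ, ∀ g ∈ E ^ n, ∀ a ∈ N, g * a * g⁻¹ ∈ N := by
    intro n
    induction n with
    | zero =>
      intro g hg a ha
      have : g = 1 := by simpa using hg
      simpa [this] using ha
    | succ n ih =>
      intro g hg a ha
      rw [pow_succ] at hg
      obtain ⟨x, hx, y, hy, rfl⟩ := hg
      have := ih x hx _ (h y hy a ha)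
      convert this using 1
      group
  refine ⟨fun a ha g => ?_⟩
  obtain ⟨n, -, hn⟩ := hE.exists_mem_pow g
  exact key n g hn a ha

/-- Covering of large balls by smaller ones, from the covering property of a nilpotent quotient. -/
lemma cosetCard_le_of_cover (hE : IsGenSet K E) (N : Subgroup A) [N.Normal] {β : Type} {f : β → A}
    (F : Finset A) {n n₁ n₂ C D L r : ℕ} (hr : 1 ≤ r) (h1 : 1 ∈ F)
    (hstep : ∀ e ∈ E, ∀ a ∈ F, ∃ a' ∈ F, ∃ g ∈ genBall f n, ∃ m ∈ N, e * a = a' * g * m)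
    (hN : ∀ m ∈ N, m ∈ E ^ n₁) (hf : ∀ b, f b ∈ E ^ n₂) (Z : Finset (A ⧸ N)) (hZ : Z.card ≤ L)
    (hcov : ∀ g ∈ genBall ((QuotientGroup.mk' N) ∘ f) (n * C * r), ∃ z ∈ Z,
      ∃ h ∈ genBall ((QuotientGroup.mk' N) ∘ f) (D * r), g = z * h) :
    cosetCard K (E ^ (C * r)) ≤ (F.card * L : ℕ) * cosetCard K (E ^ ((n₂ * D + n₁) * r)) := by
  have key : ∀ R : ℕ, ∀ g ∈ E ^ R, ∃ a ∈ F, ∃ w ∈ genBall f (n * R), ∃ m ∈ N, g = a * w * m := by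
    intro R
    induction R with
    | zero =>
      intro g hg
      have : g = 1 := by simpa using hg
      exact ⟨1, h1, 1, ⟨[], by simp, rfl⟩, 1, N.one_mem, by simp [this]⟩
    | succ R ih =>
      intro g hg
      rw [pow_succ'] at hg
      obtain ⟨e, he, g', hg', rfl⟩ := hg
      obtain ⟨a, ha, w, hw, m, hm, rfl⟩ := ih g' hg'
      obtain ⟨a', ha', w', hw', m', hm', heq⟩ := hstep e he a ha
      refine ⟨a', ha', w' * w, ?_, w⁻¹ * m' * w * m, N.mul_mem ?_ hm, ?_⟩
      · rw [mul_add, mul_one, add_comm]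
        exact genBall_mul hw' hw
      · simpa using ‹N.Normal›.conj_mem m' hm' w⁻¹
      · change e * (a * w * m) = _
        rw [← mul_assoc, ← mul_assoc, heq]
        group
  refine (cosetCard_le_card_mul (B' := E ^ ((n₂ * D + n₁) * r)) ((F ×ˢ Z).image fun p => p.1 * p.2.out) ?_).trans ?_
  · intro g hg
    obtain ⟨a, ha, w, hw, m, hm, rfl⟩ := key _ g hg
    obtain ⟨z, hz, h, hh, heq⟩ := hcov _ (genBall_map (QuotientGroup.mk' N) (by rwa [← mul_assoc] at hw))
    obtain ⟨w', hw', rfl⟩ := exists_of_mem_genBall_comp _ hh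
    refine ⟨_, Finset.mem_image_of_mem _ (Finset.mk_mem_product ha hz),
      z.out⁻¹ * w * m, ?_, by group⟩
    have hm' : (z.out * w')⁻¹ * w ∈ N := by
      refine QuotientGroup.eq.1 ?_
      rw [QuotientGroup.mk_mul, QuotientGroup.out_eq']
      exact heq.symm
    have h2 := mul_mem_pow_add (genBall_subset_pow hE hf hw') (hN _ (N.mul_mem hm' hm))
    have h3 : n₂ * (D * r) + n₁ ≤ (n₂ * D + n₁) * r := by
      rw [add_mul, mul_assoc]
      have := Nat.le_mul_of_pos_right n₁ hr
      omega
    convert hE.pow_mono h3 h2 using 1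
    group
  · gcongr
    refine Finset.card_image_le.trans ?_
    rw [Finset.card_product]
    gcongr

end CoverCount

end TransitiveGrowth

namespace TransitiveGrowth
open scoped Classical Pointwise

section Ultra

variable {A : ℕ → Type} [∀ i, Group (A i)] {K : ∀ i, Subgroup (A i)} {E : ∀ i, Set (A i)}

/-- Sequences of group elements that are bounded with respect to the generating sets `E i`. -/
def boundedSeq (ω : Ultrafilter ℕ) (hE : ∀ i, IsGenSet (K i) (E i)) : Subgroup (∀ i, A i) where
  carrier := {g | ∃ n : ℕ, ∀ᶠ i in (ω : Filter ℕ), g i ∈ E i ^ n}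
  one_mem' := ⟨0, by simp⟩
  mul_mem' := by
    rintro a b ⟨m, hm⟩ ⟨n, hn⟩
    refine ⟨m + n, ?_⟩
    filter_upwards [hm, hn] with i h1 h2
    exact mul_mem_pow_add h1 h2
  inv_mem' := by
    rintro a ⟨m, hm⟩
    refine ⟨m, ?_⟩
    filter_upwards [hm] with i h
    exact (hE i).inv_mem_pow h

variable (ω : Ultrafilter ℕ) (hE : ∀ i, IsGenSet (K i) (E i))

/-- Evaluation of a bounded sequence. -/
def seqEval (i : ℕ) : boundedSeq ω hE →* A i := (Pi.evalMonoidHom A i).comp (boundedSeq ω hE).subtype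

/-- Bounded sequences that lie in `K` almost everywhere. -/
def ultraStab : Subgroup (boundedSeq ω hE) where
  carrier := {g | ∀ᶠ i in (ω : Filter ℕ), seqEval ω hE i g ∈ K i}
  one_mem' := by simp
  mul_mem' := by
    intro a b ha hb
    filter_upwards [ha, hb] with i h1 h2
    rw [map_mul]
    exact (K i).mul_mem h1 h2
  inv_mem' := by
    intro a ha
    filter_upwards [ha] with i h
    rw [map_inv]
    exact (K i).inv_mem h

/-- Bounded sequences that lie in `E` almost everywhere. -/
def ultraGen : Set (boundedSeq ω hE) := {g | ∀ᶠ i in (ω : Filter ℕ), seqEval ω hE i g ∈ E i}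

lemma mem_ultraStab {g : boundedSeq ω hE} :
    g ∈ ultraStab ω hE ↔ ∀ᶠ i in (ω : Filter ℕ), seqEval ω hE i g ∈ K i := Iff.rfl

lemma exists_boundedSeq {n : ℕ} {P : ∀ i, A i → Prop}
    (h : ∀ᶠ i in (ω : Filter ℕ), ∃ a ∈ E i ^ n, P i a) :
    ∃ g : boundedSeq ω hE, ∀ᶠ i in (ω : Filter ℕ),
      seqEval ω hE i g ∈ E i ^ n ∧ P i (seqEval ω hE i g) := by
  let g : ∀ i, A i := fun i => if h : ∃ a ∈ E i ^ n, P i a then h.choose else 1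
  have hg : ∀ᶠ i in (ω : Filter ℕ), g i ∈ E i ^ n ∧ P i (g i) := by
    filter_upwards [h] with i hi
    simp only [g, dif_pos hi]
    exact hi.choose_spec
  exact ⟨⟨g, n, hg.mono fun i h => h.1⟩, hg⟩

lemma mem_ultraGen_pow {n : ℕ} (g : boundedSeq ω hE) :
    g ∈ ultraGen ω hE ^ (n + 1) ↔ ∀ᶠ i in (ω : Filter ℕ), seqEval ω hE i g ∈ E i ^ (n + 1) := by
  induction n generalizing g with
  | zero => simp only [zero_add, pow_one]; rfl
  | succ n ih =>
    constructor
    · intro hg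
      rw [pow_succ] at hg
      obtain ⟨x, hx, y, hy, rfl⟩ := hg
      filter_upwards [(ih x).1 hx, hy] with i h1 h2
      rw [pow_succ]
      exact ⟨_, h1, _, h2, (map_mul _ _ _).symm⟩
    · intro hg
      obtain ⟨e, he⟩ := exists_boundedSeq ω hE (n := 1)
        (P := fun i a => seqEval ω hE i g * a⁻¹ ∈ E i ^ (n + 1)) (by
          filter_upwards [hg] with i hi
          rw [pow_succ] at hi
          obtain ⟨x, hx, y, hy, hxy⟩ := hi
          refine ⟨y, by simpa using hy, ?_⟩
          rw [← hxy]
          simpa using hx)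
      rw [pow_succ]
      refine ⟨g * e⁻¹, (ih _).2 ?_, e, ?_, by group⟩
      · filter_upwards [he] with i hi
        rw [map_mul, map_inv]
        exact hi.2
      · filter_upwards [he] with i hi
        simpa using hi.1

lemma isGenSet_ultraGen : IsGenSet (ultraStab ω hE) (ultraGen ω hE) where
  one_mem := by
    refine Eventually.of_forall fun i => ?_
    rw [map_one]
    exact (hE i).one_mem
  inv_mem := fun g hg => by
    filter_upwards [hg] with i hi
    rw [map_inv]
    exact (hE i).inv_mem _ hi
  mul_mem := fun k hk g hg => by
    filter_upwards [hk, hg] with i h1 h2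
    rw [map_mul]
    exact (hE i).mul_mem _ h1 _ h2
  closure_eq := by
    refine top_unique fun g _ => ?_
    obtain ⟨n, hn⟩ := g.2
    have h1 : g ∈ ultraGen ω hE ^ (n + 1) := (mem_ultraGen_pow ω hE g).2 <| by
      filter_upwards [hn] with i hi
      exact (hE i).pow_mono (Nat.le_succ n) hi
    have h2 : ∀ m : ℕ, ultraGen ω hE ^ m ⊆ Subgroup.closure (ultraGen ω hE) := by
      intro m
      induction m with
      | zero => simp
      | succ m ih =>
        rw [pow_succ]
        rintro _ ⟨x, hx, y, hy, rfl⟩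
        exact Subgroup.mul_mem _ (ih hx) (Subgroup.subset_closure hy)
    exact h2 _ h1

lemma hasGrowth_ultraGen {c d : ℕ} (hg : ∀ i, HasGrowth (K i) (E i) c d) :
    HasGrowth (ultraStab ω hE) (ultraGen ω hE) c d := by
  intro r hr
  by_contra hlt
  rw [not_le] at hlt
  obtain ⟨t, ht, hcard⟩ := Set.exists_subset_encard_eq (Order.add_one_le_of_lt hlt)
  have htfin : t.Finite := Set.finite_of_encard_le_coe (k := c * r ^ d + 1) (by
    rw [hcard]; push_cast; rfl)
  have hch : ∀ q ∈ t, ∃ g ∈ ultraGen ω hE ^ r, (g : boundedSeq ω hE ⧸ ultraStab ω hE) = q := ht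
  choose! ρ hρ hρ' using hch
  obtain ⟨n, rfl⟩ : ∃ n, r = n + 1 := ⟨r - 1, by omega⟩
  have h1 : ∀ᶠ i in (ω : Filter ℕ), ∀ q ∈ t, seqEval ω hE i (ρ q) ∈ E i ^ (n + 1) :=
    (eventually_all_finite htfin).2 fun q hq => (mem_ultraGen_pow ω hE _).1 (hρ q hq)
  have h2 : ∀ᶠ i in (ω : Filter ℕ), ∀ q ∈ t, ∀ q' ∈ t, q ≠ q' →
      (seqEval ω hE i (ρ q))⁻¹ * seqEval ω hE i (ρ q') ∉ K i := by
    refine (eventually_all_finite htfin).2 fun q hq =>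
      (eventually_all_finite htfin).2 fun q' hq' => ?_
    by_cases hqq : q = q'
    · simp [hqq]
    · have : ¬ ∀ᶠ i in (ω : Filter ℕ), seqEval ω hE i ((ρ q)⁻¹ * ρ q') ∈ K i := by
        intro h
        apply hqq
        rw [← hρ' q hq, ← hρ' q' hq']
        exact QuotientGroup.eq.2 h
      rw [← Ultrafilter.eventually_not] at this
      filter_upwards [this] with i hi _
      rwa [map_mul, map_inv] at hi
  obtain ⟨i, h1, h2⟩ := (h1.and h2).exists
  have hinj : Set.InjOn (fun q => ((seqEval ω hE i (ρ q) : A i) : A i ⧸ K i)) t := by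
    intro q hq q' hq' h
    by_contra hne
    exact h2 q hq q' hq' hne (QuotientGroup.eq.1 h)
  have h3 : t.encard ≤ cosetCard (K i) (E i ^ (n + 1)) := by
    rw [← hinj.encard_image]
    refine Set.encard_le_encard ?_
    rintro _ ⟨q, hq, rfl⟩
    exact ⟨_, h1 q hq, rfl⟩
  have h4 := h3.trans (hg i (n + 1) hr)
  rw [hcard] at h4
  have h5 : c * (n + 1) ^ d + 1 ≤ c * (n + 1) ^ d := by exact_mod_cast h4
  omega

end Ultra

end TransitiveGrowth

namespace TransitiveGrowth
open scoped Classical commutatorElement Pointwise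

section Doubling

/-- Comparison of balls of comparable radii, for most terms of a sequence of pairs of uniformly
polynomial growth. -/
theorem eventually_cosetCard_le (ω : Ultrafilter ℕ) {A : ℕ → Type} [∀ i, Group (A i)]
    {K : ∀ i, Subgroup (A i)} {E : ∀ i, Set (A i)} (hE : ∀ i, IsGenSet (K i) (E i)) {c d : ℕ}
    (hg : ∀ i, HasGrowth (K i) (E i) c d) : ∃ D : ℕ, 1 ≤ D ∧ ∀ C : ℕ, ∃ Q : ℕ,
      ∀ᶠ i in (ω : Filter ℕ), ∀ r : ℕ, 1 ≤ r →
        cosetCard (K i) (E i ^ (C * r)) ≤ Q * cosetCard (K i) (E i ^ (D * r)) := by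
  have hE' := isGenSet_ultraGen ω hE
  obtain ⟨M, S, T, β, hβ, ι, f, F, s, n, hM, hS, hT, h1S, hmem, hι, hs, hbr, hF, h1F, hstep⟩ :=
    exists_certificate hE' (hasGrowth_ultraGen ω hE hg)
  let φ : ∀ i, boundedSeq ω hE →* A i := seqEval ω hE
  let Mi : ∀ i, Set (A i) := fun i =>
    {g | ∃ t ∈ T, ∀ σ ∈ S, (φ i σ)⁻¹ * ((φ i t)⁻¹ * g) * φ i σ ∈ K i}
  have hmemi : ∀ g, g ∈ M ↔ ∀ᶠ i in (ω : Filter ℕ), φ i g ∈ Mi i := by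
    intro g
    have h1 : ∀ t, (∀ σ ∈ S, σ⁻¹ * (t⁻¹ * g) * σ ∈ ultraStab ω hE) ↔
        ∀ᶠ i in (ω : Filter ℕ), ∀ σ ∈ S, (φ i σ)⁻¹ * ((φ i t)⁻¹ * φ i g) * φ i σ ∈ K i := by
      intro t
      rw [eventually_all_finite hS]
      refine forall₂_congr fun σ _ => ?_
      simp only [mem_ultraStab, map_mul, map_inv, φ]
    rw [hmem]
    constructor
    · rintro ⟨t, ht, h⟩
      filter_upwards [(h1 t).1 h] with i hi
      exact ⟨t, ht, hi⟩
    · intro h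
      by_contra hcon
      push Not at hcon
      have : ∀ᶠ i in (ω : Filter ℕ), ∀ t ∈ T,
          ¬ ∀ σ ∈ S, (φ i σ)⁻¹ * ((φ i t)⁻¹ * φ i g) * φ i σ ∈ K i := by
        refine (eventually_all_finite hT).2 fun t ht => ?_
        rw [Ultrafilter.eventually_not, ← h1]
        intro h'
        obtain ⟨σ, hσ, hn⟩ := hcon t ht
        exact hn (h' σ hσ)
      obtain ⟨i, ⟨t, ht, hi⟩, hi'⟩ := (h.and this).exists
      exact hi' t ht hi
  have hpow : ∀ {L : Set (boundedSeq ω hE)}, L.Finite → ∃ k : ℕ, ∀ᶠ i in (ω : Filter ℕ),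
      ∀ g ∈ L, φ i g ∈ E i ^ k := by
    intro L hL
    obtain ⟨k, hk, hLk⟩ := hE'.exists_subset_pow hL
    obtain ⟨k, rfl⟩ : ∃ j, k = j + 1 := ⟨k - 1, by omega⟩
    exact ⟨k + 1, (eventually_all_finite hL).2 fun g hg => (mem_ultraGen_pow ω hE g).1 (hLk hg)⟩
  obtain ⟨n₁, hn₁⟩ : ∃ n₁ : ℕ, ∀ᶠ i in (ω : Filter ℕ), ∀ m ∈ Mi i, m ∈ E i ^ n₁ := by
    obtain ⟨k, hk⟩ := hpow hT
    refine ⟨k + 1, ?_⟩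
    filter_upwards [hk] with i hi
    rintro m ⟨t, ht, hm⟩
    have h1 : (φ i t)⁻¹ * m ∈ K i := by simpa using hm 1 h1S
    have := mul_mem_pow_add (hi t ht) ((pow_one (E i)).symm ▸ (hE i).le_genSet h1)
    simpa using this
  obtain ⟨n₂, hn₂⟩ := hpow (Set.finite_range f)
  have hsub : ∀ᶠ i in (ω : Filter ℕ), ∀ e ∈ E i, ∀ a ∈ Mi i, ∀ b ∈ Mi i,
      e * (a * b⁻¹) * e⁻¹ ∈ Mi i := by
    by_contra hcon
    rw [← Ultrafilter.eventually_not] at hcon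
    push Not at hcon
    obtain ⟨e, he⟩ := exists_boundedSeq ω hE (n := 1)
      (P := fun i e => ∃ a ∈ Mi i, ∃ b ∈ Mi i, e * (a * b⁻¹) * e⁻¹ ∉ Mi i)
      (hcon.mono fun i ⟨e, he, h⟩ => ⟨e, by simpa using he, h⟩)
    obtain ⟨a, ha⟩ := exists_boundedSeq ω hE (n := n₁)
      (P := fun i a => a ∈ Mi i ∧ ∃ b ∈ Mi i, φ i e * (a * b⁻¹) * (φ i e)⁻¹ ∉ Mi i) (by
        filter_upwards [he, hn₁] with i hi hi'
        obtain ⟨-, a, ha, hb⟩ := hi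
        exact ⟨a, hi' a ha, ha, hb⟩)
    obtain ⟨b, hb⟩ := exists_boundedSeq ω hE (n := n₁)
      (P := fun i b => b ∈ Mi i ∧ φ i e * (φ i a * b⁻¹) * (φ i e)⁻¹ ∉ Mi i) (by
        filter_upwards [ha, hn₁] with i hi hi'
        obtain ⟨-, -, b, hb, h⟩ := hi
        exact ⟨b, hi' b hb, hb, h⟩)
    have haM : a ∈ M := (hmemi a).2 (ha.mono fun i h => h.2.1)
    have hbM : b ∈ M := (hmemi b).2 (hb.mono fun i h => h.2.1)
    have h := (hmemi _).1 (hM.conj_mem _ (M.mul_mem haM (M.inv_mem hbM)) e)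
    obtain ⟨i, hi, hi'⟩ := (h.and hb).exists
    refine hi'.2.2 ?_
    simpa using hi
  have hone : ∀ᶠ i in (ω : Filter ℕ), (1 : A i) ∈ Mi i := by
    filter_upwards [(hmemi 1).1 M.one_mem] with i hi
    simpa using hi
  have hιi : ∀ᶠ i in (ω : Filter ℕ), ∀ b, φ i (f (ι b)) * φ i (f b) ∈ Mi i := by
    refine eventually_all.2 fun b => ?_
    filter_upwards [(hmemi _).1 (hι b)] with i hi
    simpa using hi
  have hbri : ∀ᶠ i in (ω : Filter ℕ), ∀ x ∈ {x : FreeMagma β | x.length ≤ 2 * s}, s < x.length →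
      bracketVal (φ i ∘ f) x ∈ Mi i := by
    refine (eventually_all_finite (finite_length_le _)).2 fun x _ => ?_
    by_cases hx : s < x.length
    · filter_upwards [(hmemi _).1 (hbr x hx)] with i hi _
      rwa [bracketVal_map] at hi
    · exact Eventually.of_forall fun i h => absurd h hx
  have hstepi : ∀ᶠ i in (ω : Filter ℕ), ∀ a ∈ F, ∀ e ∈ E i, ∃ a' ∈ F, ∃ g ∈ genBall (φ i ∘ f) n,
      ∃ m ∈ Mi i, e * φ i a = φ i a' * g * m := by
    refine (eventually_all_finite hF).2 fun a ha => ?_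
    by_contra hcon
    rw [← Ultrafilter.eventually_not] at hcon
    obtain ⟨e, he⟩ := exists_boundedSeq ω hE (n := 1)
      (P := fun i e => ¬ ∃ a' ∈ F, ∃ g ∈ genBall (φ i ∘ f) n, ∃ m ∈ Mi i,
        e * φ i a = φ i a' * g * m)
      (hcon.mono fun i h => by
        simp only [not_forall] at h
        obtain ⟨e, he, h⟩ := h
        exact ⟨e, by simpa using he, h⟩)
    obtain ⟨a', ha', g, hg', m, hm, heq⟩ := hstep e (he.mono fun i h => by simpa using h.1) a ha
    obtain ⟨i, hi, hi'⟩ := (he.and ((hmemi m).1 hm)).exists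
    refine hi.2 ⟨a', ha', φ i g, genBall_map (φ i) hg', φ i m, hi', ?_⟩
    have := congrArg (φ i) heq
    simpa only [map_mul] using this
  obtain ⟨D, hD⟩ := exists_cover ι s
  refine ⟨n₂ * D + n₁ + 1, Nat.le_add_left _ _, fun C => ?_⟩
  obtain ⟨L, hL⟩ := hD (n * C)
  refine ⟨hF.toFinset.card * L, ?_⟩
  filter_upwards [hn₁, hn₂, hsub, hone, hιi, hbri, hstepi] with i k₁ k₂ ksub kone kι kbr kstep r hr
  let N : Subgroup (A i) :=
    { carrier := Mi i
      one_mem' := kone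
      mul_mem' := by
        intro a b ha hb
        have h1 := ksub 1 (hE i).one_mem 1 kone b hb
        have h2 := ksub 1 (hE i).one_mem a ha _ h1
        simpa using h2
      inv_mem' := by
        intro b hb
        have h1 := ksub 1 (hE i).one_mem 1 kone b hb
        simpa using h1 }
  have hN : N.Normal := (hE i).normal N fun e he a ha => by
    have := ksub e he a ha 1 kone
    change e * a * e⁻¹ ∈ Mi i
    simpa using this
  obtain ⟨Z, hZ, hcov⟩ := hL (A i ⧸ N) (QuotientGroup.mk' N ∘ (φ i ∘ f)) (fun b => by
      rw [eq_inv_iff_mul_eq_one]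
      exact (QuotientGroup.eq_one_iff _).2 (kι b)) (fun x hx => by
      refine bracketVal_eq_one_of_forall _ s (fun x h1 h2 => ?_) x hs hx
      rw [← bracketVal_map]
      exact (QuotientGroup.eq_one_iff _).2 (kbr x h2 h1)) r hr
  have hfin := cosetCard_le_of_cover (hE i) N (f := φ i ∘ f) (hF.toFinset.image (φ i)) (C := C)
    (n := n) (n₁ := n₁) (n₂ := n₂) (D := D) hr
    (Finset.mem_image.2 ⟨1, by simpa using h1F, map_one _⟩) (by
      intro e he a ha
      obtain ⟨a₀, ha₀, rfl⟩ := Finset.mem_image.1 ha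
      obtain ⟨a', ha', g, hg', m, hm, heq⟩ := kstep a₀ (hF.mem_toFinset.1 ha₀) e he
      exact ⟨_, Finset.mem_image_of_mem _ (by simpa using ha'), g, hg', m, hm, heq⟩)
    k₁ (fun b => k₂ _ ⟨b, rfl⟩) Z hZ hcov
  refine hfin.trans ?_
  gcongr
  · exact Finset.card_image_le
  · refine cosetCard_mono ((hE i).pow_mono ?_)
    exact Nat.mul_le_mul_right r (by omega)

/-- Pairs of polynomial growth are uniformly doubling. -/
theorem exists_doubling (c d : ℕ) : ∃ Q : ℕ, ∀ (A : Type) [Group A] (K : Subgroup A) (E : Set A),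
    IsGenSet K E → HasGrowth K E c d → ∀ r : ℕ, 1 ≤ r →
      cosetCard K (E ^ (2 * r)) ≤ Q * cosetCard K (E ^ r) := by
  by_contra hcon
  push Not at hcon
  choose A inst K E hE hg r hr hlt using hcon
  obtain ⟨D, hD1, hD⟩ := eventually_cosetCard_le (hyperfilter ℕ) hE hg
  obtain ⟨Q, hQ⟩ := hD (4 * D)
  have hlarge : ∀ᶠ i in (hyperfilter ℕ : Filter ℕ), max Q (c * (2 * D) ^ d) ≤ i :=
    Nat.hyperfilter_le_atTop (eventually_ge_atTop _)
  obtain ⟨i, hi, hQi⟩ := (hlarge.and hQ).exists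
  refine absurd (hlt i) (not_lt.2 ?_)
  have hEi := hE i
  rcases Nat.lt_or_ge (r i) D with h | h
  · have h1 : cosetCard (K i) (E i ^ (2 * r i)) ≤ (c * (2 * D) ^ d : ℕ) :=
      (cosetCard_mono (hEi.pow_mono (by omega))).trans (hg i (2 * D) (by omega))
    have h2 : 1 ≤ cosetCard (K i) (E i ^ r i) := by
      rw [cosetCard, Set.one_le_encard_iff_nonempty]
      exact ⟨_, 1, hEi.one_mem_pow _, rfl⟩
    calc _ ≤ ((c * (2 * D) ^ d : ℕ) : ℕ∞) := h1
      _ ≤ (i : ℕ∞) := by exact_mod_cast (le_max_right _ _).trans hi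
      _ ≤ (i : ℕ∞) * cosetCard (K i) (E i ^ r i) := le_mul_of_one_le_right' h2
  · have hq : 1 ≤ r i / D := Nat.div_pos h hD1
    have h1 : D * (r i / D) ≤ r i := Nat.mul_div_le _ _
    have h2 : r i < D * (r i / D) + D := by
      have := Nat.div_add_mod (r i) D
      have := Nat.mod_lt (r i) hD1
      omega
    have h3 : D ≤ D * (r i / D) := Nat.le_mul_of_pos_right D hq
    calc _ ≤ cosetCard (K i) (E i ^ (4 * D * (r i / D))) :=
          cosetCard_mono (hEi.pow_mono (by rw [mul_assoc]; omega))
      _ ≤ Q * cosetCard (K i) (E i ^ (D * (r i / D))) := hQi _ hq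
      _ ≤ (i : ℕ∞) * cosetCard (K i) (E i ^ r i) := by
          gcongr
          · exact_mod_cast (le_max_left _ _).trans hi
          · exact cosetCard_mono (hEi.pow_mono h1)

end Doubling

end TransitiveGrowth

namespace TransitiveGrowth

open scoped Pointwise

section Link

variable {V : Type} {G : SimpleGraph V}

lemma dist_map_le (hG : G.Connected) (φ : G ≃g G) (x y : V) : G.dist (φ x) (φ y) ≤ G.dist x y := by
  obtain ⟨p, hp⟩ := hG.exists_walk_length_eq_dist x y
  have := SimpleGraph.dist_le (p.map φ.toHom)
  rw [SimpleGraph.Walk.length_map, hp] at this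
  exact this

lemma dist_map (hG : G.Connected) (φ : G ≃g G) (x y : V) : G.dist (φ x) (φ y) = G.dist x y := by
  refine le_antisymm (dist_map_le hG φ x y) ?_
  simpa using dist_map_le hG φ.symm (φ x) (φ y)

/-- The stabilizer of a vertex in the automorphism group. -/
def vertexStab (G : SimpleGraph V) (o : V) : Subgroup (G ≃g G) where
  carrier := {φ | φ o = o}
  one_mem' := rfl
  mul_mem' := by
    intro φ ψ hφ hψ
    change φ (ψ o) = o
    rw [show ψ o = o from hψ]
    exact hφ
  inv_mem' := by
    intro φ hφ
    change φ.symm o = o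
    rw [RelIso.symm_apply_eq]
    exact (show φ o = o from hφ).symm

/-- The automorphisms moving a vertex to distance at most `1`. -/
def vertexGen (G : SimpleGraph V) (o : V) : Set (G ≃g G) := {φ | G.dist o (φ o) ≤ 1}

variable (hG : G.Connected) (hT : IsVertexTransitive G) (o : V)
include hG

lemma dist_mul_le (φ ψ : G ≃g G) :
    G.dist o ((φ * ψ) o) ≤ G.dist o (φ o) + G.dist o (ψ o) := by
  refine (hG.dist_triangle (v := φ o)).trans ?_
  rw [show (φ * ψ) o = φ (ψ o) from rfl, dist_map hG]

include hT

lemma mem_vertexGen_pow (r : ℕ) (φ : G ≃g G) (hr : 1 ≤ r) :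
    φ ∈ vertexGen G o ^ r ↔ G.dist o (φ o) ≤ r := by
  induction r, hr using Nat.le_induction generalizing φ with
  | base => simp [vertexGen]
  | succ r hr ih =>
    rw [pow_succ', Set.mem_mul]
    constructor
    · rintro ⟨e, he, ψ, hψ, rfl⟩
      have h1 : G.dist o (e o) ≤ 1 := he
      have h2 := (ih ψ).1 hψ
      have := dist_mul_le hG o e ψ
      omega
    · intro h
      have key : ∃ x : V, G.dist o x ≤ 1 ∧ G.dist x (φ o) ≤ r := by
        obtain ⟨p, hp⟩ := hG.exists_walk_length_eq_dist o (φ o)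
        generalize φ o = y at p hp h ⊢
        cases p with
        | nil => exact ⟨o, by simp, by rw [← hp]; simp⟩
        | cons hadj q =>
          refine ⟨_, (SimpleGraph.dist_eq_one_iff_adj.2 hadj).le, (SimpleGraph.dist_le q).trans ?_⟩
          rw [SimpleGraph.Walk.length_cons] at hp
          omega
      obtain ⟨x, hx1, hx2⟩ := key
      obtain ⟨e, rfl⟩ := hT o x
      refine ⟨e, hx1, e⁻¹ * φ, (ih _).2 ?_, by group⟩
      rw [← dist_map hG e]
      simpa using hx2

lemma isGenSet_vertexGen : IsGenSet (vertexStab G o) (vertexGen G o) where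
  one_mem := by simp [vertexGen]
  inv_mem := by
    intro φ hφ
    change G.dist o (φ⁻¹ o) ≤ 1
    rw [← dist_map hG φ, SimpleGraph.dist_comm]
    simpa using show G.dist o (φ o) ≤ 1 from hφ
  mul_mem := by
    intro k hk φ hφ
    have h1 := dist_mul_le hG o k φ
    rw [show k o = o from hk, SimpleGraph.dist_self, zero_add] at h1
    exact h1.trans hφ
  closure_eq := by
    rw [eq_top_iff]
    intro φ _
    have h := (mem_vertexGen_pow hG hT o (G.dist o (φ o) + 1) φ (by omega)).2 (by omega)
    rw [← SetLike.mem_coe]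
    have hsub : ∀ n : ℕ, vertexGen G o ^ n ⊆ Subgroup.closure (vertexGen G o) := by
      intro n
      induction n with
      | zero => simp
      | succ n ih =>
        rw [pow_succ]
        rintro _ ⟨a, ha, b, hb, rfl⟩
        exact mul_mem (ih ha) (Subgroup.subset_closure hb)
    exact hsub _ h

lemma cosetCard_vertexGen_pow [Finite V] (r : ℕ) (hr : 1 ≤ r) :
    cosetCard (vertexStab G o) (vertexGen G o ^ r) = (ballCard G o r : ℕ∞) := by
  let F : (G ≃g G) ⧸ vertexStab G o → V := Quotient.lift (fun φ : G ≃g G => φ o) (by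
    intro φ ψ h
    have h' : (φ⁻¹ * ψ) o = o := QuotientGroup.leftRel_apply.1 h
    have := congrArg φ h'
    simpa using this.symm)
  have hF : ∀ φ : G ≃g G, F (QuotientGroup.mk φ) = φ o := fun _ => rfl
  have hinj : Function.Injective F := by
    intro a b
    induction a using QuotientGroup.induction_on with | H φ => ?_
    induction b using QuotientGroup.induction_on with | H ψ => ?_
    intro h
    rw [hF, hF] at h
    refine QuotientGroup.eq.2 ?_
    change (φ⁻¹ * ψ) o = o
    rw [show (φ⁻¹ * ψ) o = φ⁻¹ (ψ o) from rfl, ← h]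
    simp
  have himg : F '' ((QuotientGroup.mk : (G ≃g G) → _) '' (vertexGen G o ^ r)) =
      {y : V | (G.dist o y : ℝ) ≤ (r : ℝ)} := by
    ext y
    simp only [Set.mem_image, exists_exists_and_eq_and, hF, Set.mem_ofPred_eq, Nat.cast_le]
    constructor
    · rintro ⟨φ, hφ, rfl⟩
      exact (mem_vertexGen_pow hG hT o r φ hr).1 hφ
    · intro h
      obtain ⟨φ, rfl⟩ := hT o y
      exact ⟨φ, (mem_vertexGen_pow hG hT o r φ hr).2 h, rfl⟩
  rw [cosetCard, ← hinj.encard_image, himg, ballCard,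
    Nat.card_coe_set_eq, Set.Finite.cast_ncard_eq (Set.toFinite _)]

end Link

/-- Finite vertex-transitive graphs of polynomial growth are uniformly doubling. -/
theorem exists_ballCard_doubling (c d : ℝ) : ∃ Q : ℕ, ∀ (V : Type) [Finite V] (G : SimpleGraph V),
    G.Connected → IsVertexTransitive G →
    (∀ (o : V) (r : ℕ), 1 ≤ r → (ballCard G o r : ℝ) ≤ c * (r : ℝ) ^ d) →
    ∀ (o : V) (r : ℕ), 1 ≤ r → ballCard G o (2 * r : ℕ) ≤ Q * ballCard G o r := by
  obtain ⟨Q, hQ⟩ := exists_doubling ⌈c⌉₊ ⌈d⌉₊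
  refine ⟨Q, fun V _ G hG hT hgr o r hr => ?_⟩
  have h := hQ (G ≃g G) _ _ (isGenSet_vertexGen hG hT o) (fun r hr => ?_) r hr
  · rw [cosetCard_vertexGen_pow hG hT o _ (by omega), cosetCard_vertexGen_pow hG hT o _ hr] at h
    exact_mod_cast h
  · rw [cosetCard_vertexGen_pow hG hT o _ hr]
    have hr' : (1 : ℝ) ≤ r := by exact_mod_cast hr
    have : (ballCard G o r : ℝ) ≤ ((⌈c⌉₊ * r ^ ⌈d⌉₊ : ℕ) : ℝ) := by
      push_cast
      refine (hgr o r hr).trans ?_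
      rw [← Real.rpow_natCast]
      gcongr
      · exact Nat.le_ceil c
      · exact Nat.le_ceil d
    exact_mod_cast this

end TransitiveGrowth

namespace TransitiveGrowth

section Iteration

variable {u W : ℕ → ℝ} {A Q : ℕ} {c : ℝ}

/-- A Faber–Krahn type inequality at every scale forces decay along parabolic dyadic times. -/
lemma decay_of_scale_inequality (hA : 1 ≤ A) (hQ : 1 ≤ Q) (hu : Antitone u) (hu0 : ∀ s, 0 ≤ u s)
    (hu1 : u 0 ≤ 1) (hW : ∀ r, 0 < W r) (hWc : W 1 ≤ c) (hd : ∀ r, 1 ≤ r → W (2 * r) ≤ Q * W r)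
    (h : ∀ s r, 1 ≤ r → u s ≤ A * r ^ 2 * (u s - u (s + 1)) + 1 / W r) (k : ℕ) :
    u (4 * Q * A * (4 ^ k - 1)) ≤ (2 + c) / W (2 ^ k) := by
  have hQ' : (0 : ℝ) < Q := by exact_mod_cast hQ
  have hA' : (0 : ℝ) < A := by exact_mod_cast hA
  have hc : 0 < c := (hW 1).trans_le hWc
  have sum_le : ∀ s r T : ℕ, 1 ≤ r →
      T * u (s + T) ≤ A * r ^ 2 * (u s - u (s + T)) + T * (1 / W r) := by
    intro s r T hr
    induction T with
    | zero => simp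
    | succ T ih =>
      have h1 := h (s + T) r hr
      have h2 : u (s + (T + 1)) ≤ u (s + T) := hu (by omega)
      have h3 : (T : ℝ) * u (s + (T + 1)) ≤ T * u (s + T) := by gcongr
      push_cast
      rw [← add_assoc] at *
      nlinarith
  have step : ∀ s r : ℕ, 1 ≤ r → u (s + 2 * Q * A * r ^ 2) ≤ u s / (2 * Q) + 1 / W r := by
    intro s r hr
    have hr' : (0 : ℝ) < r := by exact_mod_cast hr
    have h1 := sum_le s r (2 * Q * A * r ^ 2) hr
    push_cast at h1
    have hB : (0 : ℝ) < A * r ^ 2 := by positivity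
    have h2 := hu0 (s + 2 * Q * A * r ^ 2)
    generalize u (s + 2 * Q * A * r ^ 2) = v at *
    have h3 : (A * r ^ 2 : ℝ) * (2 * Q * v) ≤ A * r ^ 2 * (u s + 2 * Q * (1 / W r)) := by nlinarith
    have h4 := le_of_mul_le_mul_left h3 hB
    have h5 : 2 * Q * v ≤ 2 * Q * (u s / (2 * Q) + 1 / W r) := by
      have : 2 * Q * (u s / (2 * Q) + 1 / W r) = u s + 2 * Q * (1 / W r) := by field_simp
      rwa [this]
    exact le_of_mul_le_mul_left h5 (by positivity)
  induction k with
  | zero =>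
    simp only [pow_zero, Nat.sub_self, mul_zero]
    refine hu1.trans ?_
    rw [le_div_iff₀ (hW 1)]
    linarith
  | succ k ih =>
    have hk : 1 ≤ 2 ^ k := Nat.one_le_two_pow
    have hp := hW (2 ^ k)
    have hp2 := hW (2 ^ (k + 1))
    have hdk := hd (2 ^ k) hk
    rw [← pow_succ'] at hdk
    have hle : 4 * Q * A * (4 ^ k - 1) + 2 * Q * A * (2 ^ (k + 1)) ^ 2 ≤
        4 * Q * A * (4 ^ (k + 1) - 1) := by
      have h4 : 1 ≤ 4 ^ k := Nat.one_le_pow _ _ (by norm_num)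
      have : (2 ^ (k + 1)) ^ 2 = 4 * 4 ^ k := by
        rw [← pow_mul, mul_comm, pow_mul, pow_succ']
        norm_num
      rw [this, pow_succ']
      obtain ⟨m, hm⟩ := Nat.exists_eq_add_of_le h4
      rw [hm, show 1 + m - 1 = m by omega, show 4 * (1 + m) - 1 = 4 * m + 3 by omega]
      nlinarith [Nat.zero_le (Q * A * m), Nat.zero_le (Q * A)]
    refine (hu hle).trans ((step _ (2 ^ (k + 1)) (Nat.one_le_two_pow)).trans ?_)
    have h1 : u (4 * Q * A * (4 ^ k - 1)) / (2 * Q) ≤ ((2 + c) / 2) / W (2 ^ (k + 1)) := by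
      rw [div_le_div_iff₀ (by positivity) hp2]
      have h2 : u (4 * Q * A * (4 ^ k - 1)) * W (2 ^ (k + 1)) ≤
          ((2 + c) / W (2 ^ k)) * (Q * W (2 ^ k)) := by
        gcongr
      have h3 : ((2 + c) / W (2 ^ k)) * (Q * W (2 ^ k)) = (2 + c) * Q := by field_simp
      linarith
    refine (add_le_add_left h1 _).trans ?_
    rw [← add_div]
    exact div_le_div_of_nonneg_right (by linarith) hp2.le

end Iteration

section Energy

variable {V : Type} [Fintype V] {G : SimpleGraph V} [DecidableRel G.Adj] {Δ : ℕ}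

/-- The Dirichlet energy, up to normalization. -/
def graphEnergy (G : SimpleGraph V) [DecidableRel G.Adj] (f : V → ℝ) : ℝ :=
  ∑ x, ∑ y ∈ G.neighborFinset x, (f x - f y) ^ 2

lemma graphEnergy_nonneg (f : V → ℝ) : 0 ≤ graphEnergy G f :=
  Finset.sum_nonneg fun _ _ => Finset.sum_nonneg fun _ _ => sq_nonneg _

lemma sum_sum_neighborFinset_comm (F : V → V → ℝ) :
    ∑ x, ∑ y ∈ G.neighborFinset x, F x y = ∑ x, ∑ y ∈ G.neighborFinset x, F y x := by
  refine Finset.sum_comm' fun x y => ?_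
  simp [G.adj_comm]

lemma sum_mul_sum_sub (f : V → ℝ) :
    2 * ∑ x, f x * ∑ y ∈ G.neighborFinset x, (f y - f x) = - graphEnergy G f := by
  have h1 : ∑ x, f x * ∑ y ∈ G.neighborFinset x, (f y - f x) =
      ∑ x, ∑ y ∈ G.neighborFinset x, f x * (f y - f x) := by simp_rw [Finset.mul_sum]
  have h2 := h1.trans (sum_sum_neighborFinset_comm _)
  rw [two_mul]
  nth_rw 1 [h1]
  rw [h2, graphEnergy, ← Finset.sum_add_distrib, ← Finset.sum_neg_distrib]
  refine Finset.sum_congr rfl fun x _ => ?_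
  rw [← Finset.sum_add_distrib, ← Finset.sum_neg_distrib]
  exact Finset.sum_congr rfl fun y _ => by ring

lemma sum_sq_sum_sub_le (hΔ : ∀ x, G.degree x = Δ) (f : V → ℝ) :
    ∑ x, (∑ y ∈ G.neighborFinset x, (f y - f x)) ^ 2 ≤ Δ * graphEnergy G f := by
  rw [graphEnergy, Finset.mul_sum]
  refine Finset.sum_le_sum fun x _ => ?_
  refine sq_sum_le_card_mul_sum_sq.trans_eq ?_
  rw [G.card_neighborFinset_eq_degree, hΔ]
  congr 1
  exact Finset.sum_congr rfl fun y _ => by ring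

/-- One lazy step decreases the `ℓ²` norm by a multiple of the energy. -/
lemma sum_sq_lazy_step_le (hΔ : ∀ x, G.degree x = Δ) (h0 : 1 ≤ Δ) (f g : V → ℝ)
    (hg : ∀ x, g x = f x + (2 * (Δ : ℝ))⁻¹ * ∑ y ∈ G.neighborFinset x, (f y - f x)) :
    graphEnergy G f ≤ 4 * Δ * (∑ x, f x ^ 2 - ∑ x, g x ^ 2) := by
  have h0' : (0 : ℝ) < Δ := by exact_mod_cast h0
  have key : ∑ x, g x ^ 2 = ∑ x, f x ^ 2 +
      (Δ : ℝ)⁻¹ * ∑ x, f x * ∑ y ∈ G.neighborFinset x, (f y - f x) +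
      (4 * (Δ : ℝ) ^ 2)⁻¹ * ∑ x, (∑ y ∈ G.neighborFinset x, (f y - f x)) ^ 2 := by
    rw [Finset.mul_sum, Finset.mul_sum, ← Finset.sum_add_distrib, ← Finset.sum_add_distrib]
    refine Finset.sum_congr rfl fun x _ => ?_
    rw [hg]
    field_simp
    ring
  have h1 := sum_mul_sum_sub (G := G) f
  have h2 := sum_sq_sum_sub_le hΔ f
  rw [key]
  generalize ∑ x, f x * ∑ y ∈ G.neighborFinset x, (f y - f x) = a at *
  generalize ∑ x, (∑ y ∈ G.neighborFinset x, (f y - f x)) ^ 2 = b at *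
  have h3 : 4 * (Δ : ℝ) * (∑ x, f x ^ 2 -
      (∑ x, f x ^ 2 + (Δ : ℝ)⁻¹ * a + (4 * (Δ : ℝ) ^ 2)⁻¹ * b)) = -4 * a - b / Δ := by
    field_simp
    ring
  rw [h3]
  have h4 : b / Δ ≤ graphEnergy G f := by rw [div_le_iff₀ h0']; linarith
  linarith

section Group

omit [DecidableRel G.Adj]

variable (hT : IsVertexTransitive G)
include hT

omit [Fintype V] in
lemma sum_aut_eq [Fintype (G ≃g G)] (h : V → ℝ) (x y : V) :
    ∑ γ : G ≃g G, h (γ x) = ∑ γ : G ≃g G, h (γ y) := by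
  obtain ⟨ψ, rfl⟩ := hT y x
  exact Fintype.sum_equiv (Equiv.mulRight ψ) _ _ fun γ => rfl

/-- Averaging over the automorphism group is averaging over the vertices. -/
lemma card_mul_sum_aut [Fintype (G ≃g G)] (h : V → ℝ) (x : V) :
    Fintype.card V * ∑ γ : G ≃g G, h (γ x) = Fintype.card (G ≃g G) * ∑ y, h y := by
  have h1 : ∑ y : V, ∑ γ : G ≃g G, h (γ y) = Fintype.card V * ∑ γ : G ≃g G, h (γ x) := by
    rw [Finset.sum_congr rfl fun y _ => sum_aut_eq hT h y x]
    simp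
  rw [← h1, Finset.sum_comm]
  have h2 : ∀ γ : G ≃g G, ∑ y, h (γ y) = ∑ y, h y := fun γ =>
    Fintype.sum_equiv γ.toEquiv _ _ fun _ => rfl
  simp [h2]

end Group

/-- The `ℓ²` distance over the automorphism group between the orbit maps of two vertices is
controlled by the graph distance and the energy. -/
lemma card_mul_sum_aut_sub_sq_le [Fintype (G ≃g G)] (hG : G.Connected) (hT : IsVertexTransitive G)
    (f : V → ℝ) (x y : V) :
    Fintype.card V * ∑ γ : G ≃g G, (f (γ x) - f (γ y)) ^ 2 ≤
      G.dist x y ^ 2 * (Fintype.card (G ≃g G) * graphEnergy G f) := by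
  have : Nonempty V := ⟨x⟩
  have hn : (0 : ℝ) < Fintype.card V := by exact_mod_cast Fintype.card_pos
  let v : V → EuclideanSpace ℝ (G ≃g G) := fun x => WithLp.toLp 2 fun γ => f (γ x)
  have hv : ∀ x y, ‖v x - v y‖ ^ 2 = ∑ γ : G ≃g G, (f (γ x) - f (γ y)) ^ 2 := by
    intro x y
    rw [EuclideanSpace.real_norm_sq_eq]
    rfl
  set M : ℝ := Fintype.card (G ≃g G) * graphEnergy G f / Fintype.card V with hM
  have hM0 : 0 ≤ M := by have := graphEnergy_nonneg (G := G) f; positivity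
  have hadj : ∀ x y, G.Adj x y → ‖v x - v y‖ ≤ Real.sqrt M := by
    intro x y hxy
    refine Real.le_sqrt_of_sq_le ?_
    rw [hv, hM, le_div_iff₀ hn, mul_comm, graphEnergy,
      ← card_mul_sum_aut hT (fun x => ∑ y ∈ G.neighborFinset x, (f x - f y) ^ 2) x]
    gcongr with γ
    exact Finset.single_le_sum (f := fun z => (f (γ x) - f z) ^ 2) (fun _ _ => sq_nonneg _)
      ((G.mem_neighborFinset _ _).2 (γ.map_adj_iff.2 hxy))
  have hwalk : ∀ {x y : V} (p : G.Walk x y), ‖v x - v y‖ ≤ p.length * Real.sqrt M := by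
    intro x y p
    induction p with
    | nil => simp
    | @cons a b c hab q ih =>
      have h1 := norm_sub_le_norm_sub_add_norm_sub (v a) (v b) (v c)
      have h2 := hadj a b hab
      rw [SimpleGraph.Walk.length_cons]
      push_cast
      linarith
  obtain ⟨p, hp⟩ := hG.exists_walk_length_eq_dist x y
  have h := hwalk p
  rw [hp] at h
  have h2 := pow_le_pow_left₀ (norm_nonneg _) h 2
  rw [hv, mul_pow, Real.sq_sqrt hM0, hM, ← mul_div_assoc, le_div_iff₀ hn] at h2
  linarith

/-- The pseudo-Poincaré inequality in the form of a Faber–Krahn type inequality. -/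
lemma sum_sq_le_graphEnergy (hG : G.Connected) (hT : IsVertexTransitive G) (f : V → ℝ)
    (hf0 : ∀ x, 0 ≤ f x) (hf1 : ∑ x, f x = 1) (o : V) (r : ℕ) :
    2 * ∑ x, f x ^ 2 ≤ r ^ 2 * graphEnergy G f + 2 / ballCard G o r := by
  classical
  let : Fintype (G ≃g G) := Fintype.ofInjective _ (RelIso.toEquiv_injective (r := G.Adj))
  have : Nonempty V := ⟨o⟩
  have hn : (0 : ℝ) < Fintype.card V := by exact_mod_cast Fintype.card_pos
  have hΓ : (0 : ℝ) < Fintype.card (G ≃g G) := by exact_mod_cast Fintype.card_pos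
  let B : Finset V := Finset.univ.filter fun y => (G.dist o y : ℝ) ≤ r
  have hB : ballCard G o r = B.card := by
    rw [ballCard, Nat.card_coe_set_eq, ← Set.ncard_coe_finset]
    congr 1
    ext y
    simp [B]
  have hoB : o ∈ B := by simp [B]
  have hBpos : (0 : ℝ) < B.card := by exact_mod_cast Finset.card_pos.2 ⟨o, hoB⟩
  set E := graphEnergy G f with hE
  have hE0 : 0 ≤ E := graphEnergy_nonneg f
  set g : ℝ := (Fintype.card (G ≃g G) : ℝ) with hg
  set n : ℝ := (Fintype.card V : ℝ) with hn'
  have h1 : ∀ z ∈ B, n * ∑ γ : G ≃g G, (f (γ o) - f (γ z)) ^ 2 ≤ r ^ 2 * (g * E) := by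
    intro z hz
    refine (card_mul_sum_aut_sub_sq_le hG hT f o z).trans ?_
    have : (G.dist o z : ℝ) ≤ r := (Finset.mem_filter.1 hz).2
    gcongr
  have h2 : ∀ z, n * ∑ γ : G ≃g G, (f (γ o) - f (γ z)) ^ 2 =
      2 * (g * ∑ x, f x ^ 2) - 2 * n * ∑ γ : G ≃g G, f (γ o) * f (γ z) := by
    intro z
    have e1 := card_mul_sum_aut hT (fun x => f x ^ 2) o
    have e2 := card_mul_sum_aut hT (fun x => f x ^ 2) z
    have e3 : ∑ γ : G ≃g G, (f (γ o) - f (γ z)) ^ 2 = ∑ γ : G ≃g G, f (γ o) ^ 2 +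
        ∑ γ : G ≃g G, f (γ z) ^ 2 - 2 * ∑ γ : G ≃g G, f (γ o) * f (γ z) := by
      rw [Finset.mul_sum, ← Finset.sum_add_distrib, ← Finset.sum_sub_distrib]
      exact Finset.sum_congr rfl fun γ _ => by ring
    rw [e3]
    linarith
  have h3 : n * ∑ z ∈ B, ∑ γ : G ≃g G, f (γ o) * f (γ z) ≤ g := by
    have e1 := card_mul_sum_aut hT f o
    rw [hf1, mul_one] at e1
    rw [hg, ← e1, Finset.sum_comm]
    gcongr with γ
    rw [← Finset.mul_sum]
    refine mul_le_of_le_one_right (hf0 _) ?_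
    rw [← hf1, ← Fintype.sum_equiv γ.toEquiv (fun z => f (γ z)) f fun _ => rfl]
    exact Finset.sum_le_sum_of_subset_of_nonneg (Finset.subset_univ _) fun _ _ _ => hf0 _
  have h4 := Finset.sum_le_sum h1
  simp_rw [h2] at h4
  rw [Finset.sum_sub_distrib, Finset.sum_const, Finset.sum_const, nsmul_eq_mul, nsmul_eq_mul,
    ← Finset.mul_sum] at h4
  rw [hB]
  have h5 : (g * B.card) * (2 * ∑ x, f x ^ 2) ≤ (g * B.card) * (r ^ 2 * E + 2 / B.card) := by
    have : (g * B.card) * (r ^ 2 * E + 2 / B.card) = B.card * (r ^ 2 * (g * E)) + 2 * g := by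
      field_simp
    rw [this]
    linarith
  exact le_of_mul_le_mul_left h5 (by positivity)

end Energy

end TransitiveGrowth

namespace TransitiveGrowth

section LazyWalk

variable {V : Type} [Fintype V] [DecidableEq V] {G : SimpleGraph V} [DecidableRel G.Adj] {Δ : ℕ}

lemma lazyMatrix_apply (hΔ : ∀ x, G.degree x = Δ) (x y : V) :
    lazyMatrix (srwMatrix G) x y =
      2⁻¹ * ((if x = y then 1 else 0) + if G.Adj x y then (Δ : ℝ)⁻¹ else 0) := by
  simp [lazyMatrix, srwMatrix, hΔ, Matrix.one_apply]

lemma lazyMatrix_nonneg (x y : V) : 0 ≤ lazyMatrix (srwMatrix G) x y := by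
  simp only [lazyMatrix, srwMatrix, Matrix.smul_apply, Matrix.add_apply, Matrix.one_apply,
    smul_eq_mul]
  positivity

lemma lazyMatrix_pow_nonneg (t : ℕ) (x y : V) : 0 ≤ (lazyMatrix (srwMatrix G) ^ t) x y := by
  induction t generalizing y with
  | zero => rw [pow_zero, Matrix.one_apply]; positivity
  | succ t ih =>
    rw [pow_succ, Matrix.mul_apply]
    exact Finset.sum_nonneg fun z _ => mul_nonneg (ih z) (lazyMatrix_nonneg z y)

variable (hΔ : ∀ x, G.degree x = Δ)
include hΔ

lemma lazyMatrix_isSymm : (lazyMatrix (srwMatrix G)).IsSymm := by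
  refine Matrix.IsSymm.ext fun x y => ?_
  rw [lazyMatrix_apply hΔ, lazyMatrix_apply hΔ]
  simp only [G.adj_comm, eq_comm]

variable (h0 : 1 ≤ Δ)
include h0

lemma lazyMatrix_pow_succ_apply (t : ℕ) (o x : V) :
    (lazyMatrix (srwMatrix G) ^ (t + 1)) o x = (lazyMatrix (srwMatrix G) ^ t) o x +
      (2 * (Δ : ℝ))⁻¹ * ∑ y ∈ G.neighborFinset x,
        ((lazyMatrix (srwMatrix G) ^ t) o y - (lazyMatrix (srwMatrix G) ^ t) o x) := by
  have h0' : (Δ : ℝ) ≠ 0 := by positivity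
  rw [pow_succ, Matrix.mul_apply]
  generalize (lazyMatrix (srwMatrix G) ^ t) o = f
  simp_rw [lazyMatrix_apply hΔ]
  have h1 : ∀ y, f y * (2⁻¹ * ((if y = x then 1 else 0) + if G.Adj y x then (Δ : ℝ)⁻¹ else 0)) =
      (if y = x then 2⁻¹ * f y else 0) +
        if y ∈ G.neighborFinset x then (2 * (Δ : ℝ))⁻¹ * f y else 0 := by
    intro y
    simp only [G.mem_neighborFinset, G.adj_comm x y]
    split_ifs <;> simp <;> ring
  simp_rw [h1, Finset.sum_add_distrib, Finset.sum_sub_distrib]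
  rw [Finset.sum_ite_eq' , Finset.sum_ite_mem, Finset.univ_inter, ← Finset.mul_sum,
    Finset.sum_const, G.card_neighborFinset_eq_degree, hΔ, nsmul_eq_mul]
  simp only [Finset.mem_univ, if_true]
  field_simp
  ring

lemma sum_lazyMatrix_pow (t : ℕ) (o : V) : ∑ x, (lazyMatrix (srwMatrix G) ^ t) o x = 1 := by
  induction t with
  | zero => simp [Matrix.one_apply]
  | succ t ih =>
    simp_rw [lazyMatrix_pow_succ_apply hΔ h0]
    rw [Finset.sum_add_distrib, ih, ← Finset.mul_sum]
    generalize (lazyMatrix (srwMatrix G) ^ t) o = f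
    have h := sum_sum_neighborFinset_comm (G := G) fun x y => f y - f x
    have h2 : ∑ x, ∑ y ∈ G.neighborFinset x, (f x - f y) =
        - ∑ x, ∑ y ∈ G.neighborFinset x, (f y - f x) := by
      simp only [← Finset.sum_neg_distrib, neg_sub]
    have h3 : ∑ x, ∑ y ∈ G.neighborFinset x, (f y - f x) = 0 := by linarith
    rw [h3, mul_zero, add_zero]

omit h0 in
lemma lazyMatrix_pow_add_apply_self (s t : ℕ) (o : V) :
    (lazyMatrix (srwMatrix G) ^ (s + t)) o o =
      ∑ x, (lazyMatrix (srwMatrix G) ^ s) o x * (lazyMatrix (srwMatrix G) ^ t) o x := by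
  rw [pow_add, Matrix.mul_apply]
  refine Finset.sum_congr rfl fun x _ => ?_
  rw [((lazyMatrix_isSymm hΔ).pow t).apply]

lemma antitone_sum_sq_lazyMatrix_pow (o : V) :
    Antitone fun s : ℕ => ∑ x, (lazyMatrix (srwMatrix G) ^ s) o x ^ 2 := by
  refine antitone_nat_of_succ_le fun s => ?_
  have h := sum_sq_lazy_step_le hΔ h0 _ _ fun x => lazyMatrix_pow_succ_apply hΔ h0 s o x
  have h1 := graphEnergy_nonneg (G := G) ((lazyMatrix (srwMatrix G) ^ s) o)
  have h0' : (0 : ℝ) < 4 * Δ := by positivity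
  have := nonneg_of_mul_nonneg_right (h1.trans h) h0'
  linarith

/-- Return probabilities are controlled by the `ℓ²` norm at half the time. -/
lemma lazyMatrix_pow_self_le (t : ℕ) (o : V) :
    (lazyMatrix (srwMatrix G) ^ t) o o ≤ ∑ x, (lazyMatrix (srwMatrix G) ^ (t / 2)) o x ^ 2 := by
  obtain ⟨s, hs | hs⟩ := Nat.even_or_odd' t
  · rw [hs, Nat.mul_div_cancel_left _ (by norm_num), two_mul, lazyMatrix_pow_add_apply_self hΔ]
    simp only [sq, le_refl]
  · have hs2 : t / 2 = s := by omega
    rw [hs2, hs, show 2 * s + 1 = s + (s + 1) by ring, lazyMatrix_pow_add_apply_self hΔ]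
    have h := antitone_sum_sq_lazyMatrix_pow hΔ h0 o (Nat.le_succ s)
    simp only [Nat.succ_eq_add_one] at h
    have h2 : 2 * ∑ x, (lazyMatrix (srwMatrix G) ^ s) o x *
        (lazyMatrix (srwMatrix G) ^ (s + 1)) o x ≤
        ∑ x, (lazyMatrix (srwMatrix G) ^ s) o x ^ 2 +
          ∑ x, (lazyMatrix (srwMatrix G) ^ (s + 1)) o x ^ 2 := by
      rw [Finset.mul_sum, ← Finset.sum_add_distrib]
      refine Finset.sum_le_sum fun x _ => ?_
      linarith [two_mul_le_add_sq ((lazyMatrix (srwMatrix G) ^ s) o x)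
        ((lazyMatrix (srwMatrix G) ^ (s + 1)) o x)]
    linarith

end LazyWalk

section Balls

variable {V : Type} [Finite V] (G : SimpleGraph V) (o : V)

lemma ballCard_mono {s t : ℝ} (h : s ≤ t) : ballCard G o s ≤ ballCard G o t :=
  Nat.card_mono (Set.toFinite _) fun _ hy => le_trans (show (G.dist o _ : ℝ) ≤ s from hy) h

lemma ballCard_pos {s : ℝ} (h : 0 ≤ s) : 0 < ballCard G o s := by
  have : Nonempty {y : V | (G.dist o y : ℝ) ≤ s} := ⟨o, by simpa using h⟩
  exact Nat.card_pos

end Balls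

/-- Doubling implies the on-diagonal heat kernel bound. -/
lemma lazyMatrix_pow_self_le_of_doubling {Δ Q : ℕ} {c α : ℝ} (hΔ1 : 1 ≤ Δ) (hQ : 1 ≤ Q) {m : ℕ}
    (hm : α * Real.sqrt (64 * Q * Δ) ≤ 2 ^ m) (hα : 0 < α)
    {V : Type} [Fintype V] [DecidableEq V] {G : SimpleGraph V} [DecidableRel G.Adj]
    (hG : G.Connected) (hT : IsVertexTransitive G) (hΔ : ∀ x, G.degree x = Δ) (o : V)
    (hc : (ballCard G o 1 : ℝ) ≤ c)
    (hd : ∀ r : ℕ, 1 ≤ r → ballCard G o (2 * r : ℕ) ≤ Q * ballCard G o r) (t : ℕ) :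
    (lazyMatrix (srwMatrix G) ^ t) o o ≤
      ((2 + c) * Q ^ m) / (ballCard G o (α * Real.sqrt t) : ℝ) := by
  have hc0 : 0 < c := lt_of_lt_of_le (by exact_mod_cast ballCard_pos G o zero_le_one) hc
  have decay := decay_of_scale_inequality (A := 2 * Δ) (Q := Q) (c := c)
    (u := fun s => ∑ x, (lazyMatrix (srwMatrix G) ^ s) o x ^ 2)
    (W := fun r => (ballCard G o r : ℝ)) (by omega) hQ (antitone_sum_sq_lazyMatrix_pow hΔ hΔ1 o)
    (fun s => Finset.sum_nonneg fun _ _ => sq_nonneg _) (by simp [Matrix.one_apply])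
    (fun r => by exact_mod_cast ballCard_pos G o (Nat.cast_nonneg r)) (by simpa using hc)
    (fun r hr => by exact_mod_cast hd r hr) (fun s r hr => by
      have h1 := sum_sq_lazy_step_le hΔ hΔ1 _ _ fun x => lazyMatrix_pow_succ_apply hΔ hΔ1 s o x
      have h2 := sum_sq_le_graphEnergy hG hT _ (lazyMatrix_pow_nonneg s o)
        (sum_lazyMatrix_pow hΔ hΔ1 s o) o r
      have h3 := mul_le_mul_of_nonneg_left h1 (sq_nonneg (r : ℝ))
      rw [show (2 : ℝ) / ballCard G o r = 2 * (1 / ballCard G o r) by ring] at h2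
      push_cast
      linarith)
  have hdouble : ∀ k j : ℕ, ballCard G o (2 ^ (k + j) : ℕ) ≤ Q ^ j * ballCard G o (2 ^ k : ℕ) := by
    intro k j
    induction j with
    | zero => simp
    | succ j ih =>
      have h := hd (2 ^ (k + j)) Nat.one_le_two_pow
      rw [← pow_succ'] at h
      calc _ ≤ _ := h
        _ ≤ Q * (Q ^ j * ballCard G o (2 ^ k : ℕ)) := by gcongr
        _ = _ := by ring
  have hN : 1 ≤ 4 * Q * (2 * Δ) := Nat.one_le_iff_ne_zero.2 (by positivity)
  obtain ⟨k, hk1, hk2⟩ : ∃ k : ℕ, 4 * Q * (2 * Δ) * (4 ^ k - 1) ≤ t / 2 ∧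
      t / 2 < 4 * Q * (2 * Δ) * (4 ^ (k + 1) - 1) := by
    have hex : ∃ k : ℕ, t / 2 < 4 * Q * (2 * Δ) * (4 ^ k - 1) := by
      refine ⟨t / 2 + 1, ?_⟩
      have h1 : t / 2 + 1 < 4 ^ (t / 2 + 1) := Nat.lt_pow_self (by norm_num)
      calc t / 2 < 4 ^ (t / 2 + 1) - 1 := by omega
        _ ≤ _ := Nat.le_mul_of_pos_left _ hN
    rcases hfind : Nat.find hex with _ | k
    · have := Nat.find_spec hex
      rw [hfind] at this
      simp at this
    · refine ⟨k, not_lt.1 (Nat.find_min hex (by omega)), ?_⟩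
      have := Nat.find_spec hex
      rwa [hfind] at this
  have ht : (t : ℝ) ≤ (64 * Q * Δ) * (2 ^ k) ^ 2 := by
    have h1 : t ≤ 64 * Q * Δ * 4 ^ k := by
      have h4 : 1 ≤ 4 ^ (k + 1) := Nat.one_le_pow _ _ (by norm_num)
      obtain ⟨a, ha⟩ := Nat.exists_eq_add_of_le h4
      rw [ha, show 1 + a - 1 = a by omega] at hk2
      have h5 : 4 * 4 ^ k = 1 + a := by rw [← ha, pow_succ']
      have h6 : t < 2 * (4 * Q * (2 * Δ) * a) + 2 := by omega
      have h7 : 64 * Q * Δ * 4 ^ k = 2 * (4 * Q * (2 * Δ) * a) + 2 * (4 * Q * (2 * Δ)) := by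
        rw [show 64 * Q * Δ * 4 ^ k = 16 * Q * Δ * (4 * 4 ^ k) by ring, h5]
        ring
      omega
    have h2 : ((2 : ℝ) ^ k) ^ 2 = 4 ^ k := by
      rw [← pow_mul, mul_comm, pow_mul]
      norm_num
    rw [h2]
    exact_mod_cast h1
  have hsqrt : α * Real.sqrt t ≤ ((2 ^ (k + m) : ℕ) : ℝ) := by
    have h1 : Real.sqrt t ≤ Real.sqrt (64 * Q * Δ) * 2 ^ k := by
      refine (Real.sqrt_le_sqrt ht).trans_eq ?_
      rw [Real.sqrt_mul (by positivity), Real.sqrt_sq (by positivity)]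
    push_cast
    calc α * Real.sqrt t ≤ α * (Real.sqrt (64 * Q * Δ) * 2 ^ k) := by gcongr
      _ = (α * Real.sqrt (64 * Q * Δ)) * 2 ^ k := by ring
      _ ≤ 2 ^ m * 2 ^ k := by gcongr
      _ = 2 ^ (k + m) := by ring
  have hball : (ballCard G o (α * Real.sqrt t) : ℝ) ≤ Q ^ m * ballCard G o (2 ^ k : ℕ) := by
    exact_mod_cast (ballCard_mono G o hsqrt).trans (hdouble k m)
  have hpos : (0 : ℝ) < ballCard G o (α * Real.sqrt t) := by
    exact_mod_cast ballCard_pos G o (by positivity)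
  have hpos' : (0 : ℝ) < ballCard G o (2 ^ k : ℕ) := by
    exact_mod_cast ballCard_pos G o (Nat.cast_nonneg _)
  refine (lazyMatrix_pow_self_le hΔ hΔ1 t o).trans
    ((antitone_sum_sq_lazyMatrix_pow hΔ hΔ1 o hk1).trans ((decay k).trans ?_))
  rw [div_le_div_iff₀ hpos' hpos, mul_assoc]
  gcongr

end TransitiveGrowth

open TransitiveGrowth in
/-- On-diagonal heat-kernel upper bound `P_lazy^t(o,o) ≤ C'/V(α√t)` for
`t ≤ C·diam(G)²` on vertex-transitive graphs of polynomial growth. -/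
theorem stmt15 (Δ : ℕ) (c d : ℝ) (hc : 0 < c) (hd : 0 < d) :
    ∃ C : ℝ, 0 < C ∧ ∀ α : ℝ, 0 < α → ∃ C' : ℝ, 0 < C' ∧
      ∀ (V : Type) [Fintype V] [DecidableEq V] (G : SimpleGraph V) [DecidableRel G.Adj],
        G.Connected → IsVertexTransitive G → (∀ x, G.degree x = Δ) →
        (∀ (o : V) (r : ℕ), 1 ≤ r → (ballCard G o r : ℝ) ≤ c * (r : ℝ) ^ d) →
        ∀ (o : V) (t : ℕ), 1 ≤ t → (t : ℝ) ≤ C * (G.diam : ℝ) ^ 2 →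
          ((lazyMatrix (srwMatrix G)) ^ t) o o ≤ C' / (ballCard G o (α * Real.sqrt t) : ℝ) := by
  obtain ⟨Q, hQ⟩ := exists_ballCard_doubling c d
  refine ⟨1, one_pos, fun α hα => ?_⟩
  obtain ⟨m, hm⟩ := pow_unbounded_of_one_lt (α * Real.sqrt (64 * (Q + 1 : ℕ) * Δ))
    (one_lt_two : (1 : ℝ) < 2)
  refine ⟨(2 + c) * (Q + 1 : ℕ) ^ m, by positivity, fun V _ _ G _ hG hT hΔ hgr o t ht htd => ?_⟩
  have hdiam : G.diam ≠ 0 := by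
    intro h
    have : (1 : ℝ) ≤ t := by exact_mod_cast ht
    rw [h] at htd
    norm_num at htd
    omega
  have : Nontrivial V := SimpleGraph.nontrivial_of_diam_ne_zero hdiam
  have hΔ1 : 1 ≤ Δ := hΔ o ▸ hG.preconnected.degree_pos_of_nontrivial o
  refine lazyMatrix_pow_self_le_of_doubling hΔ1 (Nat.le_add_left 1 Q) hm.le hα hG hT hΔ o
    (by simpa using hgr o 1 le_rfl) (fun r hr => ?_) t
  exact (hQ V G hG hT hgr o r hr).trans (Nat.mul_le_mul_right _ (Nat.le_succ Q))
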